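/- Let F be a field other than the two-element field, and let σ : F → F be a nontrivial field involution (σ² = id, σ ≠ id). For every n ≥ 1, the stabilization map U_{n,n}(F,σ) → U_{n+1,n+1}(F,σ), extending an automorphism by the identity on an added hyperbolic plane, induces an isomorphism H_d(U_{n,n}(F,σ); ℤ) → H_d(U_{n+1,n+1}(F,σ); ℤ) for all d ≤ n − 1, and a surjection for d = n. -/

import Mathlib

/-! # Group homology via the inhomogeneous bar complex (trivial coefficients) -/

namespace GroupHomologyBar

variable (G : Type) [Group G] (A : Type) [AddCommGroup A]

/-- Inhomogeneous `n`-chains of `G` with coefficients in `A`. -/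
abbrev chains (n : ℕ) : Type := (Fin n → G) →₀ A

/-- The differential of the inhomogeneous bar complex with trivial `G`-action on the
coefficients, sending `[g₁|…|g_{n+1}] ⊗ a` to
`[g₂|…|g_{n+1}] ⊗ a + ∑ⱼ (-1)^{j+1} [g₁|…|gⱼg_{j+1}|…|g_{n+1}] ⊗ a`
(the last summand of the sum being `(-1)^{n+1} [g₁|…|g_n] ⊗ a`). -/
noncomputable def d (n : ℕ) : chains G A (n + 1) →ₗ[ℤ] chains G A n :=
  Finsupp.lsum ℤ fun g =>
    (Finsupp.lsingle (Fin.tail g) : A →ₗ[ℤ] chains G A n)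
      + ∑ j : Fin (n + 1),
          ((-1 : ℤ) ^ ((j : ℕ) + 1)) • Finsupp.lsingle (Fin.contractNth j (· * ·) g)

/-- The `n`-cycles. -/
noncomputable def cycles : (n : ℕ) → Submodule ℤ (chains G A n)
  | 0 => ⊤
  | (n + 1) => LinearMap.ker (d G A n)

/-- The `n`-boundaries, viewed as a submodule of the `n`-cycles. -/
noncomputable def boundaries (n : ℕ) : Submodule ℤ (cycles G A n) :=
  Submodule.comap (cycles G A n).subtype (LinearMap.range (d G A n))

/-- The group homology `H_n(G; A)` of `G` with trivial coefficients in `A`. -/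
abbrev Homology (n : ℕ) : Type := cycles G A n ⧸ boundaries G A n

variable {G}
variable {G' : Type} [Group G']

/-- The map on chains induced by a group homomorphism. -/
noncomputable def chainsMap (φ : G →* G') (n : ℕ) : chains G A n →ₗ[ℤ] chains G' A n :=
  Finsupp.lmapDomain A ℤ fun v => φ ∘ v

lemma chainsMap_single (φ : G →* G') {n : ℕ} (v : Fin n → G) (a : A) :
    chainsMap A φ n (Finsupp.single v a) = Finsupp.single (φ ∘ v) a := by
  simp [chainsMap, Finsupp.mapDomain_single]

lemma d_single {n : ℕ} (g : Fin (n + 1) → G) (a : A) :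
    d G A n (Finsupp.single g a)
      = Finsupp.single (Fin.tail g) a
        + ∑ j : Fin (n + 1),
            ((-1 : ℤ) ^ ((j : ℕ) + 1)) • Finsupp.single (Fin.contractNth j (· * ·) g) a := by
  simp [d, Finsupp.lsum_single]

lemma d_chainsMap (φ : G →* G') (n : ℕ) :
    (d G' A n).comp (chainsMap A φ (n + 1)) = (chainsMap A φ n).comp (d G A n) := by
  apply Finsupp.lhom_ext
  intro g a
  have hc : ∀ j : Fin (n + 1),
      φ ∘ Fin.contractNth j (· * ·) g = Fin.contractNth j (· * ·) (φ ∘ g) := by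
    intro j
    funext k
    simp only [Function.comp_apply, Fin.contractNth]
    split_ifs <;> simp
  simp only [LinearMap.comp_apply, chainsMap_single, d_single, map_add, map_sum, map_smul,
    chainsMap_single, Fin.comp_tail, hc]

lemma chainsMap_mem_cycles (φ : G →* G') (n : ℕ) :
    ∀ x ∈ cycles G A n, chainsMap A φ n x ∈ cycles G' A n := by
  intro x hx
  cases n with
  | zero => trivial
  | succ n =>
    simp only [cycles, LinearMap.mem_ker] at hx ⊢
    have := congrArg (fun L : chains G A (n + 1) →ₗ[ℤ] chains G' A n => L x) (d_chainsMap A φ n)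
    simp only [LinearMap.comp_apply] at this
    rw [this, hx, map_zero]

/-- The map on cycles induced by a group homomorphism. -/
noncomputable def cyclesMap (φ : G →* G') (n : ℕ) : cycles G A n →ₗ[ℤ] cycles G' A n :=
  (chainsMap A φ n).restrict (chainsMap_mem_cycles A φ n)

/-- The map `H_n(G; A) → H_n(G'; A)` on group homology induced by a group
homomorphism `φ : G →* G'`. -/
noncomputable def inducedMap (φ : G →* G') (n : ℕ) :
    Homology G A n →ₗ[ℤ] Homology G' A n :=
  Submodule.mapQ _ _ (cyclesMap A φ n) (by
    rintro ⟨x, hx⟩ hmem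
    simp only [boundaries, Submodule.mem_comap, Submodule.subtype_apply,
      LinearMap.mem_range] at hmem ⊢
    obtain ⟨y, hy⟩ := hmem
    refine ⟨chainsMap A φ (n + 1) y, ?_⟩
    have := congrArg (fun L : chains G A (n + 1) →ₗ[ℤ] chains G' A n => L y) (d_chainsMap A φ n)
    simp only [LinearMap.comp_apply] at this
    rw [this, hy]
    rfl)

end GroupHomologyBar

section Isometries

variable (F : Type) [Field F] {W : Type} [AddCommGroup W] [Module F W]

/-- The group of linear automorphisms of a vector space `V` preserving a
function `Q : V → F` (e.g. a quadratic form). -/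
def quadIsoms {V : Type} [AddCommGroup V] [Module F V] (Q : V → F) :
    Subgroup (V ≃ₗ[F] V) where
  carrier := {g | ∀ v, Q (g v) = Q v}
  one_mem' := fun _ => rfl
  mul_mem' := fun {a b} ha hb v => by
    rw [show (a * b) v = a (b v) from rfl, ha, hb]
  inv_mem' := fun {a} ha v => by
    rw [show (a⁻¹ : V ≃ₗ[F] V) v = a.symm v from rfl, ← ha (a.symm v), a.apply_symm_apply]

/-- The group of linear automorphisms of a vector space `V` preserving a
pairing `ω : V → V → F` (e.g. a bilinear or sesquilinear form). -/
def bilinIsoms {V : Type} [AddCommGroup V] [Module F V] (ω : V → V → F) :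
    Subgroup (V ≃ₗ[F] V) where
  carrier := {g | ∀ v w, ω (g v) (g w) = ω v w}
  one_mem' := fun _ _ => rfl
  mul_mem' := fun {a b} ha hb v w => by
    rw [show (a * b) v = a (b v) from rfl, show (a * b) w = a (b w) from rfl, ha, hb]
  inv_mem' := fun {a} ha v w => by
    rw [show (a⁻¹ : V ≃ₗ[F] V) v = a.symm v from rfl,
      show (a⁻¹ : V ≃ₗ[F] V) w = a.symm w from rfl,
      ← ha (a.symm v) (a.symm w), a.apply_symm_apply, a.apply_symm_apply]

/-- The "orthogonal sum" form `x ↦ ∑ i, q (x i)` on `W^n`. -/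
def sumForm (q : W → F) (n : ℕ) (x : Fin n → W) : F := ∑ i, q (x i)

/-- The "orthogonal sum" pairing `(x, y) ↦ ∑ i, β (x i) (y i)` on `W^n`. -/
def pairForm (β : W → W → F) (n : ℕ) (x y : Fin n → W) : F := ∑ i, β (x i) (y i)

/-- The linear equivalence `W^{n+1} ≃ W^n × W` splitting off the last coordinate. -/
def lastSplit (n : ℕ) : (Fin (n + 1) → W) ≃ₗ[F] (Fin n → W) × W where
  toLinearMap := (LinearMap.funLeft F W Fin.castSucc).prod (LinearMap.proj (Fin.last n))
  invFun p := Fin.snoc p.1 p.2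
  left_inv x := Fin.snoc_init_self x
  right_inv p := by
    refine Prod.ext (funext fun i => ?_) ?_
    · exact @Fin.snoc_castSucc n (fun _ => W) p.2 p.1 i
    · exact @Fin.snoc_last n (fun _ => W) p.2 p.1

lemma lastSplit_symm_apply (n : ℕ) (p : Fin n → W) (w : W) :
    (lastSplit F n).symm (p, w) = Fin.snoc p w := rfl

/-- Extension of an automorphism of `W^n` to `W^{n+1}` by the identity on the
added last coordinate. -/
def stabAut (n : ℕ) (g : (Fin n → W) ≃ₗ[F] (Fin n → W)) :
    (Fin (n + 1) → W) ≃ₗ[F] (Fin (n + 1) → W) :=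
  (lastSplit F n).trans ((g.prodCongr (LinearEquiv.refl F W)).trans (lastSplit F n).symm)

lemma stabAut_symm_apply (n : ℕ) (g : (Fin n → W) ≃ₗ[F] (Fin n → W))
    (p : Fin n → W) (w : W) :
    stabAut F n g ((lastSplit F n).symm (p, w)) = (lastSplit F n).symm (g p, w) := by
  simp [stabAut, LinearEquiv.trans_apply, LinearEquiv.apply_symm_apply, LinearEquiv.prodCongr_apply]

lemma sumForm_snoc (q : W → F) (n : ℕ) (p : Fin n → W) (w : W) :
    sumForm F q (n + 1) ((lastSplit F n).symm (p, w)) = sumForm F q n p + q w := by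
  simp [sumForm, lastSplit_symm_apply, Fin.sum_univ_castSucc, Fin.snoc_castSucc, Fin.snoc_last]

lemma pairForm_snoc (β : W → W → F) (n : ℕ) (p p' : Fin n → W) (w w' : W) :
    pairForm F β (n + 1) ((lastSplit F n).symm (p, w)) ((lastSplit F n).symm (p', w'))
      = pairForm F β n p p' + β w w' := by
  simp [pairForm, lastSplit_symm_apply, Fin.sum_univ_castSucc, Fin.snoc_castSucc, Fin.snoc_last]

/-- The stabilization homomorphism on the isometry group of the form `sumForm q n`,
extending an isometry by the identity on the added summand. -/
def quadStab (q : W → F) (n : ℕ) :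
    quadIsoms F (sumForm F q n) →* quadIsoms F (sumForm F q (n + 1)) where
  toFun g := ⟨stabAut F n g.1, by
    intro v
    obtain ⟨⟨p, w⟩, rfl⟩ : ∃ x, (lastSplit F n).symm x = v :=
      ⟨lastSplit F n v, (lastSplit F n).symm_apply_apply v⟩
    rw [stabAut_symm_apply, sumForm_snoc, sumForm_snoc, g.2 p]⟩
  map_one' := by
    refine Subtype.ext (LinearEquiv.ext fun v => ?_)
    show stabAut F n 1 v = v
    obtain ⟨⟨p, w⟩, rfl⟩ : ∃ x, (lastSplit F n).symm x = v :=
      ⟨lastSplit F n v, (lastSplit F n).symm_apply_apply v⟩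
    rw [stabAut_symm_apply]
    rfl
  map_mul' g h := by
    refine Subtype.ext (LinearEquiv.ext fun v => ?_)
    show stabAut F n (g.1 * h.1) v = stabAut F n g.1 (stabAut F n h.1 v)
    obtain ⟨⟨p, w⟩, rfl⟩ : ∃ x, (lastSplit F n).symm x = v :=
      ⟨lastSplit F n v, (lastSplit F n).symm_apply_apply v⟩
    rw [stabAut_symm_apply, stabAut_symm_apply, stabAut_symm_apply]
    rfl

/-- The stabilization homomorphism on the isometry group of the pairing `pairForm β n`,
extending an isometry by the identity on the added summand. -/
def bilinStab (β : W → W → F) (n : ℕ) :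
    bilinIsoms F (pairForm F β n) →* bilinIsoms F (pairForm F β (n + 1)) where
  toFun g := ⟨stabAut F n g.1, by
    intro v v'
    obtain ⟨⟨p, w⟩, rfl⟩ : ∃ x, (lastSplit F n).symm x = v :=
      ⟨lastSplit F n v, (lastSplit F n).symm_apply_apply v⟩
    obtain ⟨⟨p', w'⟩, rfl⟩ : ∃ x, (lastSplit F n).symm x = v' :=
      ⟨lastSplit F n v', (lastSplit F n).symm_apply_apply v'⟩
    rw [stabAut_symm_apply, stabAut_symm_apply, pairForm_snoc, pairForm_snoc, g.2 p p']⟩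
  map_one' := by
    refine Subtype.ext (LinearEquiv.ext fun v => ?_)
    show stabAut F n 1 v = v
    obtain ⟨⟨p, w⟩, rfl⟩ : ∃ x, (lastSplit F n).symm x = v :=
      ⟨lastSplit F n v, (lastSplit F n).symm_apply_apply v⟩
    rw [stabAut_symm_apply]
    rfl
  map_mul' g h := by
    refine Subtype.ext (LinearEquiv.ext fun v => ?_)
    show stabAut F n (g.1 * h.1) v = stabAut F n g.1 (stabAut F n h.1 v)
    obtain ⟨⟨p, w⟩, rfl⟩ : ∃ x, (lastSplit F n).symm x = v :=
      ⟨lastSplit F n v, (lastSplit F n).symm_apply_apply v⟩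
    rw [stabAut_symm_apply, stabAut_symm_apply, stabAut_symm_apply]
    rfl

end Isometries

/-- The hyperbolic Hermitian pairing (with respect to an involution `σ`) on `F² = F × F`. -/
def hermPair (F : Type) [Field F] (σ : F → F) (s t : F × F) : F := σ s.1 * t.2 + σ s.2 * t.1

set_option linter.unusedVariables false
set_option linter.unusedSimpArgs false

namespace HS

/-- Free abelian group on `n`-tuples. -/
abbrev TC (n : ℕ) (A : Type) : Type := FreeAbelianGroup (Fin n → A)

open FreeAbelianGroup

section tuples
variable {A B : Type}

/-- the map induced by a function on the entries -/
noncomputable def tmap {n : ℕ} (f : A → B) : TC n A →+ TC n B :=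
  FreeAbelianGroup.map (fun l => f ∘ l)

@[simp] lemma tmap_of {n : ℕ} (f : A → B) (l : Fin n → A) :
    tmap f (of l) = of (f ∘ l) := by simp [tmap]

/-- prepend an entry -/
noncomputable def cone {n : ℕ} (a : A) : TC n A →+ TC (n + 1) A :=
  FreeAbelianGroup.map (fun l => Fin.cons a l)

@[simp] lemma cone_of {n : ℕ} (a : A) (l : Fin n → A) :
    cone a (of l) = of (Fin.cons a l : Fin (n + 1) → A) := by simp [cone]

noncomputable def bdT {n : ℕ} (l : Fin (n + 1) → A) : TC n A :=
  ∑ i : Fin (n + 1), ((-1 : ℤ) ^ (i : ℕ)) • of (fun j => l (i.succAbove j))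

noncomputable def bd {n : ℕ} : TC (n + 1) A →+ TC n A := FreeAbelianGroup.lift bdT

@[simp] lemma bd_of {n : ℕ} (l : Fin (n + 1) → A) : bd (of l) = bdT l := by simp [bd]

lemma bdT_cons {n : ℕ} (a : A) (l : Fin (n + 1) → A) :
    bdT (Fin.cons a l : Fin (n + 2) → A) = of l - cone a (bdT l) := by
  unfold bdT
  rw [Fin.sum_univ_succ]
  simp only [map_sum, map_zsmul, cone_of]
  rw [sub_eq_add_neg, ← Finset.sum_neg_distrib]
  refine congrArg₂ (· + ·) ?_ ?_
  · simp
  · refine Finset.sum_congr rfl fun i _ => ?_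
    rw [Fin.val_succ, pow_succ, mul_neg_one, neg_smul]
    congr 3
    funext j
    refine Fin.cases ?_ (fun j => ?_) j
    · simp
    · simp

lemma bdT_cons_zero (a : A) (l : Fin 0 → A) :
    bdT (Fin.cons a l : Fin 1 → A) = of l := by
  simp only [bdT, Fin.sum_univ_succ, Fin.val_zero, pow_zero, one_smul]
  simp

lemma bd_cone {n : ℕ} (a : A) (x : TC (n + 1) A) :
    bd (cone a x) = x - cone a (bd x) := by
  have : (bd.comp (cone a) : TC (n+1) A →+ TC (n+1) A)
      = AddMonoidHom.id _ - (cone a).comp bd := by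
    apply FreeAbelianGroup.lift_ext
    intro l
    simp [bdT_cons]
  exact DFunLike.congr_fun this x

lemma bd_bd {n : ℕ} (x : TC (n + 2) A) : bd (bd x) = 0 := by
  have : (bd.comp bd : TC (n+2) A →+ TC n A) = 0 := by
    apply FreeAbelianGroup.lift_ext
    intro l
    simp only [AddMonoidHom.comp_apply, bd_of, AddMonoidHom.zero_apply]
    clear x
    induction n with
    | zero =>
      rw [← Fin.cons_self_tail l, bdT_cons, ← Fin.cons_self_tail (Fin.tail l), bdT_cons_zero,
        cone_of, map_sub, bd_of, bd_of, bdT_cons_zero, bdT_cons_zero, sub_self]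
    | succ n ih =>
      rw [← Fin.cons_self_tail l, bdT_cons, map_sub, bd_of, bd_cone, ih, map_zero]
      simp
  exact DFunLike.congr_fun this x

lemma tmap_cone {n : ℕ} (f : A → B) (a : A) (x : TC n A) :
    tmap f (cone a x) = cone (f a) (tmap f x) := by
  have : ((tmap f).comp (cone a) : TC n A →+ TC (n+1) B) = (cone (f a)).comp (tmap f) := by
    apply FreeAbelianGroup.lift_ext
    intro l
    simp only [AddMonoidHom.comp_apply, cone_of, tmap_of]
    congr 1
    funext j
    refine Fin.cases ?_ (fun j => ?_) j <;> simp
  exact DFunLike.congr_fun this x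

lemma tmap_bdT {n : ℕ} (f : A → B) (l : Fin (n+1) → A) :
    tmap f (bdT l) = bdT (f ∘ l) := by
  simp only [bdT, map_sum, map_zsmul, tmap_of]
  rfl

lemma tmap_bd {n : ℕ} (f : A → B) (x : TC (n+1) A) : tmap f (bd x) = bd (tmap f x) := by
  have : ((tmap f).comp bd : TC (n+1) A →+ TC n B) = bd.comp (tmap f) := by
    apply FreeAbelianGroup.lift_ext
    intro l
    simp [tmap_bdT]
  exact DFunLike.congr_fun this x

lemma tmap_tmap {C : Type} {n : ℕ} (f : A → B) (g : B → C) (x : TC n A) :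
    tmap g (tmap f x) = tmap (g ∘ f) x := by
  have : ((tmap g).comp (tmap f) : TC n A →+ TC n C) = tmap (g ∘ f) := by
    apply FreeAbelianGroup.lift_ext
    intro l
    simp [Function.comp_assoc]
  exact DFunLike.congr_fun this x

lemma tmap_id {n : ℕ} (x : TC n A) : tmap id x = x := by
  have : (tmap id : TC n A →+ TC n A) = AddMonoidHom.id _ := by
    apply FreeAbelianGroup.lift_ext
    intro l
    simp
  exact DFunLike.congr_fun this x

/-- the prism -/
noncomputable def Pr : (n : ℕ) → (Fin n → A × A) → TC (n + 1) A
  | 0, _ => 0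
  | n + 1, p => of (Fin.cons (p 0).1 (Fin.cons (p 0).2 (fun j => (p j.succ).2)))
      - cone (p 0).1 (Pr n (Fin.tail p))

noncomputable def PrH {n : ℕ} : TC n (A × A) →+ TC (n + 1) A := FreeAbelianGroup.lift (Pr n)

@[simp] lemma PrH_of {n : ℕ} (p : Fin n → A × A) : PrH (of p) = Pr n p := by simp [PrH]

lemma PrH_cone {n : ℕ} (a b : A) (y : TC n (A × A)) :
    PrH (cone (a, b) y) = cone a (cone b (tmap Prod.snd y)) - cone a (PrH y) := by
  have : (PrH.comp (cone (a, b)) : TC n (A × A) →+ TC (n+2) A)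
      = ((cone a).comp (cone b)).comp (tmap Prod.snd) - (cone a).comp PrH := by
    apply FreeAbelianGroup.lift_ext
    intro l
    simp [Pr]
    rfl
  exact DFunLike.congr_fun this y

lemma bd_Pr {n : ℕ} (p : Fin (n + 1) → A × A) :
    bd (Pr (n + 1) p) = of (Prod.snd ∘ p) - of (Prod.fst ∘ p) - PrH (bdT p) := by
  induction n with
  | zero =>
    rw [← Fin.cons_self_tail p, bdT_cons_zero, PrH_of]
    simp only [Pr, map_zero, sub_zero, bd_of, bdT_cons, bdT_cons_zero, cone_of]
    congr 1
    · congr 1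
      funext j
      refine Fin.cases ?_ (fun j => j.elim0) j
      simp
    · congr 1
      funext j
      refine Fin.cases ?_ (fun j => j.elim0) j
      simp
  | succ n ih =>
    have hs : (Prod.snd ∘ p : Fin (n+2) → A)
        = Fin.cons (p 0).2 (Prod.snd ∘ Fin.tail p) := by
      funext j
      refine Fin.cases ?_ (fun j => ?_) j <;> simp [Fin.tail]
    have hf : (Prod.fst ∘ p : Fin (n+2) → A)
        = Fin.cons (p 0).1 (Prod.fst ∘ Fin.tail p) := by
      funext j
      refine Fin.cases ?_ (fun j => ?_) j <;> simp [Fin.tail]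
    have hb : bdT p = of (Fin.tail p) - cone ((p 0).1, (p 0).2) (bdT (Fin.tail p)) := by
      conv_lhs => rw [← Fin.cons_self_tail p]
      exact bdT_cons _ _
    have hsn : (fun j : Fin (n+1) => (p j.succ).2) = Prod.snd ∘ Fin.tail p := rfl
    rw [Pr, map_sub, bd_of, bdT_cons, bdT_cons, bd_cone, ih, hb, map_sub PrH, PrH_of, PrH_cone,
      hs, hf, hsn, ← cone_of, ← cone_of, tmap_bdT]
    simp only [map_sub]
    abel

lemma bd_PrH {n : ℕ} (y : TC (n + 1) (A × A)) :
    bd (PrH y) = tmap Prod.snd y - tmap Prod.fst y - PrH (bd y) := by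
  have : (bd.comp PrH : TC (n+1) (A × A) →+ TC (n+1) A)
      = tmap Prod.snd - tmap Prod.fst - PrH.comp bd := by
    apply FreeAbelianGroup.lift_ext
    intro l
    simp [bd_Pr]
  exact DFunLike.congr_fun this y

lemma tmap_Pr {n : ℕ} (f : A → B) (p : Fin n → A × A) :
    tmap f (Pr n p) = Pr n (fun i => (f (p i).1, f (p i).2)) := by
  induction n with
  | zero => simp [Pr]
  | succ n ih =>
    simp only [Pr, map_sub, tmap_cone, ih, tmap_of]
    congr 2
    funext j
    refine Fin.cases ?_ (fun j => ?_) j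
    · simp
    · refine Fin.cases ?_ (fun j => ?_) j <;> simp

lemma PrH_tmap {n : ℕ} (f : A → B) (y : TC n (A × A)) :
    tmap f (PrH y) = PrH (tmap (Prod.map f f) y) := by
  have : ((tmap f).comp PrH : TC n (A × A) →+ TC (n+1) B)
      = PrH.comp (tmap (Prod.map f f)) := by
    apply FreeAbelianGroup.lift_ext
    intro l
    simp [tmap_Pr]
    rfl
  exact DFunLike.congr_fun this y

/-- A homomorphism killing every tuple in which the two prism entries of some index occur,
with all other entries from the corresponding pairs, kills the prism. -/
lemma Pr_support {E : Type} [AddCommGroup E] {n : ℕ} (p : Fin n → A × A)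
    (Φ : TC (n + 1) A →+ E)
    (h : ∀ l : Fin (n + 1) → A, (∃ i, ∃ r : Fin (n+1) , r = i.castSucc ∧
        l r = (p i).1 ∧ l i.succ = (p i).2 ∧
        (∀ j : Fin n, (j < i → l j.castSucc = (p j).1) ∧ (i < j → l j.succ = (p j).2))) →
        Φ (of l) = 0) : Φ (Pr n p) = 0 := by
  induction n with
  | zero => simp [Pr]
  | succ n ih =>
    rw [Pr, map_sub]
    rw [h, zero_sub, neg_eq_zero]
    · have := ih (Fin.tail p) (Φ.comp (cone (p 0).1)) ?_
      · simpa using this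
      · rintro l ⟨i, r, rfl, h1, h2, h3⟩
        simp only [AddMonoidHom.comp_apply, cone_of]
        apply h
        refine ⟨i.succ, i.succ.castSucc, rfl, ?_, ?_, ?_⟩
        · rw [← Fin.succ_castSucc, Fin.cons_succ]; exact h1
        · rw [Fin.cons_succ]; exact h2
        · intro j
          refine Fin.cases ?_ (fun j => ?_) j
          · refine ⟨fun _ => by simp, fun hj => absurd hj (by simp)⟩
          · refine ⟨fun hj => ?_, fun hj => ?_⟩
            · rw [← Fin.succ_castSucc, Fin.cons_succ]
              exact (h3 j).1 (by simpa using hj)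
            · rw [Fin.cons_succ]
              exact (h3 j).2 (by simpa using hj)
    · refine ⟨0, 0, rfl, by simp, by simp, fun j => ⟨fun hj => absurd hj (by simp), fun hj => ?_⟩⟩
      obtain ⟨j, rfl⟩ := Fin.exists_succ_eq.mpr (Fin.pos_iff_ne_zero.mp hj)
      simp

end tuples

end HS

set_option linter.unusedVariables false
set_option linter.unusedSimpArgs false

namespace HS
open FreeAbelianGroup

section chains
variable {G : Type} [Group G]

/-- cells: nonempty tuples of group elements together with an element of `S`. -/
structure Cell (G S : Type) (n : ℕ) : Type where
  x : Fin n → G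
  t : S
  pos : 0 < n

instance (S : Type) [MulAction G S] (n : ℕ) : MulAction G (Cell G S n) where
  smul g c := ⟨fun i => g * c.x i, g • c.t, c.pos⟩
  one_smul c := by
    show (⟨fun i => 1 * c.x i, (1 : G) • c.t, c.pos⟩ : Cell G S n) = c
    simp
  mul_smul g h c := by
    show (⟨fun i => (g * h) * c.x i, (g * h) • c.t, c.pos⟩ : Cell G S n)
      = ⟨fun i => g * (h * c.x i), g • h • c.t, c.pos⟩
    simp [mul_assoc, mul_smul]

/-- chains: free abelian group on the orbits of cells. -/
def Ch (G S : Type) [Group G] [MulAction G S] (n : ℕ) : Type :=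
  FreeAbelianGroup (MulAction.orbitRel.Quotient G (Cell G S n))

noncomputable instance (S : Type) [MulAction G S] (n : ℕ) : AddCommGroup (Ch G S n) :=
  inferInstanceAs (AddCommGroup (FreeAbelianGroup _))

variable {S S₂ S₃ : Type} [MulAction G S] [MulAction G S₂] [MulAction G S₃]
variable {B : Type} [AddCommGroup B]

instance : Subsingleton (Ch G S 0) := by
  have : IsEmpty (MulAction.orbitRel.Quotient G (Cell G S 0)) :=
    ⟨fun q => Quotient.inductionOn q fun c => absurd c.pos (lt_irrefl _)⟩
  refine ⟨fun a b => ?_⟩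
  have : ∀ a : FreeAbelianGroup (MulAction.orbitRel.Quotient G (Cell G S 0)), a = 0 := by
    intro a
    induction a using FreeAbelianGroup.induction_on with
    | zero => rfl
    | of x => exact isEmptyElim x
    | neg x _ => exact isEmptyElim x
    | add x y hx hy => rw [hx, hy, add_zero]
  exact (this a).trans (this b).symm

/-- basis elements -/
noncomputable def cel₀ {n : ℕ} (c : Cell G S n) : Ch G S n :=
  of (Quotient.mk (MulAction.orbitRel G (Cell G S n)) c)

noncomputable def cel {n : ℕ} (x : Fin n → G) (t : S) : Ch G S n :=
  if h : 0 < n then cel₀ ⟨x, t, h⟩ else 0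

lemma cel₀_eq {n : ℕ} (c : Cell G S n) : cel₀ c = cel c.x c.t := by
  unfold cel
  rw [dif_pos c.pos]

lemma cel_smul {n : ℕ} (g : G) (x : Fin n → G) (t : S) :
    cel (fun i => g * x i) (g • t) = cel x t := by
  unfold cel
  by_cases h : 0 < n
  · rw [dif_pos h, dif_pos h]
    exact congrArg of (Quotient.sound (s := MulAction.orbitRel G (Cell G S n)) ⟨g, rfl⟩)
  · rw [dif_neg h, dif_neg h]

noncomputable def Ch.lift {n : ℕ} (F : (Fin n → G) → S → B)
    (hF : ∀ g x t, F (fun i => g * x i) (g • t) = F x t) : Ch G S n →+ B :=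
  FreeAbelianGroup.lift (fun q => Quotient.liftOn q (fun c : Cell G S n => F c.x c.t) (by
    rintro a b ⟨g, rfl⟩
    exact hF g b.x b.t))

lemma Ch.lift_cel₀ {n : ℕ} (F : (Fin n → G) → S → B) (hF) (c : Cell G S n) :
    Ch.lift F hF (cel₀ c) = F c.x c.t :=
  FreeAbelianGroup.lift_apply_of _ _

lemma Ch.lift_cel {n : ℕ} (F : (Fin n → G) → S → B) (hF) (hn : n = 0 → ∀ x t, F x t = 0)
    (x : Fin n → G) (t : S) : Ch.lift F hF (cel x t) = F x t := by
  by_cases h : 0 < n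
  · have := Ch.lift_cel₀ F hF ⟨x, t, h⟩
    rwa [cel₀_eq] at this
  · have : cel x t = 0 := by
      unfold cel
      rw [dif_neg h]
    rw [this, map_zero, hn (by omega)]

lemma Ch.ext {n : ℕ} {f g : Ch G S n →+ B} (h : ∀ x t, f (cel x t) = g (cel x t)) : f = g := by
  apply FreeAbelianGroup.lift_ext
  intro q
  induction q using Quotient.inductionOn with
  | h c =>
    have := h c.x c.t
    rw [← cel₀_eq] at this
    exact this

lemma Ch.ind {n : ℕ} {P : Ch G S n → Prop} (z : Ch G S n) (h0 : P 0)
    (hc : ∀ x t, P (cel x t)) (hn : ∀ a, P a → P (-a)) (ha : ∀ a b, P a → P b → P (a + b)) :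
    P z := by
  induction z using FreeAbelianGroup.induction_on with
  | zero => exact h0
  | of q =>
    induction q using Quotient.inductionOn with
    | h c =>
      have := hc c.x c.t
      rw [← cel₀_eq] at this
      exact this
  | neg q h => exact hn _ h
  | add x y hx hy => exact ha _ _ hx hy

lemma cel_zero (x : Fin 0 → G) (t : S) : cel x t = 0 := Subsingleton.elim _ _

/-- linear extension of `cel` in the group variables -/
noncomputable def push {n : ℕ} (t : S) : TC n G →+ Ch G S n :=
  FreeAbelianGroup.lift (fun x => cel x t)

@[simp] lemma push_of {n : ℕ} (t : S) (x : Fin n → G) : push t (of x) = cel x t := by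
  simp [push]

lemma push_smul {n : ℕ} (g : G) (t : S) (x : TC n G) :
    push (g • t) (tmap (g * ·) x) = push t x := by
  have : ((push (g • t)).comp (tmap (g * ·)) : TC n G →+ Ch G S n) = push t := by
    apply FreeAbelianGroup.lift_ext
    intro l
    simp only [AddMonoidHom.comp_apply, tmap_of, push_of]
    exact cel_smul g l t
  exact DFunLike.congr_fun this x

/-- lift for families of homs on tuples -/
noncomputable def Ch.plift {n : ℕ} (F : S → TC n G →+ B)
    (hF : ∀ g x t, F (g • t) (tmap (g * ·) x) = F t x) : Ch G S n →+ B :=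
  Ch.lift (fun x t => F t (of x)) (fun g x t => by
    have := hF g (of x) t
    rw [tmap_of] at this
    exact this)

lemma Ch.plift_push {n : ℕ} (F : S → TC n G →+ B) (hF) (hn : n = 0 → ∀ x t, F t x = 0)
    (t : S) (x : TC n G) : Ch.plift F hF (push t x) = F t x := by
  have : ((Ch.plift F hF).comp (push t) : TC n G →+ B) = F t := by
    apply FreeAbelianGroup.lift_ext
    intro l
    simp only [AddMonoidHom.comp_apply, push_of]
    unfold Ch.plift
    rw [Ch.lift_cel]
    intro h x t
    exact hn h _ t
  exact DFunLike.congr_fun this x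

lemma Ch.pext {n : ℕ} {f g : Ch G S n →+ B} (h : ∀ x t, f (push t x) = g (push t x)) : f = g :=
  Ch.ext fun x t => by simpa using h (of x) t

/-- boundary -/
noncomputable def Ch.d {n : ℕ} : Ch G S (n + 1) →+ Ch G S n :=
  Ch.plift (fun t => (push t).comp bd) (fun g x t => by
    simp only [AddMonoidHom.comp_apply]
    rw [← tmap_bd, push_smul])

lemma Ch.d_push {n : ℕ} (t : S) (x : TC (n + 1) G) :
    Ch.d (push t x) = push t (bd x) := by
  unfold Ch.d
  rw [Ch.plift_push _ _ (by omega)]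
  rfl

lemma Ch.d_d {n : ℕ} (z : Ch G S (n + 2)) : Ch.d (Ch.d z) = 0 := by
  have : (Ch.d.comp Ch.d : Ch G S (n+2) →+ Ch G S n) = 0 := by
    apply Ch.pext
    intro x t
    simp [Ch.d_push, bd_bd]
  exact DFunLike.congr_fun this z

/-- boundary, total version -/
noncomputable def Ch.dd : (n : ℕ) → Ch G S n →+ Ch G S (n - 1)
  | 0 => 0
  | n + 1 => (Ch.d : Ch G S (n + 1) →+ Ch G S n)

/-- functoriality in the configuration set -/
noncomputable def Ch.map {n : ℕ} (f : S → S₂) (hf : ∀ (g : G) s, f (g • s) = g • f s) :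
    Ch G S n →+ Ch G S₂ n :=
  Ch.plift (fun t => push (f t)) (fun g x t => by rw [hf, push_smul])

lemma Ch.map_push {n : ℕ} (f : S → S₂) (hf : ∀ (g : G) s, f (g • s) = g • f s)
    (t : S) (x : TC n G) : Ch.map f hf (push t x) = push (f t) x := by
  unfold Ch.map
  rw [Ch.plift_push]
  rintro rfl x t
  exact Subsingleton.elim _ _

lemma Ch.map_cel {n : ℕ} (f : S → S₂) (hf : ∀ (g : G) s, f (g • s) = g • f s)
    (t : S) (x : Fin n → G) : Ch.map f hf (cel x t) = cel x (f t) := by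
  rw [← push_of, Ch.map_push, push_of]

lemma Ch.d_map {n : ℕ} (f : S → S₂) (hf : ∀ (g : G) s, f (g • s) = g • f s)
    (z : Ch G S (n + 1)) : Ch.d (Ch.map f hf z) = Ch.map f hf (Ch.d z) := by
  have : (Ch.d.comp (Ch.map f hf) : Ch G S (n+1) →+ Ch G S₂ n) = (Ch.map f hf).comp Ch.d := by
    apply Ch.pext
    intro x t
    simp [Ch.d_push, Ch.map_push]
  exact DFunLike.congr_fun this z

lemma Ch.dd_map {n : ℕ} (f : S → S₂) (hf : ∀ (g : G) s, f (g • s) = g • f s)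
    (z : Ch G S n) : Ch.dd n (Ch.map f hf z) = Ch.map f hf (Ch.dd n z) := by
  cases n with
  | zero => exact Subsingleton.elim (α := Ch G S₂ 0) _ _
  | succ n => exact Ch.d_map f hf z

lemma Ch.map_map {n : ℕ} (f : S → S₂) (hf : ∀ (g : G) s, f (g • s) = g • f s)
    (f' : S₂ → S₃) (hf' : ∀ (g : G) s, f' (g • s) = g • f' s) (z : Ch G S n) :
    Ch.map f' hf' (Ch.map f hf z)
      = Ch.map (fun s => f' (f s)) (fun g s => by rw [hf, hf']) z := by
  have : ((Ch.map f' hf').comp (Ch.map f hf) : Ch G S n →+ Ch G S₃ n)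
      = Ch.map (fun s => f' (f s)) (fun g s => by rw [hf, hf']) := by
    apply Ch.pext
    intro x t
    simp [Ch.map_push]
  exact DFunLike.congr_fun this z

lemma Ch.map_id' {n : ℕ} (f : S → S) (hf : ∀ (g : G) s, f (g • s) = g • f s)
    (h : ∀ s, f s = s) (z : Ch G S n) : Ch.map f hf z = z := by
  have : (Ch.map f hf : Ch G S n →+ Ch G S n) = AddMonoidHom.id _ := by
    apply Ch.pext
    intro x t
    simp [Ch.map_push, h]
  exact DFunLike.congr_fun this z

/-- change of vertices -/
noncomputable def Ch.vert {n : ℕ} (m : G → S → G) (hm : ∀ g x t, m (g * x) (g • t) = g * m x t) :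
    Ch G S n →+ Ch G S n :=
  Ch.plift (fun t => (push t).comp (tmap (fun x => m x t))) (fun g x t => by
    simp only [AddMonoidHom.comp_apply, tmap_tmap]
    rw [← push_smul g t, tmap_tmap]
    congr 3
    funext y
    simp [hm])

lemma Ch.vert_push {n : ℕ} (m : G → S → G) (hm : ∀ g x t, m (g * x) (g • t) = g * m x t)
    (t : S) (x : TC n G) : Ch.vert m hm (push t x) = push t (tmap (fun x => m x t) x) := by
  unfold Ch.vert
  rw [Ch.plift_push]
  · rfl
  · rintro rfl x t
    exact Subsingleton.elim _ _

/-- prism operator -/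
noncomputable def Ch.pri {n : ℕ} (m : G → S → G) (hm : ∀ g x t, m (g * x) (g • t) = g * m x t) :
    Ch G S n →+ Ch G S (n + 1) :=
  Ch.plift (fun t => (push t).comp (PrH.comp (tmap (fun x => (x, m x t))))) (fun g x t => by
    simp only [AddMonoidHom.comp_apply, tmap_tmap]
    rw [← push_smul g t, PrH_tmap, tmap_tmap]
    congr 4
    funext y
    simp [hm])

lemma Ch.pri_push {n : ℕ} (m : G → S → G) (hm : ∀ g x t, m (g * x) (g • t) = g * m x t)
    (t : S) (x : TC n G) :
    Ch.pri m hm (push t x) = push t (PrH (tmap (fun x => (x, m x t)) x)) := by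
  unfold Ch.pri
  rw [Ch.plift_push]
  · rfl
  · rintro rfl x t
    have : (PrH.comp (tmap (fun x => (x, m x t))) : TC 0 G →+ TC 1 G) = 0 := by
      apply FreeAbelianGroup.lift_ext
      intro l
      simp [Pr]
    rw [this]
    simp

lemma Ch.d_pri {n : ℕ} (m : G → S → G) (hm : ∀ g x t, m (g * x) (g • t) = g * m x t)
    (z : Ch G S (n + 1)) :
    Ch.d (Ch.pri m hm z) = Ch.vert m hm z - z - Ch.pri m hm (Ch.d z) := by
  have : (Ch.d.comp (Ch.pri m hm) : Ch G S (n+1) →+ Ch G S (n+1))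
      = Ch.vert m hm - AddMonoidHom.id _ - (Ch.pri m hm).comp Ch.d := by
    apply Ch.pext
    intro x t
    simp only [AddMonoidHom.comp_apply, AddMonoidHom.sub_apply, AddMonoidHom.id_apply,
      Ch.pri_push, Ch.vert_push, Ch.d_push, bd_PrH, tmap_tmap, map_sub, ← tmap_bd]
    congr 2
    exact congrArg _ (tmap_id x)
  exact DFunLike.congr_fun this z

lemma Ch.d_pri_of_cycle {n : ℕ} (m : G → S → G) (hm : ∀ g x t, m (g * x) (g • t) = g * m x t)
    (z : Ch G S n) (hz : Ch.dd n z = 0) :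
    Ch.d (Ch.pri m hm z) = Ch.vert m hm z - z := by
  cases n with
  | zero => exact Subsingleton.elim _ _
  | succ n => rw [Ch.d_pri, show Ch.d z = 0 from hz, map_zero, sub_zero]

/-- naturality of the prism -/
lemma Ch.map_pri {n : ℕ} (f : S → S₂) (hf : ∀ (g : G) s, f (g • s) = g • f s)
    (m : G → S → G) (hm) (m₂ : G → S₂ → G) (hm₂) (h : ∀ x t, m₂ x (f t) = m x t)
    (z : Ch G S n) : Ch.map f hf (Ch.pri m hm z) = Ch.pri m₂ hm₂ (Ch.map f hf z) := by
  have : ((Ch.map f hf).comp (Ch.pri m hm) : Ch G S n →+ Ch G S₂ (n+1))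
      = (Ch.pri m₂ hm₂).comp (Ch.map f hf) := by
    apply Ch.pext
    intro x t
    simp [Ch.pri_push, Ch.map_push, h]
  exact DFunLike.congr_fun this z

lemma Ch.vert_conj {n : ℕ} (γ : S → G) (hγ : ∀ g s, γ (g • s) = g * γ s * g⁻¹) (f : S → S)
    (hf : ∀ (g : G) s, f (g • s) = g • f s) (hfγ : ∀ s, f s = γ s • s) (z : Ch G S n) :
    Ch.vert (fun x t => (γ t)⁻¹ * x) (fun g x t => by rw [hγ]; group) z = Ch.map f hf z := by
  have : (Ch.vert (fun x t => (γ t)⁻¹ * x) (fun g x t => by rw [hγ]; group) :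
      Ch G S n →+ Ch G S n) = Ch.map f hf := by
    apply Ch.pext
    intro x t
    rw [Ch.vert_push, Ch.map_push, hfγ, ← push_smul (γ t) t, tmap_tmap]
    congr 1
    convert tmap_id x
    funext y
    simp
  exact DFunLike.congr_fun this z

end chains

/-- A pair of configuration sets. -/
structure GP (G : Type) [Group G] where
  S : Type
  P : Type
  [aS : MulAction G S]
  [aP : MulAction G P]
  f : P → S
  hf : ∀ (g : G) p, f (g • p) = g • f p

attribute [instance] GP.aS GP.aP

structure GPHom {G : Type} [Group G] (X Y : GP G) where
  s : X.S → Y.S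
  p : X.P → Y.P
  hs : ∀ (g : G) x, s (g • x) = g • s x
  hp : ∀ (g : G) x, p (g • x) = g • p x
  comm : ∀ x, Y.f (p x) = s (X.f x)

section rel
variable {G : Type} [Group G]

/-- relative chains -/
def Rel (X : GP G) (n : ℕ) : Type := Ch G X.S n × Ch G X.P (n - 1)

noncomputable instance (X : GP G) (n : ℕ) : AddCommGroup (Rel X n) :=
  inferInstanceAs (AddCommGroup (Ch G X.S n × Ch G X.P (n - 1)))

instance (X : GP G) : Subsingleton (Rel X 0) :=
  inferInstanceAs (Subsingleton (Ch G X.S 0 × Ch G X.P 0))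

variable {X Y Z : GP G}

@[ext] lemma Rel.ext {n : ℕ} {a b : Rel X n} (h1 : a.1 = b.1) (h2 : a.2 = b.2) : a = b :=
  Prod.ext h1 h2

@[simp] lemma Rel.add_fst {n : ℕ} (a b : Rel X n) : (a + b).1 = a.1 + b.1 := rfl
@[simp] lemma Rel.add_snd {n : ℕ} (a b : Rel X n) : (a + b).2 = a.2 + b.2 := rfl
@[simp] lemma Rel.sub_fst {n : ℕ} (a b : Rel X n) : (a - b).1 = a.1 - b.1 := rfl
@[simp] lemma Rel.sub_snd {n : ℕ} (a b : Rel X n) : (a - b).2 = a.2 - b.2 := rfl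
@[simp] lemma Rel.neg_fst {n : ℕ} (a : Rel X n) : (-a).1 = -a.1 := rfl
@[simp] lemma Rel.neg_snd {n : ℕ} (a : Rel X n) : (-a).2 = -a.2 := rfl
@[simp] lemma Rel.zero_fst {n : ℕ} : (0 : Rel X n).1 = 0 := rfl
@[simp] lemma Rel.zero_snd {n : ℕ} : (0 : Rel X n).2 = 0 := rfl

noncomputable def Rel.d {n : ℕ} : Rel X (n + 1) →+ Rel X n where
  toFun z := (Ch.d z.1 + Ch.map X.f X.hf (show Ch G X.P n from z.2), - Ch.dd n z.2)
  map_zero' := by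
    apply Rel.ext
    · show Ch.d (0 : Ch G X.S (n+1)) + Ch.map X.f X.hf (0 : Ch G X.P n) = 0
      simp
    · show - Ch.dd n (0 : Ch G X.P n) = 0
      simp
  map_add' a b := by
    apply Rel.ext
    · show Ch.d (a.1 + b.1) + Ch.map X.f X.hf
        ((show Ch G X.P n from a.2) + (show Ch G X.P n from b.2)) =
        (Ch.d a.1 + Ch.map X.f X.hf (show Ch G X.P n from a.2)) +
        (Ch.d b.1 + Ch.map X.f X.hf (show Ch G X.P n from b.2))
      simp only [map_add]
      abel
    · show - Ch.dd n ((show Ch G X.P n from a.2) + (show Ch G X.P n from b.2)) =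
        - Ch.dd n (show Ch G X.P n from a.2) + - Ch.dd n (show Ch G X.P n from b.2)
      simp only [map_add, neg_add]

lemma Rel.d_fst {n : ℕ} (z : Rel X (n + 1)) :
    (Rel.d z).1 = Ch.d z.1 + Ch.map X.f X.hf (show Ch G X.P n from z.2) := rfl
lemma Rel.d_snd {n : ℕ} (z : Rel X (n + 1)) :
    (Rel.d z).2 = - Ch.dd n (show Ch G X.P n from z.2) := rfl

lemma Rel.d_d {n : ℕ} (z : Rel X (n + 2)) : Rel.d (Rel.d z) = 0 := by
  apply Rel.ext
  · rw [Rel.d_fst, Rel.d_fst, Rel.d_snd, map_add, Ch.d_d, Ch.d_map]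
    show 0 + _ + Ch.map X.f X.hf (- Ch.d (show Ch G X.P (n+1) from z.2)) = 0
    rw [map_neg]
    abel
  · rw [Rel.d_snd, Rel.d_snd]
    cases n with
    | zero => exact Subsingleton.elim (α := Ch G X.P 0) _ _
    | succ n =>
      show - Ch.d (- Ch.d (show Ch G X.P (n+2) from z.2)) = 0
      rw [map_neg, Ch.d_d]
      simp

/-- induced map on relative chains -/
noncomputable def Rel.map {n : ℕ} (h : GPHom X Y) : Rel X n →+ Rel Y n :=
  AddMonoidHom.prodMap (Ch.map h.s h.hs) (Ch.map h.p h.hp)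

lemma Rel.map_fst {n : ℕ} (h : GPHom X Y) (z : Rel X n) :
    (Rel.map h z).1 = Ch.map h.s h.hs z.1 := rfl
lemma Rel.map_snd {n : ℕ} (h : GPHom X Y) (z : Rel X n) :
    (Rel.map h z).2 = Ch.map h.p h.hp z.2 := rfl

lemma Rel.d_map {n : ℕ} (h : GPHom X Y) (z : Rel X (n + 1)) :
    Rel.d (Rel.map h z) = Rel.map h (Rel.d z) := by
  apply Rel.ext
  · rw [Rel.d_fst, Rel.map_fst, Rel.map_snd, Rel.map_fst, Rel.d_fst, map_add, Ch.d_map]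
    congr 1
    show Ch.map Y.f Y.hf (Ch.map h.p h.hp (show Ch G X.P n from z.2)) = _
    rw [Ch.map_map, Ch.map_map]
    congr 1
    congr 1
    funext x
    exact h.comm x
  · rw [Rel.d_snd, Rel.map_snd, Rel.map_snd, Rel.d_snd, map_neg]
    congr 1
    exact Ch.dd_map _ _ _

def GPHom.comp (h' : GPHom Y Z) (h : GPHom X Y) : GPHom X Z where
  s x := h'.s (h.s x)
  p x := h'.p (h.p x)
  hs g x := by rw [h.hs, h'.hs]
  hp g x := by rw [h.hp, h'.hp]
  comm x := by rw [h'.comm, h.comm]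

lemma Rel.map_map {n : ℕ} (h' : GPHom Y Z) (h : GPHom X Y) (z : Rel X n) :
    Rel.map h' (Rel.map h z) = Rel.map (h'.comp h) z := by
  apply Rel.ext
  · exact Ch.map_map h.s h.hs h'.s h'.hs _
  · exact Ch.map_map h.p h.hp h'.p h'.hp _

lemma GPHom.ext' {h h' : GPHom X Y} (h1 : ∀ x, h.s x = h'.s x) (h2 : ∀ x, h.p x = h'.p x) :
    h = h' := by
  cases h; cases h'
  congr 1
  · exact funext h1
  · exact funext h2

lemma Rel.map_id' {n : ℕ} (h : GPHom X X) (h1 : ∀ x, h.s x = x) (h2 : ∀ x, h.p x = x)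
    (z : Rel X n) : Rel.map h z = z := by
  apply Rel.ext
  · exact Ch.map_id' h.s h.hs h1 _
  · exact Ch.map_id' h.p h.hp h2 _

/-- conjugation homotopy -/
lemma Rel.conj {n : ℕ} (h : GPHom X X) (γ : X.S → G) (hγ : ∀ g s, γ (g • s) = g * γ s * g⁻¹)
    (h1 : ∀ s, h.s s = γ s • s) (h2 : ∀ p, h.p p = γ (X.f p) • p)
    (z : Rel X (n + 1)) (hz : Rel.d z = 0) : ∃ w, Rel.d w = Rel.map h z - z := by
  obtain ⟨a, b⟩ := z
  change Ch G X.P n at b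
  have ha : Ch.d a + Ch.map X.f X.hf b = 0 := congrArg Prod.fst hz
  have hb : Ch.dd n b = 0 := by
    have := congrArg Prod.snd hz
    exact neg_eq_zero.mp this
  have hm1 : ∀ g x t, (γ (g • t))⁻¹ * (g * x) = g * ((γ t)⁻¹ * x) := by
    intro g x t; rw [hγ]; group
  have hγ' : ∀ g p, γ (X.f (g • p)) = g * γ (X.f p) * g⁻¹ := fun g p => by rw [X.hf, hγ]
  have hm2 : ∀ g x p, (γ (X.f (g • p)))⁻¹ * (g * x) = g * ((γ (X.f p))⁻¹ * x) := by
    intro g x t; rw [hγ']; group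
  refine ⟨(Ch.pri (fun x t => (γ t)⁻¹ * x) hm1 a,
    (- Ch.pri (fun x p => (γ (X.f p))⁻¹ * x) hm2 b : Ch G X.P (n+1))), ?_⟩
  apply Rel.ext
  · show Ch.d (Ch.pri (fun x t => (γ t)⁻¹ * x) hm1 a) + Ch.map X.f X.hf
      (- Ch.pri (fun x p => (γ (X.f p))⁻¹ * x) hm2 b) = Ch.map h.s h.hs a - a
    rw [Ch.d_pri, map_neg, Ch.map_pri X.f X.hf (fun x p => (γ (X.f p))⁻¹ * x) hm2
      (fun x t => (γ t)⁻¹ * x) hm1 (fun _ _ => rfl), Ch.vert_conj γ hγ h.s h.hs h1,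
      eq_neg_of_add_eq_zero_left ha, map_neg]
    abel
  · show - Ch.d (- Ch.pri (fun x p => (γ (X.f p))⁻¹ * x) hm2 b) = Ch.map h.p h.hp b - b
    rw [map_neg, neg_neg, Ch.d_pri_of_cycle _ _ _ hb,
      Ch.vert_conj (fun p => γ (X.f p)) hγ' h.p h.hp h2]

end rel

end HS

set_option linter.unusedVariables false
set_option linter.unusedSimpArgs false

namespace HS
open FreeAbelianGroup

section lemmaL

/-- Lemma L -/
lemma lemmaL {C : ℕ → ℕ → Type} [∀ k n, AddCommGroup (C k n)]
    (d : ∀ k n, C k (n + 1) →+ C k n) (e : ∀ k n, C (k + 1) n →+ C k n)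
    (hdd : ∀ k n z, d k n (d k (n + 1) z) = 0)
    (hee : ∀ k n z, e k n (e (k + 1) n z) = 0)
    (hde : ∀ k n z, d k n (e k (n + 1) z) = e k n (d (k + 1) n z))
    (h0 : ∀ k, Subsingleton (C k 0))
    (hex : ∀ k n (z : C (k + 1) (n + 1)), e k (n + 1) z = 0 → ∃ a, e (k + 1) (n + 1) a = z)
    (hon : ∀ n (z : C 0 (n + 1)), ∃ a, e 0 (n + 1) a = z)
    (m : ℕ)
    (hyp : ∀ k i, 1 ≤ k → k + i = m → ∀ z : C (k + 1) (i + 1), d _ _ z = 0 →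
      ∃ z', d _ _ z' = 0 ∧ ∃ w, z = e _ _ z' + d _ _ w)
    (x : C 0 (m + 1)) (hx : d _ _ x = 0) : ∃ z, d _ _ z = 0 ∧ e _ _ z = x := by
  have claim : ∀ i k, k + 1 + i = m → ∀ ζ : C (k + 1) (i + 1), d _ _ ζ = 0 → e _ _ ζ = 0 →
      ∃ η, d _ _ η = ζ ∧ e _ _ η = 0 := by
    intro i
    induction i with
    | zero =>
      intro k hk ζ h1 h2
      obtain ⟨a, rfl⟩ := hex _ _ ζ h2
      obtain ⟨z', hz', w, rfl⟩ := hyp (k + 1) 0 (by omega) hk a ((h0 _).elim _ _)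
      refine ⟨e _ _ w, ?_, hee _ _ _⟩
      simp only [hde, map_add, hee, _root_.zero_add (M := C (k + 1) _)]
    | succ i ih =>
      intro k hk ζ h1 h2
      obtain ⟨a, rfl⟩ := hex _ _ ζ h2
      obtain ⟨b, hb1, hb2⟩ := ih (k + 1) (by omega) (d _ _ a) (hdd _ _ _) (by rw [← hde, h1])
      obtain ⟨z', hz', w, hw⟩ := hyp (k + 1) (i + 1) (by omega) hk (a - b)
        (by rw [map_sub, hb1, sub_self])
      refine ⟨e _ _ w, ?_, hee _ _ _⟩
      have : d _ _ w = a - b - e _ _ z' := by rw [hw]; abel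
      rw [hde, this, map_sub, map_sub, hee, hb2]
      abel
  obtain ⟨a, rfl⟩ := hon _ x
  cases m with
  | zero => exact ⟨a, (h0 _).elim _ _, rfl⟩
  | succ i =>
    obtain ⟨b, hb1, hb2⟩ := claim i 0 (by omega) (d _ _ a) (hdd _ _ _) (by rw [← hde, hx])
    exact ⟨a - b, by rw [map_sub, hb1, sub_self], by rw [map_sub, hb2, sub_zero]⟩

end lemmaL

section tup
variable {G : Type} [Group G] {V : Type} [MulAction G V]

/-- equivariant family of subsets -/
structure EqFam (G S V : Type) [Group G] [MulAction G S] [MulAction G V] where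
  Ω : S → Set V
  eqv : ∀ (g : G) s v, v ∈ Ω s → g • v ∈ Ω (g • s)

variable {S : Type} [MulAction G S]

structure Tup (Φ : EqFam G S V) (k : ℕ) where
  t : S
  η : Fin k → V
  mem : ∀ i, η i ∈ Φ.Ω t

lemma Tup.ext' {Φ : EqFam G S V} {k : ℕ} {a b : Tup Φ k} (h1 : a.t = b.t)
    (h2 : ∀ i, a.η i = b.η i) : a = b := by
  cases a; cases b
  congr 1
  exact funext h2

instance (Φ : EqFam G S V) (k : ℕ) : MulAction G (Tup Φ k) where
  smul g q := ⟨g • q.t, fun i => g • q.η i, fun i => Φ.eqv g _ _ (q.mem i)⟩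
  one_smul q := Tup.ext' (one_smul _ _) (fun i => one_smul _ _)
  mul_smul g h q := Tup.ext' (mul_smul _ _ _) (fun i => mul_smul _ _ _)

@[simp] lemma Tup.smul_t {Φ : EqFam G S V} {k : ℕ} (g : G) (q : Tup Φ k) :
    (g • q).t = g • q.t := rfl
@[simp] lemma Tup.smul_η {Φ : EqFam G S V} {k : ℕ} (g : G) (q : Tup Φ k) (i : Fin k) :
    (g • q).η i = g • q.η i := rfl

def Tup.face {Φ : EqFam G S V} {k : ℕ} (i : Fin (k + 1)) (q : Tup Φ (k + 1)) : Tup Φ k :=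
  ⟨q.t, fun j => q.η (i.succAbove j), fun j => q.mem _⟩

lemma Tup.face_smul {Φ : EqFam G S V} {k : ℕ} (i : Fin (k + 1)) (g : G) (q : Tup Φ (k + 1)) :
    Tup.face i (g • q) = g • Tup.face i q := rfl

noncomputable def Ch.e {Φ : EqFam G S V} {k n : ℕ} : Ch G (Tup Φ (k + 1)) n →+ Ch G (Tup Φ k) n :=
  ∑ i : Fin (k + 1), ((-1 : ℤ) ^ (i : ℕ)) • Ch.map (Tup.face i) (Tup.face_smul i)

lemma Ch.e_apply {Φ : EqFam G S V} {k n : ℕ} (z : Ch G (Tup Φ (k + 1)) n) :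
    Ch.e z = ∑ i : Fin (k + 1), ((-1 : ℤ) ^ (i : ℕ)) • Ch.map (Tup.face i) (Tup.face_smul i) z := by
  simp [Ch.e]

/-- push in the tuple direction -/
noncomputable def tpush {Φ : EqFam G S V} {k n : ℕ} (x : Fin n → G) (t : S) :
    TC k (Φ.Ω t) →+ Ch G (Tup Φ k) n :=
  FreeAbelianGroup.lift (fun l => cel x ⟨t, fun i => (l i).1, fun i => (l i).2⟩)

lemma tpush_of {Φ : EqFam G S V} {k n : ℕ} (x : Fin n → G) (t : S) (l : Fin k → Φ.Ω t) :
    tpush x t (of l) = cel x (⟨t, fun i => (l i).1, fun i => (l i).2⟩ : Tup Φ k) := by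
  simp [tpush]

lemma cel_eq_tpush {Φ : EqFam G S V} {k n : ℕ} (x : Fin n → G) (q : Tup Φ k) :
    cel x q = tpush x q.t (of (fun i => (⟨q.η i, q.mem i⟩ : Φ.Ω q.t))) := by
  rw [tpush_of]

lemma Ch.e_tpush {Φ : EqFam G S V} {k n : ℕ} (x : Fin n → G) (t : S) (y : TC (k + 1) (Φ.Ω t)) :
    Ch.e (tpush x t y) = tpush x t (bd y) := by
  have : (Ch.e.comp (tpush x t) : TC (k+1) (Φ.Ω t) →+ Ch G (Tup Φ k) n)
      = (tpush x t).comp bd := by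
    apply FreeAbelianGroup.lift_ext
    intro l
    simp only [AddMonoidHom.comp_apply, tpush_of, Ch.e_apply, Ch.map_cel, bd_of, bdT, map_sum,
      map_zsmul]
    rfl
  exact DFunLike.congr_fun this y

lemma Ch.e_e {Φ : EqFam G S V} {k n : ℕ} (z : Ch G (Tup Φ (k + 2)) n) : Ch.e (Ch.e z) = 0 := by
  have : (Ch.e.comp Ch.e : Ch G (Tup Φ (k+2)) n →+ Ch G (Tup Φ k) n) = 0 := by
    apply Ch.ext
    intro x q
    rw [cel_eq_tpush]
    simp only [AddMonoidHom.comp_apply, Ch.e_tpush, bd_bd, map_zero, AddMonoidHom.zero_apply]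
  exact DFunLike.congr_fun this z

/-- contraction -/
noncomputable def Ch.con {Φ : EqFam G S V} {k n : ℕ} (c : S → V) (hc : ∀ s, c s ∈ Φ.Ω s) :
    Ch G (Tup Φ k) (n + 1) →+ Ch G (Tup Φ (k + 1)) (n + 1) :=
  Ch.lift (fun x q => cel x ⟨q.t, Fin.cons (x 0 • c ((x 0)⁻¹ • q.t)) q.η, fun i => by
    refine Fin.cases ?_ (fun j => ?_) i
    · have := Φ.eqv (x 0) _ _ (hc ((x 0)⁻¹ • q.t))
      simpa using this
    · simpa using q.mem j⟩) (fun g x q => by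
    rw [← cel_smul g x]
    congr 1
    apply Tup.ext'
    · rfl
    · intro i
      refine Fin.cases ?_ (fun j => ?_) i
      · simp [mul_smul]
      · simp)

lemma Ch.con_tpush {Φ : EqFam G S V} {k n : ℕ} (c : S → V) (hc : ∀ s, c s ∈ Φ.Ω s)
    (x : Fin (n + 1) → G) (t : S) (h : x 0 • c ((x 0)⁻¹ • t) ∈ Φ.Ω t) (y : TC k (Φ.Ω t)) :
    Ch.con c hc (tpush x t y) = tpush x t (cone ⟨_, h⟩ y) := by
  have : ((Ch.con c hc).comp (tpush x t) : TC k (Φ.Ω t) →+ Ch G (Tup Φ (k+1)) (n+1))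
      = (tpush x t).comp (cone ⟨_, h⟩) := by
    apply FreeAbelianGroup.lift_ext
    intro l
    simp only [AddMonoidHom.comp_apply, tpush_of, cone_of]
    unfold Ch.con
    rw [Ch.lift_cel _ _ (by omega)]
    congr 1
    apply Tup.ext'
    · rfl
    · intro i
      refine Fin.cases ?_ (fun j => ?_) i <;> simp
  exact DFunLike.congr_fun this y

lemma con_mem {Φ : EqFam G S V} (c : S → V) (hc : ∀ s, c s ∈ Φ.Ω s) (x : G) (t : S) :
    x • c (x⁻¹ • t) ∈ Φ.Ω t := by
  have := Φ.eqv x _ _ (hc (x⁻¹ • t))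
  simpa using this

lemma Ch.e_con {Φ : EqFam G S V} {k n : ℕ} (c : S → V) (hc : ∀ s, c s ∈ Φ.Ω s)
    (z : Ch G (Tup Φ (k + 1)) (n + 1)) :
    Ch.e (Ch.con c hc z) = z - Ch.con c hc (Ch.e z) := by
  have : (Ch.e.comp (Ch.con c hc) : Ch G (Tup Φ (k+1)) (n+1) →+ Ch G (Tup Φ (k+1)) (n+1))
      = AddMonoidHom.id _ - (Ch.con c hc).comp Ch.e := by
    apply Ch.ext
    intro x q
    rw [cel_eq_tpush]
    simp only [AddMonoidHom.comp_apply, Ch.e_tpush, AddMonoidHom.sub_apply,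
      AddMonoidHom.id_apply, Ch.con_tpush c hc x _ (con_mem c hc (x 0) _), bd_cone, map_sub]
  exact DFunLike.congr_fun this z

lemma Ch.e_con_zero {Φ : EqFam G S V} {n : ℕ} (c : S → V) (hc : ∀ s, c s ∈ Φ.Ω s)
    (z : Ch G (Tup Φ 0) (n + 1)) :
    Ch.e (Ch.con c hc z) = z := by
  have : (Ch.e.comp (Ch.con c hc) : Ch G (Tup Φ 0) (n+1) →+ Ch G (Tup Φ 0) (n+1))
      = AddMonoidHom.id _ := by
    apply Ch.ext
    intro x q
    rw [cel_eq_tpush]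
    simp only [AddMonoidHom.comp_apply, Ch.e_tpush, AddMonoidHom.sub_apply,
      AddMonoidHom.id_apply, Ch.con_tpush c hc x _ (con_mem c hc (x 0) _), cone_of, bd_of,
      bdT_cons_zero]
  exact DFunLike.congr_fun this z

lemma Ch.e_exact {Φ : EqFam G S V} (hne : ∀ s, (Φ.Ω s).Nonempty) {k n : ℕ}
    (z : Ch G (Tup Φ (k + 1)) n) (hz : Ch.e z = 0) : ∃ a, Ch.e a = z := by
  cases n with
  | zero => exact ⟨0, Subsingleton.elim _ _⟩
  | succ n =>
    choose c hc using hne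
    exact ⟨Ch.con c hc z, by rw [Ch.e_con, hz, map_zero, sub_zero]⟩

lemma Ch.e_onto {Φ : EqFam G S V} (hne : ∀ s, (Φ.Ω s).Nonempty) {n : ℕ}
    (z : Ch G (Tup Φ 0) n) : ∃ a, Ch.e a = z := by
  cases n with
  | zero => exact ⟨0, Subsingleton.elim _ _⟩
  | succ n =>
    choose c hc using hne
    exact ⟨Ch.con c hc z, Ch.e_con_zero c hc z⟩

/-- tuples over a pair -/
structure PairFam (X : GP G) (V : Type) [MulAction G V] where
  Φ : EqFam G X.S V
  Φ' : EqFam G X.P V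
  le : ∀ p, Φ'.Ω p ⊆ Φ.Ω (X.f p)

variable {X : GP G}

def tupGP (Φ : PairFam X V) (k : ℕ) : GP G where
  S := Tup Φ.Φ k
  P := Tup Φ.Φ' k
  f q := ⟨X.f q.t, q.η, fun i => Φ.le _ (q.mem i)⟩
  hf g q := Tup.ext' (X.hf _ _) (fun i => rfl)

def faceHom (Φ : PairFam X V) (k : ℕ) (i : Fin (k + 1)) :
    GPHom (tupGP Φ (k + 1)) (tupGP Φ k) where
  s := Tup.face i
  p := Tup.face i
  hs _ _ := rfl
  hp _ _ := rfl
  comm _ := rfl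

noncomputable def Rel.e {Φ : PairFam X V} {k n : ℕ} :
    Rel (tupGP Φ (k + 1)) n →+ Rel (tupGP Φ k) n :=
  ∑ i : Fin (k + 1), ((-1 : ℤ) ^ (i : ℕ)) • Rel.map (faceHom Φ k i)

lemma Rel.e_apply {Φ : PairFam X V} {k n : ℕ} (z : Rel (tupGP Φ (k + 1)) n) :
    Rel.e z = ∑ i : Fin (k + 1), ((-1 : ℤ) ^ (i : ℕ)) • Rel.map (faceHom Φ k i) z := by
  simp [Rel.e]

noncomputable def Rel.fstH (X : GP G) (n : ℕ) : Rel X n →+ Ch G X.S n := AddMonoidHom.fst _ _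
noncomputable def Rel.sndH (X : GP G) (n : ℕ) : Rel X n →+ Ch G X.P (n - 1) :=
  AddMonoidHom.snd _ _

lemma Rel.e_fst {Φ : PairFam X V} {k n : ℕ} (z : Rel (tupGP Φ (k + 1)) n) :
    (Rel.e z).1 = Ch.e (Φ := Φ.Φ) z.1 := by
  rw [Rel.e_apply]
  show Rel.fstH _ _ (∑ i : Fin (k + 1), ((-1 : ℤ) ^ (i : ℕ)) • Rel.map (faceHom Φ k i) z) = _
  rw [map_sum]
  refine Eq.trans (Finset.sum_congr rfl fun i _ => ?_) (Ch.e_apply _).symm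
  rw [map_zsmul]
  rfl

lemma Rel.e_snd {Φ : PairFam X V} {k n : ℕ} (z : Rel (tupGP Φ (k + 1)) n) :
    (Rel.e z).2 = Ch.e (Φ := Φ.Φ') z.2 := by
  rw [Rel.e_apply]
  show Rel.sndH _ _ (∑ i : Fin (k + 1), ((-1 : ℤ) ^ (i : ℕ)) • Rel.map (faceHom Φ k i) z) = _
  rw [map_sum]
  refine Eq.trans (Finset.sum_congr rfl fun i _ => ?_) (Ch.e_apply _).symm
  rw [map_zsmul]
  rfl

lemma Rel.e_e {Φ : PairFam X V} {k n : ℕ} (z : Rel (tupGP Φ (k + 2)) n) :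
    Rel.e (Rel.e z) = 0 := by
  apply Rel.ext
  · rw [Rel.e_fst, Rel.e_fst]; exact Ch.e_e _
  · rw [Rel.e_snd, Rel.e_snd]; exact Ch.e_e _

lemma Rel.d_e {Φ : PairFam X V} {k n : ℕ} (z : Rel (tupGP Φ (k + 1)) (n + 1)) :
    Rel.d (Rel.e z) = Rel.e (Rel.d z) := by
  simp only [Rel.e_apply, map_sum, map_zsmul, Rel.d_map]

lemma Rel.e_exact {Φ : PairFam X V} (h1 : ∀ s, (Φ.Φ.Ω s).Nonempty)
    (h2 : ∀ p, (Φ.Φ'.Ω p).Nonempty) {k n : ℕ} (z : Rel (tupGP Φ (k + 1)) n)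
    (hz : Rel.e z = 0) : ∃ a, Rel.e a = z := by
  obtain ⟨a, ha⟩ := Ch.e_exact (Φ := Φ.Φ) h1 z.1 (by rw [← Rel.e_fst, hz]; rfl)
  obtain ⟨b, hb⟩ := Ch.e_exact (Φ := Φ.Φ') h2 z.2 (by rw [← Rel.e_snd, hz]; rfl)
  refine ⟨(a, b), Rel.ext ?_ ?_⟩
  · exact (Rel.e_fst (Φ := Φ) _).trans ha
  · exact (Rel.e_snd (Φ := Φ) _).trans hb

lemma Rel.e_onto {Φ : PairFam X V} (h1 : ∀ s, (Φ.Φ.Ω s).Nonempty)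
    (h2 : ∀ p, (Φ.Φ'.Ω p).Nonempty) {n : ℕ} (z : Rel (tupGP Φ 0) n) : ∃ a, Rel.e a = z := by
  obtain ⟨a, ha⟩ := Ch.e_onto (Φ := Φ.Φ) h1 z.1
  obtain ⟨b, hb⟩ := Ch.e_onto (Φ := Φ.Φ') h2 z.2
  refine ⟨(a, b), Rel.ext ?_ ?_⟩
  · exact (Rel.e_fst (Φ := Φ) _).trans ha
  · exact (Rel.e_snd (Φ := Φ) _).trans hb

/-- The subgroup of elements which are trivial for the purposes of Lemma L. -/
noncomputable def triv (Φ : PairFam X V) (k n : ℕ) : AddSubgroup (Rel (tupGP Φ k) (n + 1)) :=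
  (AddMonoidHom.range (Rel.d : Rel (tupGP Φ k) (n + 2) →+ _)) ⊔
    (AddSubgroup.map (Rel.e : Rel (tupGP Φ (k + 1)) (n + 1) →+ _)
      (AddMonoidHom.ker (Rel.d : Rel (tupGP Φ (k + 1)) (n + 1) →+ _)))

lemma triv_d (Φ : PairFam X V) {k n : ℕ} (w : Rel (tupGP Φ k) (n + 2)) :
    Rel.d w ∈ triv Φ k n :=
  AddSubgroup.mem_sup_left ⟨w, rfl⟩

lemma triv_e (Φ : PairFam X V) {k n : ℕ} (z : Rel (tupGP Φ (k + 1)) (n + 1))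
    (hz : Rel.d z = 0) : Rel.e z ∈ triv Φ k n :=
  AddSubgroup.mem_sup_right ⟨z, hz, rfl⟩

/-- Lemma L for tuples over a pair -/
lemma lemmaL_tup (Φ : PairFam X V) (h1 : ∀ s, (Φ.Φ.Ω s).Nonempty)
    (h2 : ∀ p, (Φ.Φ'.Ω p).Nonempty) (m : ℕ)
    (hyp : ∀ k i, 1 ≤ k → k + i = m → ∀ z : Rel (tupGP Φ (k + 1)) (i + 1), Rel.d z = 0 →
      z ∈ triv Φ (k + 1) i)
    (x : Rel (tupGP Φ 0) (m + 1)) (hx : Rel.d x = 0) :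
    ∃ z : Rel (tupGP Φ 1) (m + 1), Rel.d z = 0 ∧ Rel.e z = x := by
  refine lemmaL (C := fun k n => Rel (tupGP Φ k) n) (fun k n => Rel.d) (fun k n => Rel.e)
    (fun _ _ z => Rel.d_d z) (fun _ _ z => Rel.e_e z) (fun _ _ z => Rel.d_e z)
    (fun k => inferInstance) (fun _ _ z hz => Rel.e_exact h1 h2 z hz)
    (fun _ z => Rel.e_onto h1 h2 z) m ?_ x hx
  intro k i hk hki z hz
  obtain ⟨y, ⟨w, rfl⟩, y', ⟨z', hz', rfl⟩, rfl⟩ := AddSubgroup.mem_sup.mp (hyp k i hk hki z hz)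
  exact ⟨z', hz', w, add_comm _ _⟩

end tup

section gen
variable {G : Type} [Group G] {X : GP G}

/-- decomposition of cycles according to an invariant -/
lemma gen {I : Type} (orb : X.S → I) (T : I → GP G) (θ : ∀ i, GPHom (T i) X)
    (horb : ∀ i u, orb ((θ i).s u) = i)
    (hS : ∀ s, ∃ u, (θ (orb s)).s u = s) (hP : ∀ p, ∃ u, (θ (orb (X.f p))).p u = p)
    (iS : ∀ i, Function.Injective (θ i).s) (iP : ∀ i, Function.Injective (θ i).p)
    (hg : ∀ (g : G) s, orb (g • s) = orb s)
    {n : ℕ} (A : AddSubgroup (Rel X (n + 1)))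
    (hA : ∀ i (m : Rel (T i) (n + 1)), Rel.d m = 0 → Rel.map (θ i) m ∈ A)
    (z : Rel X (n + 1)) (hz : Rel.d z = 0) : z ∈ A := by
  classical
  choose ψ hψ using hS
  choose ψ' hψ' using hP
  let ψi : ∀ i s, orb s = i → (T i).S := fun i s h => h ▸ ψ s
  have hψi : ∀ i s h, (θ i).s (ψi i s h) = s := by
    rintro i s rfl; exact hψ s
  let ψi' : ∀ i p, orb (X.f p) = i → (T i).P := fun i p h => h ▸ ψ' p
  have hψi' : ∀ i p h, (θ i).p (ψi' i p h) = p := by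
    rintro i p rfl; exact hψ' p
  have hff : ∀ i p h, (T i).f (ψi' i p h) = ψi i (X.f p) h := by
    intro i p h
    apply iS
    rw [← (θ i).comm, hψi', hψi]
  have e1 : ∀ i (g : G) s h h', ψi i (g • s) h = g • ψi i s h' := by
    intro i g s h h'
    apply iS
    rw [(θ i).hs, hψi, hψi]
  have e2 : ∀ i (g : G) s h h', ψi' i (g • s) h = g • ψi' i s h' := by
    intro i g s h h'
    apply iP
    rw [(θ i).hp, hψi', hψi']
  -- projections
  let Q : ∀ i n, Ch G X.S n →+ Ch G (T i).S n := fun i n =>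
    Ch.plift (fun t => if h : orb t = i then push (ψi i t h) else 0) (fun g x t => by
      by_cases h : orb t = i
      · have h' : orb (g • t) = i := by rw [hg, h]
        rw [dif_pos h, dif_pos h', e1 i g t h' h, push_smul]
      · have h' : ¬ orb (g • t) = i := by rw [hg]; exact h
        rw [dif_neg h, dif_neg h']
        rfl)
  have Qp : ∀ i n t (x : TC n G), Q i n (push t x)
      = if h : orb t = i then push (ψi i t h) x else 0 := by
    intro i n t x
    simp only [Q]
    rw [Ch.plift_push]
    · split_ifs <;> rfl
    · rintro rfl x t
      exact Subsingleton.elim _ _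
  let Q' : ∀ i n, Ch G X.P n →+ Ch G (T i).P n := fun i n =>
    Ch.plift (fun t => if h : orb (X.f t) = i then push (ψi' i t h) else 0) (fun g x t => by
      by_cases h : orb (X.f t) = i
      · have h' : orb (X.f (g • t)) = i := by rw [X.hf, hg, h]
        rw [dif_pos h, dif_pos h', e2 i g t h' h, push_smul]
      · have h' : ¬ orb (X.f (g • t)) = i := by rw [X.hf, hg]; exact h
        rw [dif_neg h, dif_neg h']
        rfl)
  have Qp' : ∀ i n t (x : TC n G), Q' i n (push t x)
      = if h : orb (X.f t) = i then push (ψi' i t h) x else 0 := by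
    intro i n t x
    simp only [Q']
    rw [Ch.plift_push]
    · split_ifs <;> rfl
    · rintro rfl x t
      exact Subsingleton.elim _ _
  have Qd : ∀ i n (z : Ch G X.S (n + 1)), Ch.d (Q i _ z) = Q i _ (Ch.d z) := by
    intro i n z
    have : (Ch.d.comp (Q i (n+1))) = (Q i n).comp Ch.d := by
      apply Ch.pext
      intro x t
      simp only [AddMonoidHom.comp_apply, Qp, Ch.d_push]
      split_ifs
      · rw [Ch.d_push]
      · simp
    exact DFunLike.congr_fun this z
  have Qd' : ∀ i n (z : Ch G X.P n), Ch.dd n (Q' i _ z) = Q' i _ (Ch.dd n z) := by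
    intro i n z
    cases n with
    | zero => exact Subsingleton.elim (α := Ch G (T i).P 0) _ _
    | succ n =>
      have : (Ch.d.comp (Q' i (n+1))) = (Q' i n).comp Ch.d := by
        apply Ch.pext
        intro x t
        simp only [AddMonoidHom.comp_apply, Qp', Ch.d_push]
        split_ifs
        · rw [Ch.d_push]
        · simp
      exact DFunLike.congr_fun this z
  have Qf : ∀ i n (z : Ch G X.P n), Ch.map (T i).f (T i).hf (Q' i _ z)
      = Q i _ (Ch.map X.f X.hf z) := by
    intro i n z
    have : (Ch.map (T i).f (T i).hf).comp (Q' i n) = (Q i n).comp (Ch.map X.f X.hf) := by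
      apply Ch.pext
      intro x t
      simp only [AddMonoidHom.comp_apply, Qp', Qp, Ch.map_push]
      split_ifs
      · rw [Ch.map_push, hff]
      · simp
    exact DFunLike.congr_fun this z
  let R : ∀ i n, Rel X n →+ Rel (T i) n := fun i n => AddMonoidHom.prodMap (Q i n) (Q' i (n - 1))
  have Rd : ∀ i, Rel.d (R i (n + 1) z) = 0 := by
    intro i
    have h1 : Ch.d z.1 + Ch.map X.f X.hf (show Ch G X.P n from z.2) = 0 := congrArg Prod.fst hz
    have h2 : - Ch.dd n (show Ch G X.P n from z.2) = 0 := congrArg Prod.snd hz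
    apply Rel.ext
    · show Ch.d (Q i (n+1) z.1) + Ch.map (T i).f (T i).hf (Q' i n (show Ch G X.P n from z.2)) = 0
      rw [Qd, Qf, ← map_add, h1, map_zero]
    · show - Ch.dd n (Q' i n (show Ch G X.P n from z.2)) = 0
      rw [Qd', ← map_neg, h2, map_zero]
  have sumS : ∀ n (a : Ch G X.S n), ∃ O₀ : Finset I, ∀ O, O₀ ⊆ O →
      ∑ i ∈ O, Ch.map (θ i).s (θ i).hs (Q i n a) = a := by
    intro n a
    refine Ch.ind (P := fun a => ∃ O₀ : Finset I, ∀ O, O₀ ⊆ O →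
      ∑ i ∈ O, Ch.map (θ i).s (θ i).hs (Q i n a) = a) a ⟨∅, by simp⟩ ?_ ?_ ?_
    · intro x t
      refine ⟨{orb t}, fun O hO => ?_⟩
      rw [Finset.sum_eq_single (orb t)]
      · rw [← push_of, Qp, dif_pos rfl, Ch.map_push]
        exact congrArg (fun s => push s (of x)) (hψi (orb t) t rfl)
      · intro i _ hi
        rw [← push_of, Qp, dif_neg (Ne.symm hi), map_zero]
      · intro h; exact absurd (hO (by simp)) h
    · rintro a ⟨O₀, h⟩
      refine ⟨O₀, fun O hO => ?_⟩
      simp only [map_neg, Finset.sum_neg_distrib, h O hO]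
    · rintro a b ⟨O₀, h⟩ ⟨O₁, h'⟩
      refine ⟨O₀ ∪ O₁, fun O hO => ?_⟩
      simp only [map_add, Finset.sum_add_distrib, h O (Finset.union_subset_left hO),
        h' O (Finset.union_subset_right hO)]
  have sumP : ∀ n (a : Ch G X.P n), ∃ O₀ : Finset I, ∀ O, O₀ ⊆ O →
      ∑ i ∈ O, Ch.map (θ i).p (θ i).hp (Q' i n a) = a := by
    intro n a
    refine Ch.ind (P := fun a => ∃ O₀ : Finset I, ∀ O, O₀ ⊆ O →
      ∑ i ∈ O, Ch.map (θ i).p (θ i).hp (Q' i n a) = a) a ⟨∅, by simp⟩ ?_ ?_ ?_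
    · intro x t
      refine ⟨{orb (X.f t)}, fun O hO => ?_⟩
      rw [Finset.sum_eq_single (orb (X.f t))]
      · rw [← push_of, Qp', dif_pos rfl, Ch.map_push]
        exact congrArg (fun s => push s (of x)) (hψi' (orb (X.f t)) t rfl)
      · intro i _ hi
        rw [← push_of, Qp', dif_neg (Ne.symm hi), map_zero]
      · intro h; exact absurd (hO (by simp)) h
    · rintro a ⟨O₀, h⟩
      refine ⟨O₀, fun O hO => ?_⟩
      simp only [map_neg, Finset.sum_neg_distrib, h O hO]
    · rintro a b ⟨O₀, h⟩ ⟨O₁, h'⟩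
      refine ⟨O₀ ∪ O₁, fun O hO => ?_⟩
      simp only [map_add, Finset.sum_add_distrib, h O (Finset.union_subset_left hO),
        h' O (Finset.union_subset_right hO)]
  obtain ⟨O₀, h₀⟩ := sumS _ z.1
  obtain ⟨O₁, h₁⟩ := sumP _ z.2
  have key : z = ∑ i ∈ O₀ ∪ O₁, Rel.map (θ i) (R i (n + 1) z) := by
    apply Rel.ext
    · show _ = Rel.fstH X (n+1) (∑ i ∈ O₀ ∪ O₁, _)
      rw [map_sum]
      exact (h₀ _ Finset.subset_union_left).symm
    · show _ = Rel.sndH X (n+1) (∑ i ∈ O₀ ∪ O₁, _)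
      rw [map_sum]
      exact (h₁ _ Finset.subset_union_right).symm
  rw [key]
  exact sum_mem fun i _ => hA i _ (Rd i)

end gen

end HS

set_option linter.unusedVariables false
set_option linter.unusedSimpArgs false

namespace HS
open FreeAbelianGroup

/-- nondegenerate hermitian form with nontrivial involution -/
structure Herm {F : Type} [Field F] (σ : F →+* F) {V : Type} [AddCommGroup V] [Module F V]
    (ω : V → V → F) : Prop where
  add_r : ∀ x y z, ω x (y + z) = ω x y + ω x z
  smul_r : ∀ x (c : F) y, ω x (c • y) = c * ω x y
  symm : ∀ x y, ω y x = σ (ω x y)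
  nondeg : ∀ x, (∀ y, ω y x = 0) → x = 0
  inv : ∀ x, σ (σ x) = x
  ne : ∃ a, σ a ≠ a

section herm
variable {F : Type} [Field F] {σ : F →+* F} {V : Type} [AddCommGroup V] [Module F V]
variable {ω : V → V → F}

namespace Herm

lemma zero_r (H : Herm σ ω) (x : V) : ω x 0 = 0 := by
  have := H.smul_r x 0 0
  simpa using this
lemma add_l (H : Herm σ ω) (x y z : V) : ω (x + y) z = ω x z + ω y z := by
  rw [H.symm z, H.add_r, map_add, ← H.symm, ← H.symm]
lemma smul_l (H : Herm σ ω) (c : F) (x y : V) : ω (c • x) y = σ c * ω x y := by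
  rw [H.symm y, H.smul_r, map_mul, ← H.symm]
lemma zero_l (H : Herm σ ω) (x : V) : ω 0 x = 0 := by
  rw [H.symm x, H.zero_r, map_zero]
lemma neg_r (H : Herm σ ω) (x y : V) : ω x (-y) = - ω x y := by
  rw [← neg_one_smul F, H.smul_r]; ring
lemma neg_l (H : Herm σ ω) (x y : V) : ω (-x) y = - ω x y := by
  rw [← neg_one_smul F, H.smul_l]; simp
lemma sub_r (H : Herm σ ω) (x y z : V) : ω x (y - z) = ω x y - ω x z := by
  rw [sub_eq_add_neg, H.add_r, H.neg_r]; ring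
lemma sub_l (H : Herm σ ω) (x y z : V) : ω (x - y) z = ω x z - ω y z := by
  rw [sub_eq_add_neg, H.add_l, H.neg_l]; ring

lemma eq_zero_symm (H : Herm σ ω) {x y : V} (h : ω x y = 0) : ω y x = 0 := by
  rw [H.symm x, h, map_zero]

lemma ne_zero_symm (H : Herm σ ω) {x y : V} (h : ω x y ≠ 0) : ω y x ≠ 0 :=
  fun h' => h (H.eq_zero_symm h')

/-- the functional `ω x ·` -/
def L (H : Herm σ ω) (x : V) : V →ₗ[F] F where
  toFun y := ω x y
  map_add' := H.add_r x
  map_smul' := H.smul_r x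

@[simp] lemma L_apply (H : Herm σ ω) (x y : V) : H.L x y = ω x y := rfl

lemma sigma_ne (H : Herm σ ω) {x : F} (h : x ≠ 0) : σ x ≠ 0 := by
  intro h'
  exact h (by rw [← H.inv x, h', map_zero])

lemma exists_theta (H : Herm σ ω) : ∃ θ : F, θ + σ θ = 1 := by
  by_cases h : ∃ a, a + σ a ≠ 0
  · obtain ⟨a, ha⟩ := h
    refine ⟨a / (a + σ a), ?_⟩
    rw [map_div₀, map_add, H.inv, add_comm (σ a) a, ← add_div, div_self ha]
  · push Not at h
    exfalso
    obtain ⟨a, ha⟩ := H.ne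
    have h1 := h 1
    have h2 := h a
    rw [map_one] at h1
    apply ha
    have : σ a = -a := by linear_combination h2
    rw [this]
    have : a * (1 + 1) = 0 := by rw [h1]; ring
    linear_combination -this

lemma exists_skew (H : Herm σ ω) : ∃ κ : F, κ ≠ 0 ∧ κ + σ κ = 0 := by
  obtain ⟨a, ha⟩ := H.ne
  refine ⟨a - σ a, sub_ne_zero.2 (Ne.symm ha), ?_⟩
  rw [map_sub, H.inv]; ring

lemma exists_norm_one (H : Herm σ ω) : ∃ u : F, u ≠ 1 ∧ σ u * u = 1 := by
  obtain ⟨a, ha⟩ := H.ne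
  have h0 : a ≠ 0 := by rintro rfl; simp at ha
  have h1 := H.sigma_ne h0
  refine ⟨a / σ a, ?_, ?_⟩
  · intro h
    rw [div_eq_one_iff_eq h1] at h
    exact ha h.symm
  · rw [map_div₀, H.inv]; field_simp

lemma exists_kappa (H : Herm σ ω) (s : F) (hs : σ s = s) : ∃ κ : F, κ ≠ 0 ∧ κ + σ κ = s := by
  by_cases h : s = 0
  · subst h; exact H.exists_skew
  · obtain ⟨θ, hθ⟩ := H.exists_theta
    refine ⟨θ * s, mul_ne_zero ?_ h, ?_⟩
    · rintro rfl; simp at hθ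
    · rw [map_mul, hs, ← add_mul, hθ, one_mul]

/-- orthogonal complement -/
def perp (H : Herm σ ω) (Δ : Submodule F V) : Submodule F V where
  carrier := {v | ∀ x ∈ Δ, ω x v = 0}
  zero_mem' x _ := H.zero_r x
  add_mem' ha hb x hx := by rw [H.add_r, ha x hx, hb x hx, add_zero]
  smul_mem' c a ha x hx := by rw [H.smul_r, ha x hx, mul_zero]

lemma mem_perp (H : Herm σ ω) {Δ : Submodule F V} {v : V} : v ∈ H.perp Δ ↔ ∀ x ∈ Δ, ω x v = 0 :=
  Iff.rfl
lemma mem_perp' (H : Herm σ ω) {Δ : Submodule F V} {v : V} : v ∈ H.perp Δ ↔ ∀ x ∈ Δ, ω v x = 0 :=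
  ⟨fun h x hx => H.eq_zero_symm (h x hx), fun h x hx => H.eq_zero_symm (h x hx)⟩

lemma perp_anti (H : Herm σ ω) {A B : Submodule F V} (h : A ≤ B) : H.perp B ≤ H.perp A :=
  fun v hv x hx => hv x (h hx)

lemma mem_perp_sup (H : Herm σ ω) {A B : Submodule F V} {v : V} :
    v ∈ H.perp (A ⊔ B) ↔ v ∈ H.perp A ∧ v ∈ H.perp B := by
  constructor
  · exact fun h => ⟨H.perp_anti le_sup_left h, H.perp_anti le_sup_right h⟩
  · rintro ⟨h1, h2⟩ x hx
    obtain ⟨a, ha, b, hb, rfl⟩ := Submodule.mem_sup.1 hx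
    rw [H.add_l, h1 a ha, h2 b hb, add_zero]

lemma mem_perp_span (H : Herm σ ω) {s : Set V} {v : V} :
    v ∈ H.perp (Submodule.span F s) ↔ ∀ x ∈ s, ω x v = 0 := by
  constructor
  · exact fun h x hx => h x (Submodule.subset_span hx)
  · intro h x hx
    induction hx using Submodule.span_induction with
    | mem x hx => exact h x hx
    | zero => exact H.zero_l v
    | add a b _ _ ha hb => rw [H.add_l, ha, hb, add_zero]
    | smul c a _ ha => rw [H.smul_l, ha, mul_zero]

lemma mem_perp_span_singleton (H : Herm σ ω) {e v : V} :
    v ∈ H.perp (F ∙ e) ↔ ω e v = 0 := by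
  rw [H.mem_perp_span]; simp

variable [FiniteDimensional F V]

lemma exists_rep (H : Herm σ ω) (f : V →ₗ[F] F) : ∃ u, ∀ v, ω u v = f v := by
  let b := Module.finBasis F V
  let Φ : V →ₗ[F] (Fin (Module.finrank F V) → F) := LinearMap.pi (fun i => H.L (b i))
  have hinj : Function.Injective Φ := by
    rw [← LinearMap.ker_eq_bot, LinearMap.ker_eq_bot']
    intro x hx
    apply H.nondeg
    intro y
    have : H.L x = 0 := b.ext fun i => by
      have := congrFun hx i
      exact H.eq_zero_symm this
    exact H.eq_zero_symm (LinearMap.congr_fun this y)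
  have hsurj : Function.Surjective Φ :=
    (LinearMap.injective_iff_surjective_of_finrank_eq_finrank (by simp)).1 hinj
  obtain ⟨u, hu⟩ := hsurj (fun i => σ (f (b i)))
  refine ⟨u, fun v => ?_⟩
  have : H.L u = f := b.ext fun i => by
    have h1 : ω (b i) u = σ (f (b i)) := congrFun hu i
    rw [L_apply, H.symm (b i), h1, H.inv]
  exact LinearMap.congr_fun this v

lemma sep (H : Herm σ ω) {Δ : Submodule F V} {v : V} (hv : v ∉ Δ) :
    ∃ u ∈ H.perp Δ, ω u v ≠ 0 := by
  obtain ⟨f, hf, hle⟩ := Submodule.exists_le_ker_of_notMem hv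
  obtain ⟨u, hu⟩ := H.exists_rep f
  refine ⟨u, ?_, ?_⟩
  · rw [H.mem_perp']
    intro x hx
    rw [hu]
    exact hle hx
  · rwa [hu]

lemma perp_perp (H : Herm σ ω) (Δ : Submodule F V) : H.perp (H.perp Δ) = Δ := by
  apply le_antisymm
  · intro v hv
    by_contra h
    obtain ⟨u, hu, hne⟩ := H.sep h
    exact hne (hv u hu)
  · intro v hv
    rw [H.mem_perp']
    intro x hx
    exact hx v hv

end Herm

/-- quasi-reflection -/
def rfn (ω : V → V → F) (w : V) (c : F) (v : V) : V := v + (c * ω w v) • w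

def rgood (σ : F →+* F) (ω : V → V → F) (p : V × F) : Prop :=
  p.2 + σ p.2 + p.2 * σ p.2 * ω p.1 p.1 = 0

def rchain (ω : V → V → F) (l : List (V × F)) (v : V) : V := l.foldr (fun p v => rfn ω p.1 p.2 v) v

lemma rchain_append (l l' : List (V × F)) (v : V) :
    rchain ω (l ++ l') v = rchain ω l (rchain ω l' v) := by
  simp [rchain, List.foldr_append]

namespace Herm

lemma rfn_isom (H : Herm σ ω) {w : V} {c : F} (h : rgood σ ω (w, c)) (x y : V) :
    ω (rfn ω w c x) (rfn ω w c y) = ω x y := by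
  have h' : c + σ c + c * σ c * ω w w = 0 := h
  simp only [rfn, H.add_l, H.add_r, H.smul_l, H.smul_r, map_mul, ← H.symm w x]
  linear_combination (ω x w * ω w y) * h'

lemma rfn_add (H : Herm σ ω) (w : V) (c : F) (x y : V) :
    rfn ω w c (x + y) = rfn ω w c x + rfn ω w c y := by
  simp only [rfn, H.add_r, mul_add, add_smul]; abel

lemma rfn_smul (H : Herm σ ω) (w : V) (c : F) (a : F) (y : V) :
    rfn ω w c (a • y) = a • rfn ω w c y := by
  simp only [rfn, H.smul_r, smul_add, smul_smul]
  congr 2; ring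

lemma rgood_inv (H : Herm σ ω) {w : V} {c : F} (h : rgood σ ω (w, c)) :
    rgood σ ω (w, σ c) := by
  have h' : c + σ c + c * σ c * ω w w = 0 := h
  show σ c + σ (σ c) + σ c * σ (σ c) * ω w w = 0
  rw [H.inv]; linear_combination h'

lemma rfn_inv (H : Herm σ ω) {w : V} {c : F} (h : rgood σ ω (w, c)) (v : V) :
    rfn ω w (σ c) (rfn ω w c v) = v := by
  have h' : c + σ c + c * σ c * ω w w = 0 := h
  simp only [rfn, H.add_r, H.smul_r]
  rw [add_assoc, ← add_smul]
  have : c * ω w v + σ c * (ω w v + c * ω w v * ω w w) = 0 := by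
    linear_combination (ω w v) * h'
  rw [this, zero_smul, add_zero]

/-- quasi-reflection as a group element -/
def rG (H : Herm σ ω) (w : V) (c : F) (h : rgood σ ω (w, c)) : bilinIsoms F ω :=
  ⟨{ toFun := rfn ω w c
     map_add' := H.rfn_add w c
     map_smul' := fun a y => H.rfn_smul w c a y
     invFun := rfn ω w (σ c)
     left_inv := H.rfn_inv h
     right_inv := fun v => by
       have := H.rfn_inv (H.rgood_inv h) v
       rwa [H.inv] at this }, fun x y => H.rfn_isom h x y⟩

lemma rG_smul (H : Herm σ ω) (w : V) (c : F) (h : rgood σ ω (w, c)) (v : V) :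
    H.rG w c h • v = v + (c * ω w v) • w := rfl

lemma isom (g : bilinIsoms F ω) (x y : V) : ω (g • x) (g • y) = ω x y := g.2 x y

lemma isom' (g : bilinIsoms F ω) (x y : V) : ω x (g • y) = ω (g⁻¹ • x) y := by
  rw [← isom g (g⁻¹ • x) y, smul_inv_smul]

lemma smul_add' (g : bilinIsoms F ω) (x y : V) : g • (x + y) = g • x + g • y := map_add g.1 x y
lemma smul_smul' (g : bilinIsoms F ω) (c : F) (y : V) : g • (c • y) = c • (g • y) :=
  map_smul g.1 c y

/-- list of reflections as group element -/
lemma exists_rchainG (H : Herm σ ω) (l : List (V × F)) (hl : ∀ p ∈ l, rgood σ ω p) :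
    ∃ g : bilinIsoms F ω, ∀ v, g • v = rchain ω l v := by
  induction l with
  | nil => exact ⟨1, fun v => one_smul _ v⟩
  | cons p l ih =>
    obtain ⟨g, hg⟩ := ih fun q hq => hl q (List.mem_cons_of_mem _ hq)
    refine ⟨H.rG p.1 p.2 (hl p List.mem_cons_self) * g, fun v => ?_⟩
    rw [mul_smul, hg]
    rfl

lemma rG_conj (H : Herm σ ω) (g : bilinIsoms F ω) (w : V) (c : F) (h : rgood σ ω (w, c))
    (h' : rgood σ ω (g • w, c)) : H.rG (g • w) c h' = g * H.rG w c h * g⁻¹ := by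
  apply Subtype.ext
  apply LinearEquiv.ext
  intro v
  show H.rG (g • w) c h' • v = (g * H.rG w c h * g⁻¹) • v
  rw [mul_smul, mul_smul, rG_smul, rG_smul, smul_add', smul_smul', smul_inv_smul, isom' g⁻¹,
    inv_inv]

/-- one step -/
lemma witt_one (H : Herm σ ω) (x y : V) (h : ω x x = ω y y)
    (hne : ω (y - x) x ≠ 0) : ∃ c, rgood σ ω (y - x, c) ∧ rfn ω (y - x) c x = y := by
  refine ⟨(ω (y - x) x)⁻¹, ?_, ?_⟩
  · show _ + σ _ + _ * σ _ * _ = 0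
    have hne' := H.sigma_ne hne
    have key : ω (y - x) (y - x) = -(ω (y - x) x + σ (ω (y - x) x)) := by
      rw [← H.symm]; simp only [H.sub_l, H.sub_r]; linear_combination -h
    simp only [key, map_inv₀]
    field_simp
    ring
  · simp only [rfn]
    rw [inv_mul_cancel₀ hne, one_smul]; abel

lemma witt_step [FiniteDimensional F V] (H : Herm σ ω) (D : Submodule F V) (x y : V) (hx : x ∉ D)
    (hy : y ∉ D) (h : ω x x = ω y y) (hp : y - x ∈ H.perp D) :
    ∃ l : List (V × F), (∀ p ∈ l, rgood σ ω p) ∧ (∀ p ∈ l, p.1 ∈ H.perp D) ∧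
      rchain ω l x = y := by
  by_cases hne : ω (y - x) x ≠ 0
  · obtain ⟨c, hc, hc'⟩ := H.witt_one x y h hne
    refine ⟨[(y - x, c)], ?_, ?_, ?_⟩
    · simpa using hc
    · simpa using hp
    · simpa [rchain] using hc'
  push Not at hne
  obtain ⟨u, hu, hux, huy⟩ : ∃ u ∈ H.perp D, ω u x ≠ 0 ∧ ω u y ≠ 0 := by
    obtain ⟨u1, h1, h1'⟩ := H.sep hx
    obtain ⟨u2, h2, h2'⟩ := H.sep hy
    by_cases a : ω u1 y = 0
    · by_cases b : ω u2 x = 0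
      · refine ⟨u1 + u2, add_mem h1 h2, ?_, ?_⟩
        · rwa [H.add_l, b, add_zero]
        · rwa [H.add_l, a, zero_add]
      · exact ⟨u2, h2, b, h2'⟩
    · exact ⟨u1, h1, h1', a⟩
  obtain ⟨κ, hκ, hκ'⟩ := H.exists_kappa (-ω u u) (by rw [map_neg, ← H.symm])
  obtain ⟨lam, hlam⟩ : ∃ lam, lam = σ (ω x u / κ) := ⟨_, rfl⟩
  have hxu := H.ne_zero_symm hux
  have hlam0 : lam ≠ 0 := by
    rw [hlam]; exact H.sigma_ne (div_ne_zero hxu hκ)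
  have hlam2 : σ lam * κ = ω x u := by
    rw [hlam, H.inv]; field_simp
  have hself : ω (x + lam • u) (x + lam • u) = ω x x := by
    simp only [H.add_l, H.add_r, H.smul_l, H.smul_r]
    rw [H.symm x u, ← hlam2, map_mul, H.inv]
    linear_combination (lam * σ lam) * hκ'
  have hA : ω (x + lam • u - x) x ≠ 0 := by
    rw [add_sub_cancel_left, H.smul_l]
    exact mul_ne_zero (H.sigma_ne hlam0) hux
  obtain ⟨c1, hc1, hc1'⟩ := H.witt_one x (x + lam • u) hself.symm hA
  have hB : ω (y - (x + lam • u)) (x + lam • u) ≠ 0 := by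
    have : ω (y - (x + lam • u)) (x + lam • u) = lam * ω y u := by
      have e1 := hne
      have e2 := hself
      simp only [H.sub_l, H.add_l, H.add_r, H.smul_l, H.smul_r] at *
      linear_combination e1 - e2
    rw [this]
    exact mul_ne_zero hlam0 (H.ne_zero_symm huy)
  obtain ⟨c2, hc2, hc2'⟩ := H.witt_one (x + lam • u) y (hself.trans h) hB
  refine ⟨[(y - (x + lam • u), c2), (x + lam • u - x, c1)], ?_, ?_, ?_⟩
  · intro p hp
    simp only [List.mem_cons, List.not_mem_nil, or_false] at hp
    rcases hp with rfl | rfl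
    · exact hc2
    · exact hc1
  · intro p hp'
    simp only [List.mem_cons, List.not_mem_nil, or_false] at hp'
    rcases hp' with rfl | rfl
    · rw [← sub_sub]
      exact sub_mem hp (Submodule.smul_mem _ _ hu)
    · rw [add_sub_cancel_left]
      exact Submodule.smul_mem _ _ hu
  · show rfn ω _ c2 (rfn ω _ c1 x) = y
    rw [hc1', hc2']

lemma rchain_fix (H : Herm σ ω) (D : Submodule F V) (l : List (V × F))
    (hl : ∀ p ∈ l, p.1 ∈ H.perp D) (v : V) (hv : v ∈ D) : rchain ω l v = v := by
  induction l with
  | nil => rfl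
  | cons p l ih =>
    show rfn ω p.1 p.2 (rchain ω l v) = v
    rw [ih fun q hq => hl q (List.mem_cons_of_mem _ hq), rfn,
      H.eq_zero_symm (hl p List.mem_cons_self v hv)]
    simp

lemma witt [FiniteDimensional F V] (H : Herm σ ω) (k : ℕ) (v v' : Fin k → V)
    (hv : LinearIndependent F v) (hv' : LinearIndependent F v')
    (hg : ∀ i j, ω (v i) (v j) = ω (v' i) (v' j)) :
    ∃ l : List (V × F), (∀ p ∈ l, rgood σ ω p) ∧ ∀ i, rchain ω l (v i) = v' i := by
  induction k with
  | zero => exact ⟨[], by simp, fun i => i.elim0⟩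
  | succ k ih =>
    obtain ⟨l, hl, hl'⟩ := ih (fun i => v i.castSucc) (fun i => v' i.castSucc)
      (hv.comp _ (Fin.castSucc_injective k)) (hv'.comp _ (Fin.castSucc_injective k))
      (fun i j => hg _ _)
    obtain ⟨g, hgl⟩ := H.exists_rchainG l hl
    have hlast : ∀ (f : Fin (k+1) → V), LinearIndependent F f →
        f (Fin.last k) ∉ Submodule.span F (Set.range fun i : Fin k => f i.castSucc) := by
      intro f hf
      have := hf.notMem_span_image (s := Set.range Fin.castSucc) (x := Fin.last k)
        (by rintro ⟨i, hi⟩; exact (Fin.castSucc_ne_last i) hi)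
      rwa [← Set.range_comp] at this
    obtain ⟨D, hD⟩ : ∃ D, D = Submodule.span F (Set.range fun i : Fin k => v' i.castSucc) :=
      ⟨_, rfl⟩
    have hDl := hlast v' hv'
    rw [← hD] at hDl
    have hgi : LinearIndependent F (fun i => g • v i) := hv.map' g.1.toLinearMap g.1.ker
    have hDg := hlast _ hgi
    have e1 : (fun i : Fin k => g • v i.castSucc) = fun i => v' i.castSucc :=
      funext fun i => by rw [hgl, hl']
    rw [e1, ← hD] at hDg
    obtain ⟨l2, h2, h2', h2''⟩ := H.witt_step D (g • v (Fin.last k)) (v' (Fin.last k)) hDg hDl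
      (by rw [isom g, hg]) (by
        rw [hD, H.mem_perp_span]
        rintro _ ⟨i, rfl⟩
        show ω (v' i.castSucc) _ = 0
        rw [H.sub_r, ← hg, ← congrFun e1 i, isom g, sub_self])
    refine ⟨l2 ++ l, ?_, ?_⟩
    · intro p hp
      rcases List.mem_append.1 hp with h | h
      · exact h2 p h
      · exact hl p h
    · intro i
      rw [rchain_append]
      refine Fin.lastCases ?_ (fun i => ?_) i
      · rw [← hgl, h2'']
      · rw [hl', H.rchain_fix D l2 h2']
        rw [hD]; exact Submodule.subset_span ⟨i, rfl⟩

/-- Witt extension -/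
lemma witt_ext [FiniteDimensional F V] (H : Herm σ ω) (Δ : Submodule F V) (τ : Δ →ₗ[F] V)
    (hτ : Function.Injective τ) (hi : ∀ x y, ω (τ x) (τ y) = ω x y) :
    ∃ g : bilinIsoms F ω, ∀ x : Δ, g • (x : V) = τ x := by
  let b := Module.finBasis F Δ
  obtain ⟨l, hl, hl'⟩ := H.witt _ (fun i => (b i : V)) (fun i => τ (b i))
    (b.linearIndependent.map' Δ.subtype (Submodule.ker_subtype Δ))
    (b.linearIndependent.map' τ (LinearMap.ker_eq_bot.2 hτ)) (fun i j => (hi _ _).symm)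
  obtain ⟨g, hg⟩ := H.exists_rchainG l hl
  refine ⟨g, fun x => ?_⟩
  have : g.1.toLinearMap ∘ₗ Δ.subtype = τ := b.ext fun i => by
    show g • (b i : V) = _
    rw [hg, hl']
  exact LinearMap.congr_fun this x

/-- restricted form -/
lemma restrict (H : Herm σ ω) (W : Submodule F V) (hW : ∀ x ∈ W, x ∈ H.perp W → x = 0) :
    Herm σ (fun x y : W => ω x y) where
  add_r x y z := H.add_r x y z
  smul_r x c y := H.smul_r x c y
  symm x y := H.symm x y
  nondeg x h := Subtype.ext (hW x x.2 fun y hy => h ⟨y, hy⟩)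
  inv := H.inv
  ne := H.ne

/-- lower bound for the "Witt index" of the complement -/
def wi (H : Herm σ ω) (Δ : Submodule F V) (r : ℕ) : Prop :=
  ∃ A : Submodule F V, A ≤ H.perp Δ ∧ (∀ a ∈ A, ∀ b ∈ A, ω a b = 0) ∧ (∀ a ∈ A, a ∈ Δ → a = 0) ∧
    r ≤ Module.finrank F A

lemma wi_le (H : Herm σ ω) {Δ : Submodule F V} {r s : ℕ} (h : H.wi Δ r) (hs : s ≤ r) :
    H.wi Δ s := by
  obtain ⟨A, h1, h2, h3, h4⟩ := h
  exact ⟨A, h1, h2, h3, hs.trans h4⟩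

lemma wi_zero (H : Herm σ ω) (Δ : Submodule F V) : H.wi Δ 0 :=
  ⟨⊥, bot_le, by simp [H.zero_l], by simp, by simp⟩

lemma wi_mono (H : Herm σ ω) {Δ Δ' : Submodule F V} {r : ℕ} (h : H.wi Δ' r) (hs : Δ ≤ Δ') :
    H.wi Δ r := by
  obtain ⟨A, h1, h2, h3, h4⟩ := h
  exact ⟨A, h1.trans (H.perp_anti hs), h2, fun a ha hd => h3 a ha (hs hd), h4⟩

lemma wi_of_map [FiniteDimensional F V] (H : Herm σ ω) {Δ A : Submodule F V} {r : ℕ}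
    (p : V →ₗ[F] V) (h1 : ∀ a ∈ A, p a ∈ H.perp Δ) (h2 : ∀ a ∈ A, ∀ b ∈ A, ω (p a) (p b) = 0)
    (h3 : ∀ a ∈ A, p a ∈ Δ → a = 0) (h4 : r ≤ Module.finrank F A) : H.wi Δ r := by
  refine ⟨A.map p, ?_, ?_, ?_, ?_⟩
  · rintro _ ⟨a, ha, rfl⟩
    exact h1 a ha
  · rintro _ ⟨a, ha, rfl⟩ _ ⟨b, hb, rfl⟩
    exact h2 a ha b hb
  · rintro _ ⟨a, ha, rfl⟩ h
    rw [h3 a ha h, map_zero]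
  · have : Function.Injective (p.domRestrict A) := by
      rw [← LinearMap.ker_eq_bot, LinearMap.ker_eq_bot']
      intro a ha
      apply Subtype.ext
      apply h3 a a.2
      have : p a = 0 := ha
      rw [this]; exact zero_mem _
    rw [← LinearMap.range_domRestrict, LinearMap.finrank_range_of_inj this]
    exact h4

lemma finrank_inf_ker [FiniteDimensional F V] (A : Submodule F V) (f : V →ₗ[F] F) :
    Module.finrank F A - 1 ≤ Module.finrank F (A ⊓ LinearMap.ker f : Submodule F V) := by
  have h := LinearMap.finrank_range_add_finrank_ker (f.domRestrict A)
  have h2 : Module.finrank F (LinearMap.range (f.domRestrict A)) ≤ 1 := by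
    have := Submodule.finrank_le (LinearMap.range (f.domRestrict A))
    simpa using this
  have h3 : Module.finrank F (LinearMap.ker (f.domRestrict A)) =
      Module.finrank F (A ⊓ LinearMap.ker f : Submodule F V) := by
    rw [LinearMap.ker_domRestrict]
    rw [LinearEquiv.finrank_eq (Submodule.equivSubtypeMap A (Submodule.comap A.subtype (LinearMap.ker f))),
      Submodule.map_comap_subtype]
  omega

lemma wi_one [FiniteDimensional F V] (H : Herm σ ω) {Δ : Submodule F V} {r : ℕ}
    (h : H.wi Δ r) (v : V) : H.wi (Δ ⊔ F ∙ v) (r - 1) := by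
  obtain ⟨A, h1, h2, h3, h4⟩ := h
  by_cases hc : ∃ a ∈ A, ω v a ≠ 0
  · obtain ⟨a0, ha0, hne⟩ := hc
    refine ⟨A ⊓ LinearMap.ker (H.L v), ?_, ?_, ?_, ?_⟩
    · rintro a ⟨ha, hav⟩
      rw [H.mem_perp_sup]
      exact ⟨h1 ha, H.mem_perp_span_singleton.2 hav⟩
    · exact fun a ha b hb => h2 a ha.1 b hb.1
    · rintro a ⟨ha, hav⟩ hd
      obtain ⟨x, hx, y, hy, hxy⟩ := Submodule.mem_sup.1 hd
      obtain ⟨t, rfl⟩ := Submodule.mem_span_singleton.1 hy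
      have e1 : ω a0 a = 0 := h2 a0 ha0 a ha
      have e2 : ω a0 x = 0 := H.eq_zero_symm (h1 ha0 x hx)
      rw [← hxy, H.add_r, e2, H.smul_r, zero_add] at e1
      have ht : t = 0 := by
        rcases mul_eq_zero.1 e1 with h | h
        · exact h
        · exact absurd (H.eq_zero_symm h) hne
      rw [ht, zero_smul, add_zero] at hxy
      exact h3 a ha (hxy ▸ hx)
    · exact (Nat.sub_le_sub_right h4 1).trans (finrank_inf_ker A _)
  · push Not at hc
    by_cases hz : ∃ a ∈ A, a ∈ Δ ⊔ F ∙ v ∧ a ≠ 0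
    · obtain ⟨a0, ha0, hd0, hne⟩ := hz
      obtain ⟨f, hf, -⟩ := Submodule.exists_le_ker_of_notMem (p := (⊥ : Submodule F V)) (v := a0)
        (by simpa using hne)
      refine ⟨A ⊓ LinearMap.ker f, ?_, ?_, ?_, ?_⟩
      · rintro a ⟨ha, hav⟩
        rw [H.mem_perp_sup]
        exact ⟨h1 ha, H.mem_perp_span_singleton.2 (hc a ha)⟩
      · exact fun a ha b hb => h2 a ha.1 b hb.1
      · rintro a ⟨ha, hav⟩ hd
        obtain ⟨x, hx, y, hy, hxy⟩ := Submodule.mem_sup.1 hd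
        obtain ⟨t, rfl⟩ := Submodule.mem_span_singleton.1 hy
        obtain ⟨x0, hx0, y0, hy0, hxy0⟩ := Submodule.mem_sup.1 hd0
        obtain ⟨t0, rfl⟩ := Submodule.mem_span_singleton.1 hy0
        have ht0 : t0 ≠ 0 := by
          rintro rfl
          rw [zero_smul, add_zero] at hxy0
          exact hne (h3 a0 ha0 (hxy0 ▸ hx0))
        have e : a - (t / t0) • a0 = x - (t / t0) • x0 := by
          rw [← hxy, ← hxy0, smul_add, smul_smul, div_mul_cancel₀ _ ht0]; abel
        have e0 := h3 (a - (t / t0) • a0) (sub_mem ha (A.smul_mem _ ha0))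
          (by rw [e]; exact sub_mem hx (Δ.smul_mem _ hx0))
        have e1 : a = (t / t0) • a0 := sub_eq_zero.1 e0
        have e2 : f a = 0 := hav
        rw [e1, map_smul, smul_eq_mul] at e2
        rcases mul_eq_zero.1 e2 with h | h
        · rw [e1, h, zero_smul]
        · exact absurd h hf
      · exact (Nat.sub_le_sub_right h4 1).trans (finrank_inf_ker A _)
    · push Not at hz
      refine ⟨A, ?_, h2, hz, by omega⟩
      intro a ha
      rw [H.mem_perp_sup]
      exact ⟨h1 ha, H.mem_perp_span_singleton.2 (hc a ha)⟩

lemma wi_sup [FiniteDimensional F V] (H : Herm σ ω) (D : Submodule F V) {Δ : Submodule F V} {r : ℕ}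
    (h : H.wi Δ r) : H.wi (Δ ⊔ D) (r - Module.finrank F D) := by
  let b := Module.finBasis F D
  have key : ∀ (k : ℕ) (v : Fin k → V), H.wi (Δ ⊔ Submodule.span F (Set.range v)) (r - k) := by
    intro k
    induction k with
    | zero => intro v; simpa using h
    | succ k ih =>
      intro v
      have h1 := H.wi_one (ih (fun i => v i.castSucc)) (v (Fin.last k))
      have h2 : Δ ⊔ Submodule.span F (Set.range v) =
          Δ ⊔ Submodule.span F (Set.range fun i : Fin k => v i.castSucc) ⊔ F ∙ v (Fin.last k) := by
        rw [sup_assoc, ← Submodule.span_union]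
        congr 2
        ext x
        constructor
        · rintro ⟨i, rfl⟩
          refine Fin.lastCases ?_ (fun i => ?_) i
          · right; rfl
          · left; exact ⟨i, rfl⟩
        · rintro (⟨i, rfl⟩ | h)
          · exact ⟨_, rfl⟩
          · exact ⟨_, h.symm⟩
      rw [h2, show r - (k+1) = r - k - 1 by omega]
      exact h1
  have := key _ (fun i => (b i : V))
  have e : Submodule.span F (Set.range fun i => (b i : V)) = D := by
    have := congrArg (Submodule.map D.subtype) b.span_eq
    rw [Submodule.map_span, ← Set.range_comp, Submodule.map_top, Submodule.range_subtype] at this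
    exact this
  rwa [e] at this

lemma wi_two [FiniteDimensional F V] (H : Herm σ ω) {Δ : Submodule F V} {r : ℕ}
    (h : H.wi Δ r) (v w : V) (hv : v ∈ H.perp Δ) (hw : w ∈ H.perp Δ) (hvv : ω v v = 0)
    (hvw : ω v w ≠ 0) : H.wi (Δ ⊔ (F ∙ v ⊔ F ∙ w)) (r - 1) := by
  obtain ⟨A, h1, h2, h3, h4⟩ := h
  have hwv := H.ne_zero_symm hvw
  -- elements orthogonal to v, w in the sum lie in Δ
  have key : ∀ a, ω v a = 0 → ω w a = 0 → a ∈ Δ ⊔ (F ∙ v ⊔ F ∙ w) → a ∈ Δ := by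
    intro a ha hb hd
    obtain ⟨x, hx, y, hy, rfl⟩ := Submodule.mem_sup.1 hd
    obtain ⟨y1, hy1, y2, hy2, rfl⟩ := Submodule.mem_sup.1 hy
    obtain ⟨s, rfl⟩ := Submodule.mem_span_singleton.1 hy1
    obtain ⟨t, rfl⟩ := Submodule.mem_span_singleton.1 hy2
    have e1 : ω v x = 0 := H.eq_zero_symm (hv x hx)
    have e2 : ω w x = 0 := H.eq_zero_symm (hw x hx)
    simp only [H.add_r, H.smul_r, e1, e2, hvv] at ha hb
    have ht : t = 0 := by simpa [hvw] using ha
    subst ht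
    have hs : s = 0 := by simpa [hwv] using hb
    subst hs
    simpa using hx
  by_cases hc : v ∈ A ⊔ Δ
  · obtain ⟨a0, ha0, x0, hx0, hax⟩ := Submodule.mem_sup.1 hc
    have hva : ∀ a ∈ A, ω v a = 0 := by
      intro a ha
      rw [← hax, H.add_l, h2 a0 ha0 a ha, h1 ha x0 hx0, add_zero]
    refine ⟨A ⊓ LinearMap.ker (H.L w), ?_, fun a ha b hb => h2 a ha.1 b hb.1, ?_,
      (Nat.sub_le_sub_right h4 1).trans (finrank_inf_ker A _)⟩
    · rintro a ⟨ha, haw⟩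
      rw [H.mem_perp_sup, H.mem_perp_sup]
      exact ⟨h1 ha, H.mem_perp_span_singleton.2 (hva a ha), H.mem_perp_span_singleton.2 haw⟩
    · rintro a ⟨ha, haw⟩ hd
      exact h3 a ha (key a (hva a ha) haw hd)
  · let p : V →ₗ[F] V := LinearMap.id - (((ω w v)⁻¹) • H.L w).smulRight v
    have hp : ∀ a, p a = a - ((ω w v)⁻¹ * ω w a) • v := fun a => rfl
    have hpv : ∀ a, ω v a = 0 → ω v (p a) = 0 := by
      intro a ha
      rw [hp, H.sub_r, H.smul_r, hvv, ha]; ring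
    have hpw : ∀ a, ω w (p a) = 0 := by
      intro a
      rw [hp, H.sub_r, H.smul_r]; field_simp; ring
    refine H.wi_of_map (A := A ⊓ LinearMap.ker (H.L v)) p ?_ ?_ ?_
      ((Nat.sub_le_sub_right h4 1).trans (finrank_inf_ker A _))
    · rintro a ⟨ha, hav⟩
      rw [H.mem_perp_sup, H.mem_perp_sup]
      refine ⟨?_, H.mem_perp_span_singleton.2 (hpv a hav), H.mem_perp_span_singleton.2 (hpw a)⟩
      rw [hp]
      exact sub_mem (h1 ha) (Submodule.smul_mem _ _ hv)
    · rintro a ⟨ha, hav⟩ b ⟨hb, hbv⟩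
      have e1 : ω v b = 0 := hbv
      have e2 : ω a v = 0 := H.eq_zero_symm hav
      rw [hp, hp, H.sub_l, H.sub_r, H.sub_r, H.smul_l, H.smul_l, H.smul_r, H.smul_r, e1, e2, hvv,
        h2 a ha b hb]
      ring
    · rintro a ⟨ha, hav⟩ hd
      have e := key _ (hpv a hav) (hpw a) hd
      by_cases ht : (ω w v)⁻¹ * ω w a = 0
      · rw [hp, ht, zero_smul, sub_zero] at e
        exact h3 a ha e
      · exfalso
        apply hc
        obtain ⟨t, ht'⟩ : ∃ t, t = (ω w v)⁻¹ * ω w a := ⟨_, rfl⟩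
        rw [← ht'] at ht
        rw [hp, ← ht'] at e
        have : v = t⁻¹ • a - t⁻¹ • (a - t • v) := by
          rw [smul_sub, smul_smul, inv_mul_cancel₀ ht, one_smul]; abel
        rw [this]
        exact sub_mem (Submodule.smul_mem _ _ (Submodule.mem_sup_left ha))
          (Submodule.smul_mem _ _ (Submodule.mem_sup_right e))

lemma wi_four [FiniteDimensional F V] (H : Herm σ ω) {R : Submodule F V} {r : ℕ}
    (h : H.wi R r) (e f : V) (heR : e ∈ R) (he : e ∈ H.perp R) (hef : ω e f = 1) :
    H.wi (R ⊔ F ∙ f) r := by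
  obtain ⟨A, h1, h2, h3, h4⟩ := h
  have hfe : ω f e = 1 := by rw [H.symm e, hef, map_one]
  let p : V →ₗ[F] V := LinearMap.id - (H.L f).smulRight e
  have hp : ∀ a, p a = a - (ω f a) • e := fun a => rfl
  have hpR : ∀ a ∈ A, p a ∈ H.perp R := fun a ha => sub_mem (h1 ha) (Submodule.smul_mem _ _ he)
  refine H.wi_of_map (A := A) p ?_ ?_ ?_ h4
  · intro a ha
    rw [H.mem_perp_sup]
    refine ⟨hpR a ha, H.mem_perp_span_singleton.2 ?_⟩
    rw [hp, H.sub_r, H.smul_r, hfe]; ring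
  · intro a ha b hb
    have e1 : ω e b = 0 := h1 hb e heR
    have e2 : ω a e = 0 := H.eq_zero_symm (h1 ha e heR)
    have e3 : ω e e = 0 := he e heR
    rw [hp, hp, H.sub_l, H.sub_r, H.sub_r, H.smul_l, H.smul_l, H.smul_r, H.smul_r, e1, e2, e3,
        h2 a ha b hb]
    ring
  · intro a ha hd
    have ep : ω e (p a) = 0 := hpR a ha e heR
    obtain ⟨x, hx, y, hy, hxy⟩ := Submodule.mem_sup.1 hd
    obtain ⟨t, rfl⟩ := Submodule.mem_span_singleton.1 hy
    rw [← hxy, H.add_r, H.smul_r, hef, H.eq_zero_symm (he x hx)] at ep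
    have ht : t = 0 := by simpa using ep
    rw [ht, zero_smul, add_zero, hp] at hxy
    apply h3 a ha
    have : a = x + ω f a • e := by rw [hxy]; abel
    rw [this]
    exact add_mem hx (Submodule.smul_mem _ _ heR)

end Herm

end herm

end HS

set_option linter.unusedVariables false
set_option linter.unusedSimpArgs false

namespace HS
open FreeAbelianGroup

section conf
variable {F : Type} [Field F] {σ : F →+* F} {V : Type} [AddCommGroup V] [Module F V]

/-- isometric embeddings of `Δ` which extend to `V` -/
structure TS (ω : V → V → F) (Δ : Submodule F V) where
  φ : Δ → V
  ex : ∃ g : bilinIsoms F ω, ∀ x : Δ, φ x = g • (x : V)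

variable {ω : V → V → F}

lemma TS.ext' {Δ : Submodule F V} {a b : TS ω Δ} (h : ∀ x, a.φ x = b.φ x) : a = b := by
  cases a; cases b
  congr 1
  exact funext h

instance (Δ : Submodule F V) : MulAction (bilinIsoms F ω) (TS ω Δ) where
  smul g a := ⟨fun x => g • a.φ x, by
    obtain ⟨h, hh⟩ := a.ex
    exact ⟨g * h, fun x => by rw [hh, mul_smul]⟩⟩
  one_smul a := TS.ext' fun x => one_smul _ _
  mul_smul g h a := TS.ext' fun x => mul_smul _ _ _

@[simp] lemma TS.smul_φ {Δ : Submodule F V} (g : bilinIsoms F ω) (a : TS ω Δ) (x : Δ) :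
    (g • a).φ x = g • a.φ x := rfl

/-- base point -/
def TS.base (ω : V → V → F) (Δ : Submodule F V) : TS ω Δ := ⟨fun x => x, 1, fun x => (one_smul _ _).symm⟩

lemma TS.exists_smul {Δ : Submodule F V} (a : TS ω Δ) : ∃ g : bilinIsoms F ω, a = g • TS.base ω Δ := by
  obtain ⟨g, hg⟩ := a.ex
  exact ⟨g, TS.ext' hg⟩

/-- hyperbolic pairs -/
@[ext] structure HPr (ω : V → V → F) where
  e : V
  f : V
  ee : ω e e = 0
  ff : ω f f = 0
  ef : ω e f = 1

instance : MulAction (bilinIsoms F ω) (HPr ω) where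
  smul g E := ⟨g • E.e, g • E.f, by rw [Herm.isom g, E.ee], by rw [Herm.isom g, E.ff],
    by rw [Herm.isom g, E.ef]⟩
  one_smul E := HPr.ext (one_smul _ _) (one_smul _ _)
  mul_smul g h E := HPr.ext (mul_smul _ _ _) (mul_smul _ _ _)

@[simp] lemma HPr.smul_e (g : bilinIsoms F ω) (E : HPr ω) : (g • E).e = g • E.e := rfl
@[simp] lemma HPr.smul_f (g : bilinIsoms F ω) (E : HPr ω) : (g • E).f = g • E.f := rfl

structure TP (ω : V → V → F) (Δ : Submodule F V) where
  t : TS ω Δ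
  E : HPr ω
  he : ∀ x, ω (t.φ x) E.e = 0
  hf : ∀ x, ω (t.φ x) E.f = 0

lemma TP.ext' {Δ : Submodule F V} {a b : TP ω Δ} (h : a.t = b.t) (h' : a.E = b.E) : a = b := by
  cases a; cases b
  congr 1

instance (Δ : Submodule F V) : MulAction (bilinIsoms F ω) (TP ω Δ) where
  smul g a := ⟨g • a.t, g • a.E, fun x => (Herm.isom g _ _).trans (a.he x),
    fun x => (Herm.isom g _ _).trans (a.hf x)⟩
  one_smul a := TP.ext' (one_smul _ _) (one_smul _ _)
  mul_smul g h a := TP.ext' (mul_smul _ _ _) (mul_smul _ _ _)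

@[simp] lemma TP.smul_t {Δ : Submodule F V} (g : bilinIsoms F ω) (a : TP ω Δ) :
    (g • a).t = g • a.t := rfl
@[simp] lemma TP.smul_E {Δ : Submodule F V} (g : bilinIsoms F ω) (a : TP ω Δ) :
    (g • a).E = g • a.E := rfl

/-- the pair attached to `Δ` -/
def TT (ω : V → V → F) (Δ : Submodule F V) : GP (bilinIsoms F ω) where
  S := TS ω Δ
  P := TP ω Δ
  f p := p.t
  hf _ _ := rfl

/-- restriction along an isometry -/
def res {Δ Δ' : Submodule F V} (g : bilinIsoms F ω) (h : ∀ x ∈ Δ, g • x ∈ Δ') :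
    GPHom (TT ω Δ') (TT ω Δ) where
  s a := ⟨fun x => a.φ ⟨g • (x : V), h x x.2⟩, by
    obtain ⟨k, hk⟩ := TS.ex a
    exact ⟨k * g, fun x => by rw [hk, mul_smul]⟩⟩
  p a := ⟨⟨fun x => a.t.φ ⟨g • (x : V), h x x.2⟩, by
    obtain ⟨k, hk⟩ := TS.ex a.t
    exact ⟨k * g, fun x => by rw [hk, mul_smul]⟩⟩, a.E, fun x => a.he _, fun x => a.hf _⟩
  hs _ _ := rfl
  hp _ _ := rfl
  comm _ := rfl

lemma one_res {Δ Δ' : Submodule F V} (h : Δ ≤ Δ') : ∀ x ∈ Δ, (1 : bilinIsoms F ω) • x ∈ Δ' :=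
  fun x hx => by rw [one_smul]; exact h hx

/-- plain restriction -/
def res1 (ω : V → V → F) {Δ Δ' : Submodule F V} (h : Δ ≤ Δ') : GPHom (TT ω Δ') (TT ω Δ) where
  s a := ⟨fun x => a.φ ⟨x, h x.2⟩, by
    obtain ⟨k, hk⟩ := TS.ex a
    exact ⟨k, fun x => hk _⟩⟩
  p a := ⟨⟨fun x => a.t.φ ⟨x, h x.2⟩, by
    obtain ⟨k, hk⟩ := TS.ex a.t
    exact ⟨k, fun x => hk _⟩⟩, a.E, fun x => a.he _, fun x => a.hf _⟩
  hs _ _ := rfl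
  hp _ _ := rfl
  comm _ := rfl

/-- an equivariant family of subsets over `TS ω Δ` -/
abbrev Fam (ω : V → V → F) (Δ : Submodule F V) := EqFam (bilinIsoms F ω) (TS ω Δ) V

def PF {Δ : Submodule F V} (Φ : Fam ω Δ) : PairFam (TT ω Δ) V where
  Φ := Φ
  Φ' := ⟨fun p => {v | v ∈ Φ.Ω p.t ∧ ω v p.E.e = 0 ∧ ω v p.E.f = 0}, by
    rintro g s v ⟨h1, h2, h3⟩
    exact ⟨Φ.eqv g _ _ h1, (Herm.isom g _ _).trans h2, (Herm.isom g _ _).trans h3⟩⟩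
  le p v hv := hv.1

lemma Fam.mem_of_base {Δ Δ' : Submodule F V} (Φ : Fam ω Δ) (h : Δ ≤ Δ') (a : TS ω Δ') (v : V)
    (hv : v ∈ Φ.Ω (TS.base ω Δ)) (hv' : v ∈ Δ') :
    a.φ ⟨v, hv'⟩ ∈ Φ.Ω ((res1 ω h).s a) := by
  obtain ⟨g, hg⟩ := a.ex
  have e : (res1 ω h).s a = g • TS.base ω Δ := TS.ext' fun x => hg _
  rw [e, hg]
  exact Φ.eqv g _ _ hv

/-- the map `θ_η` -/
def theta {Δ Δ' : Submodule F V} (Φ : Fam ω Δ) (h : Δ ≤ Δ') {k : ℕ} (η : Fin k → V)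
    (hη : ∀ i, η i ∈ Φ.Ω (TS.base ω Δ)) (hη' : ∀ i, η i ∈ Δ') :
    GPHom (TT ω Δ') (tupGP (PF Φ) k) where
  s a := ⟨(res1 ω h).s a, fun i => TS.φ a ⟨η i, hη' i⟩, fun i => Fam.mem_of_base Φ h a _ (hη i) _⟩
  p a := ⟨(res1 ω h).p a, fun i => TS.φ (TP.t a) ⟨η i, hη' i⟩, fun i =>
    ⟨Fam.mem_of_base Φ h (TP.t a) _ (hη i) _, TP.he a _, TP.hf a _⟩⟩
  hs _ _ := rfl
  hp _ _ := rfl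
  comm _ := rfl

/-- forget the tuple -/
def forget {X : GP (bilinIsoms F ω)} (Φ : PairFam X V) (k : ℕ) : GPHom (tupGP Φ k) X where
  s a := a.t
  p a := a.t
  hs _ _ := rfl
  hp _ _ := rfl
  comm _ := rfl

/-- empty tuple -/
def unforget {X : GP (bilinIsoms F ω)} (Φ : PairFam X V) : GPHom X (tupGP Φ 0) where
  s a := ⟨a, fun i => i.elim0, fun i => i.elim0⟩
  p a := ⟨a, fun i => i.elim0, fun i => i.elim0⟩
  hs _ _ := Tup.ext' rfl (fun i => i.elim0)
  hp _ _ := Tup.ext' rfl (fun i => i.elim0)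
  comm _ := Tup.ext' rfl (fun i => i.elim0)

lemma TS_lin {Δ : Submodule F V} (a : TS ω Δ) : ∃ L : Δ →ₗ[F] V, ∀ x, L x = a.φ x := by
  obtain ⟨g, hg⟩ := a.ex
  exact ⟨g.1.toLinearMap ∘ₗ Δ.subtype, fun x => (hg x).symm⟩

lemma TS_ext_sup {Δ : Submodule F V} {k : ℕ} (η : Fin k → V)
    (a b : TS ω (Δ ⊔ Submodule.span F (Set.range η)))
    (h1 : ∀ x (hx : x ∈ Δ), a.φ ⟨x, Submodule.mem_sup_left hx⟩ = b.φ ⟨x, Submodule.mem_sup_left hx⟩)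
    (h2 : ∀ i, a.φ ⟨η i, Submodule.mem_sup_right (Submodule.subset_span ⟨i, rfl⟩)⟩ =
      b.φ ⟨η i, Submodule.mem_sup_right (Submodule.subset_span ⟨i, rfl⟩)⟩) : a = b := by
  obtain ⟨g, hg⟩ := a.ex
  obtain ⟨g', hg'⟩ := b.ex
  have key : Δ ⊔ Submodule.span F (Set.range η) ≤ LinearMap.eqLocus g.1.toLinearMap g'.1.toLinearMap := by
    apply sup_le
    · intro x hx
      have := h1 x hx
      rw [hg, hg'] at this
      exact this
    · rw [Submodule.span_le]
      rintro _ ⟨i, rfl⟩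
      have := h2 i
      rw [hg, hg'] at this
      exact this
  apply TS.ext'
  rintro ⟨x, hx⟩
  rw [hg, hg']
  exact key hx

lemma sup_span_mem {Δ : Submodule F V} {k : ℕ} (η : Fin k → V) (i : Fin k) :
    η i ∈ Δ ⊔ Submodule.span F (Set.range η) :=
  Submodule.mem_sup_right (Submodule.subset_span ⟨i, rfl⟩)

/-- cycles on tuples are generated by the images of `θ_η` -/
lemma gen_tup (H : Herm σ ω) {Δ : Submodule F V} (Φ : Fam ω Δ) {k n : ℕ}
    (A : AddSubgroup (Rel (tupGP (PF Φ) k) (n + 1)))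
    (hA : ∀ (η : Fin k → V) (hη : ∀ i, η i ∈ Φ.Ω (TS.base ω Δ))
      (m : Rel (TT ω (Δ ⊔ Submodule.span F (Set.range η))) (n + 1)), Rel.d m = 0 →
      Rel.map (theta Φ le_sup_left η hη (sup_span_mem η)) m ∈ A)
    (z : Rel (tupGP (PF Φ) k) (n + 1)) (hz : Rel.d z = 0) : z ∈ A := by
  classical
  let I := MulAction.orbitRel.Quotient (bilinIsoms F ω) (Tup Φ k)
  have hrep : ∀ i : I, ∃ (η : Fin k → V) (hη : ∀ i, η i ∈ Φ.Ω (TS.base ω Δ)),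
      (Quotient.mk'' (⟨TS.base ω Δ, η, hη⟩ : Tup Φ k) : I) = i := by
    intro i
    induction i using Quotient.inductionOn' with
    | h q =>
      obtain ⟨g, hg⟩ := TS.exists_smul q.t
      have hm : ∀ i, g⁻¹ • q.η i ∈ Φ.Ω (TS.base ω Δ) := by
        intro i
        have := Φ.eqv g⁻¹ _ _ (q.mem i)
        rwa [hg, inv_smul_smul] at this
      refine ⟨fun i => g⁻¹ • q.η i, hm, Quotient.sound' ?_⟩
      refine ⟨g⁻¹, Tup.ext' ?_ fun i => rfl⟩
      show g⁻¹ • q.t = _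
      rw [hg, inv_smul_smul]
  choose η hη hr using hrep
  have hlift : ∀ i : I, ∀ q : Tup Φ k, (Quotient.mk'' q : I) = i →
      ∃ g : bilinIsoms F ω, q = g • (⟨TS.base ω Δ, η i, hη i⟩ : Tup Φ k) := by
    intro i q hq
    have := hq.trans (hr i).symm
    obtain ⟨g, hg⟩ := Quotient.exact' this
    exact ⟨g, hg.symm⟩
  refine gen (X := tupGP (PF Φ) k) (I := I) (fun s => (Quotient.mk'' (show Tup Φ k from s) : I))
    (fun i => TT ω (Δ ⊔ Submodule.span F (Set.range (η i))))
    (fun i => theta Φ le_sup_left (η i) (hη i) (sup_span_mem (η i))) ?_ ?_ ?_ ?_ ?_ ?_ A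
    (fun i m hm => hA (η i) (hη i) m hm) z hz
  · intro i u
    obtain ⟨g, hg⟩ := TS.ex u
    refine Eq.trans (Quotient.sound' ?_) (hr i)
    refine ⟨g, Tup.ext' ?_ ?_⟩
    · exact TS.ext' fun x => (hg ⟨x, Submodule.mem_sup_left x.2⟩).symm
    · intro j
      exact (hg ⟨η i j, sup_span_mem (η i) j⟩).symm
  · intro s
    obtain ⟨g, hg⟩ := hlift _ s rfl
    refine ⟨(⟨fun x => g • (x : V), g, fun x => rfl⟩ : TS ω _), ?_⟩
    refine Eq.trans ?_ hg.symm
    exact Tup.ext' (TS.ext' fun x => rfl) fun i => rfl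
  · intro p
    obtain ⟨g, hg⟩ := hlift _ ((tupGP (PF Φ) k).f p) rfl
    have e1 : ∀ x, (TP.t (Tup.t p)).φ x = g • (x : V) := by
      intro x
      exact congrArg (fun q : Tup Φ k => q.t.φ x) hg
    have e2 : ∀ i, Tup.η p i =
        g • (η (Quotient.mk'' ((tupGP (PF Φ) k).f p : Tup Φ k) : I) i) := by
      intro i
      exact congrArg (fun q : Tup Φ k => q.η i) hg
    obtain ⟨ηp, hηp⟩ : ∃ ηp, ηp = η ((Quotient.mk'' ((tupGP (PF Φ) k).f p : Tup Φ k) : I)) :=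
      ⟨_, rfl⟩
    have key : ∀ y, (∀ x ∈ Δ, ω (g • x) y = 0) → (∀ i, ω (g • ηp i) y = 0) →
        ∀ x ∈ Δ ⊔ Submodule.span F (Set.range ηp), ω (g • x) y = 0 := by
      intro y h1 h2 x hx
      have : g⁻¹ • y ∈ H.perp (Δ ⊔ Submodule.span F (Set.range ηp)) := by
        rw [H.mem_perp_sup, H.mem_perp_span]
        constructor
        · intro x hx
          rw [Herm.isom' g⁻¹, inv_inv]; exact h1 x hx
        · rintro _ ⟨i, rfl⟩
          rw [Herm.isom' g⁻¹, inv_inv]; exact h2 i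
      have := this x hx
      rwa [Herm.isom' g⁻¹, inv_inv] at this
    have m1 : ∀ x ∈ Δ, ω (g • x) (TP.E (Tup.t p)).e = 0 := by
      intro x hx
      have := TP.he (Tup.t p) ⟨x, hx⟩
      rwa [e1] at this
    have m2 : ∀ x ∈ Δ, ω (g • x) (TP.E (Tup.t p)).f = 0 := by
      intro x hx
      have := TP.hf (Tup.t p) ⟨x, hx⟩
      rwa [e1] at this
    have m3 : ∀ i, ω (g • ηp i) (TP.E (Tup.t p)).e = 0 := by
      intro i
      rw [hηp, ← e2]
      exact (Tup.mem p i).2.1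
    have m4 : ∀ i, ω (g • ηp i) (TP.E (Tup.t p)).f = 0 := by
      intro i
      rw [hηp, ← e2]
      exact (Tup.mem p i).2.2
    rw [hηp] at key
    rw [hηp] at m3 m4
    refine ⟨(⟨⟨fun x => g • (x : V), g, fun x => rfl⟩, TP.E (Tup.t p),
      fun x => key _ m1 m3 x x.2, fun x => key _ m2 m4 x x.2⟩ : TP ω _), ?_⟩
    refine Tup.ext' (TP.ext' (TS.ext' fun x => ?_) rfl) fun i => ?_
    · exact (e1 x).symm
    · exact (e2 i).symm
  · intro i a b hab
    refine TS_ext_sup (η i) a b (fun x hx => ?_) (fun j => ?_)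
    · exact congrArg (fun q : Tup Φ k => q.t.φ ⟨x, hx⟩) hab
    · exact congrArg (fun q : Tup Φ k => q.η j) hab
  · intro i a b hab
    refine TP.ext' (TS_ext_sup (η i) _ _ (fun x hx => ?_) (fun j => ?_)) ?_
    · exact congrArg (fun q : Tup (PF Φ).Φ' k => q.t.t.φ ⟨x, hx⟩) hab
    · exact congrArg (fun q : Tup (PF Φ).Φ' k => q.η j) hab
    · exact congrArg (fun q : Tup (PF Φ).Φ' k => q.t.E) hab
  · intro g s
    exact Quotient.sound' ⟨g, rfl⟩

/-- Lemma L combined with generation -/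
lemma resolve (H : Herm σ ω) {Δ : Submodule F V} (Φ : Fam ω Δ)
    (h1 : ∀ s, (Φ.Ω s).Nonempty)
    (h2 : ∀ p : TP ω Δ, ∃ v ∈ Φ.Ω p.t, ω v p.E.e = 0 ∧ ω v p.E.f = 0) (m : ℕ)
    (hyp : ∀ k i, 1 ≤ k → k + i = m → ∀ (η : Fin (k + 1) → V)
      (hη : ∀ i, η i ∈ Φ.Ω (TS.base ω Δ))
      (μ : Rel (TT ω (Δ ⊔ Submodule.span F (Set.range η))) (i + 1)), Rel.d μ = 0 →
      Rel.map (theta Φ le_sup_left η hη (sup_span_mem η)) μ ∈ triv (PF Φ) (k + 1) i)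
    (A : AddSubgroup (Rel (TT ω Δ) (m + 1)))
    (hA : ∀ v ∈ Φ.Ω (TS.base ω Δ), ∀ μ : Rel (TT ω (Δ ⊔ F ∙ v)) (m + 1), Rel.d μ = 0 →
      Rel.map (res1 ω le_sup_left) μ ∈ A)
    (x : Rel (TT ω Δ) (m + 1)) (hx : Rel.d x = 0) : x ∈ A := by
  obtain ⟨z, hz, hze⟩ := lemmaL_tup (PF Φ) h1 h2 m
    (fun k i hk hki z hz => gen_tup H Φ _ (fun η hη μ hμ => hyp k i hk hki η hη μ hμ) z hz)
    (Rel.map (unforget (PF Φ)) x) (by rw [Rel.d_map, hx, map_zero])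
  have e1 : Rel.map (forget (PF Φ) 0) (Rel.map (unforget (PF Φ)) x) = x := by
    rw [Rel.map_map]
    exact Rel.map_id' _ (fun _ => rfl) (fun _ => rfl) x
  have e2 : Rel.map (forget (PF Φ) 0) (Rel.e z) = Rel.map (forget (PF Φ) 1) z := by
    have e3 : Rel.e z = Rel.map (faceHom (PF Φ) 0 0) z := by
      refine (Rel.e_apply z).trans ((Fin.sum_univ_one _).trans ?_)
      rw [Fin.val_zero, pow_zero, one_smul]
    rw [e3, Rel.map_map]
    rfl
  rw [← e1, ← hze, e2]
  have : z ∈ A.comap (Rel.map (forget (PF Φ) 1)) := by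
    refine gen_tup H Φ _ ?_ z hz
    intro η hη μ hμ
    show Rel.map (forget (PF Φ) 1) (Rel.map _ μ) ∈ A
    rw [Rel.map_map]
    have hspan : Δ ⊔ Submodule.span F (Set.range η) = Δ ⊔ F ∙ (η 0) := by
      congr 2
      ext y; constructor
      · rintro ⟨i, rfl⟩
        rw [Subsingleton.elim i 0]; rfl
      · intro h; exact ⟨0, h.symm⟩
    have gl : ∀ (Δ' : Submodule F V) (hΔ : Δ' = Δ ⊔ F ∙ (η 0)) (hle : Δ ≤ Δ') (hm : ∀ i, η i ∈ Δ')
        (μ : Rel (TT ω Δ') (m + 1)), Rel.d μ = 0 →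
        Rel.map ((forget (PF Φ) 1).comp (theta Φ hle η hη hm)) μ ∈ A := by
      rintro _ rfl hle hm μ hμ
      exact hA _ (hη 0) μ hμ
    exact gl _ hspan _ _ μ hμ
  exact this

end conf

end HS

set_option linter.unusedVariables false
set_option linter.unusedSimpArgs false

namespace HS
open FreeAbelianGroup

section ta
variable {F : Type} [Field F] {σ : F →+* F} {V : Type} [AddCommGroup V] [Module F V]
variable {ω : V → V → F}

def Iprop (ω : V → V → F) (Δ : Submodule F V) (b : ℕ) : Prop :=
  ∀ z : Rel (TT ω Δ) (b + 1), Rel.d z = 0 → ∃ w : Rel (TT ω Δ) (b + 2), Rel.d w = z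

def Cprop (H : Herm σ ω) (n : ℕ) : Prop :=
  ∀ (Δ₁ : Submodule F V) (e : V), e ∈ H.perp Δ₁ → ω e e = 0 → e ∉ Δ₁ → H.wi (Δ₁ ⊔ F ∙ e) n →
  ∀ A : AddSubgroup (Rel (TT ω (Δ₁ ⊔ F ∙ e)) (n + 1)), (∀ w, Rel.d w ∈ A) →
  (∀ f, f ∈ H.perp Δ₁ → ω f f = 0 → ω e f = 1 →
    ∀ μ : Rel (TT ω (Δ₁ ⊔ F ∙ e ⊔ F ∙ f)) (n + 1), Rel.d μ = 0 →
      Rel.map (res1 ω le_sup_left) μ ∈ A) →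
  ∀ z, Rel.d z = 0 → z ∈ A

def TAprop (H : Herm σ ω) (q : ℕ) : Prop :=
  ∀ (Δ : Submodule F V), H.wi Δ q → ∀ (g : bilinIsoms F ω) (hg : ∀ x ∈ Δ, g • x ∈ Δ)
    (m : Rel (TT ω Δ) (q + 1)), Rel.d m = 0 → ∃ w, Rel.d w = Rel.map (res g hg) m - m

lemma res_comp_res1 {Δ Δ' Δ'' : Submodule F V} (h1 : Δ ≤ Δ') (h2 : Δ' ≤ Δ'') :
    (res1 ω h1).comp (res1 ω h2) = res1 ω (h1.trans h2) := rfl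

lemma refl_triv (H : Herm σ ω) (W : Submodule F V) (w : V) (c : F) (hw : w ∈ W)
    (hc : rgood σ ω (w, c)) (hg : ∀ x ∈ W, H.rG w c hc • x ∈ W) {n : ℕ}
    (m : Rel (TT ω W) (n + 1)) (hm : Rel.d m = 0) :
    ∃ y, Rel.d y = Rel.map (res (H.rG w c hc) hg) m - m := by
  have hgood : ∀ s : TS ω W, rgood σ ω (s.φ ⟨w, hw⟩, c) := by
    intro s
    obtain ⟨g, hg⟩ := s.ex
    show c + σ c + c * σ c * ω (s.φ ⟨w, hw⟩) (s.φ ⟨w, hw⟩) = 0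
    rw [hg, Herm.isom g]
    exact hc
  have hs : ∀ s : TS ω W, (res (H.rG w c hc) hg).s s = H.rG (s.φ ⟨w, hw⟩) c (hgood s) • s := by
    intro s
    obtain ⟨g, hg'⟩ := s.ex
    apply TS.ext'
    intro x
    show s.φ ⟨H.rG w c hc • (x : V), _⟩ = H.rG (s.φ ⟨w, hw⟩) c (hgood s) • s.φ x
    rw [hg', hg' x]
    show g • (H.rG w c hc • (x : V)) = g • (x : V) + (c * ω (s.φ ⟨w, hw⟩) (g • (x : V))) • s.φ ⟨w, hw⟩
    rw [hg' ⟨w, hw⟩, Herm.isom g, Herm.rG_smul, Herm.smul_add', Herm.smul_smul']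
  refine Rel.conj (X := TT ω W) _ (fun s => H.rG (TS.φ s ⟨w, hw⟩) c (hgood s)) ?_ hs ?_ m hm
  · intro g s
    exact H.rG_conj g _ c (hgood s) _
  · intro p
    refine TP.ext' (hs (TP.t p)) ?_
    apply HPr.ext
    · show (TP.E p).e = H.rG _ c (hgood (TP.t p)) • (TP.E p).e
      rw [Herm.rG_smul, TP.he p]; simp
    · show (TP.E p).f = H.rG _ c (hgood (TP.t p)) • (TP.E p).f
      rw [Herm.rG_smul, TP.hf p]; simp

lemma rfn_mem (W : Submodule F V) (w : V) (c : F) (hw : w ∈ W) (x : V) (hx : x ∈ W) :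
    rfn ω w c x ∈ W := add_mem hx (W.smul_mem _ hw)

lemma rchain_mem (W : Submodule F V) (l : List (V × F)) (hl : ∀ p ∈ l, p.1 ∈ W) (x : V)
    (hx : x ∈ W) : rchain ω l x ∈ W := by
  induction l with
  | nil => exact hx
  | cons p l ih =>
    exact rfn_mem W _ _ (hl p List.mem_cons_self) _
      (ih fun q hq => hl q (List.mem_cons_of_mem _ hq))

lemma chain_triv (H : Herm σ ω) (W : Submodule F V) (l : List (V × F))
    (hl : ∀ p ∈ l, p.1 ∈ W) (hl' : ∀ p ∈ l, rgood σ ω p) (g : bilinIsoms F ω)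
    (hg : ∀ v, g • v = rchain ω l v) (hgW : ∀ x ∈ W, g • x ∈ W) {n : ℕ}
    (m : Rel (TT ω W) (n + 1)) (hm : Rel.d m = 0) :
    ∃ y, Rel.d y = Rel.map (res g hgW) m - m := by
  induction l generalizing g m with
  | nil =>
    refine ⟨0, ?_⟩
    have hx : ∀ x : V, g • x = x := hg
    rw [Rel.map_id' (res g hgW) (fun a => TS.ext' fun x => ?_)
      (fun a => TP.ext' (TS.ext' fun x => ?_) rfl), map_zero, sub_self]
    · exact congrArg (TS.φ a) (Subtype.ext (hx x))
    · exact congrArg (TS.φ (TP.t a)) (Subtype.ext (hx x))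
  | cons p l ih =>
    have h1 : ∀ q ∈ l, q.1 ∈ W := fun q hq => hl q (List.mem_cons_of_mem _ hq)
    have h2 : ∀ q ∈ l, rgood σ ω q := fun q hq => hl' q (List.mem_cons_of_mem _ hq)
    obtain ⟨g', hg'⟩ := H.exists_rchainG l h2
    have hg'W : ∀ x ∈ W, g' • x ∈ W := fun x hx => by
      rw [hg']; exact rchain_mem W l h1 x hx
    have hp := hl' p List.mem_cons_self
    have hpW : ∀ x ∈ W, H.rG p.1 p.2 hp • x ∈ W := fun x hx =>
      rfn_mem W _ _ (hl p List.mem_cons_self) x hx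
    obtain ⟨y1, hy1⟩ := refl_triv H W p.1 p.2 (hl p List.mem_cons_self) hp hpW m hm
    obtain ⟨y2, hy2⟩ := ih h1 h2 g' hg' hg'W (Rel.map (res (H.rG p.1 p.2 hp) hpW) m)
      (by rw [Rel.d_map, hm, map_zero])
    refine ⟨y1 + y2, ?_⟩
    have hx : ∀ x : V, g • x = H.rG p.1 p.2 hp • (g' • x) := by
      intro x
      rw [hg, hg']; rfl
    have e : (res g' hg'W).comp (res (H.rG p.1 p.2 hp) hpW) = res g hgW := by
      apply GPHom.ext'
      · intro a
        apply TS.ext'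
        intro x
        exact congrArg (TS.φ a) (Subtype.ext (hx x).symm)
      · intro a
        refine TP.ext' (TS.ext' fun x => ?_) rfl
        exact congrArg (TS.φ (TP.t a)) (Subtype.ext (hx x).symm)
    rw [map_add, hy1, hy2, Rel.map_map, e]
    abel

variable [FiniteDimensional F V]

lemma nondeg_red (H : Herm σ ω) (q : ℕ) (hC : Cprop H q) (s : ℕ) :
    ∀ Δ : Submodule F V, Module.finrank F V - Module.finrank F Δ = s → H.wi Δ q →
    ∀ A : AddSubgroup (Rel (TT ω Δ) (q + 1)), (∀ w, Rel.d w ∈ A) →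
    (∀ (W : Submodule F V) (hW : Δ ≤ W), (∀ x ∈ W, x ∈ H.perp W → x = 0) →
      ∀ μ : Rel (TT ω W) (q + 1), Rel.d μ = 0 → Rel.map (res1 ω hW) μ ∈ A) →
    ∀ z, Rel.d z = 0 → z ∈ A := by
  induction s using Nat.strong_induction_on with
  | _ s ih =>
  intro Δ hs hwi A hA hW z hz
  by_cases hn : ∀ x ∈ Δ, x ∈ H.perp Δ → x = 0
  · have := hW Δ le_rfl hn z hz
    rwa [Rel.map_id' _ (fun _ => rfl) (fun _ => rfl)] at this
  push Not at hn
  obtain ⟨e, he, hep, hne⟩ := hn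
  obtain ⟨Δ₁, hΔ, he1⟩ : ∃ Δ₁, Δ = Δ₁ ⊔ F ∙ e ∧ e ∉ Δ₁ := by
    obtain ⟨f, hf, -⟩ := Submodule.exists_le_ker_of_notMem (p := (⊥ : Submodule F V)) (v := e)
        (by simpa using hne)
    refine ⟨Δ ⊓ LinearMap.ker f, le_antisymm ?_ (sup_le inf_le_left ?_), fun h => hf h.2⟩
    · intro x hx
      have : x = (x - (f x / f e) • e) + (f x / f e) • e := by abel
      rw [this]
      refine Submodule.add_mem_sup ⟨sub_mem hx (Δ.smul_mem _ he), ?_⟩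
        (Submodule.smul_mem _ _ (Submodule.mem_span_singleton_self e))
      show f _ = 0
      rw [map_sub, map_smul, smul_eq_mul, div_mul_cancel₀ _ hf, sub_self]
    · rw [Submodule.span_singleton_le_iff_mem]; exact he
  subst hΔ
  refine hC Δ₁ e (H.perp_anti le_sup_left hep) (hep e he) he1 hwi A hA ?_ z hz
  intro f hf1 hf2 hf3 μ hμ
  have hfn : f ∉ Δ₁ ⊔ F ∙ e := by
    intro h
    have := H.eq_zero_symm (hep f h)
    rw [hf3] at this
    exact one_ne_zero this
  have hlt : Module.finrank F (Δ₁ ⊔ F ∙ e : Submodule F V) <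
      Module.finrank F (Δ₁ ⊔ F ∙ e ⊔ F ∙ f : Submodule F V) := by
    apply Submodule.finrank_lt_finrank_of_lt
    refine lt_of_le_of_ne le_sup_left fun h => hfn ?_
    rw [h]
    exact Submodule.mem_sup_right (Submodule.mem_span_singleton_self f)
  have hle := Submodule.finrank_le (Δ₁ ⊔ F ∙ e ⊔ F ∙ f : Submodule F V)
  refine ih (Module.finrank F V - Module.finrank F (Δ₁ ⊔ F ∙ e ⊔ F ∙ f : Submodule F V))
    (by omega) _ rfl (H.wi_four hwi e f he hep hf3)
    (A.comap (Rel.map (res1 ω le_sup_left))) ?_ ?_ μ hμ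
  · intro w
    show Rel.map _ (Rel.d w) ∈ A
    rw [← Rel.d_map]
    exact hA _
  · intro W hle' hWn ν hν
    show Rel.map _ (Rel.map _ ν) ∈ A
    rw [Rel.map_map]
    exact hW W (le_sup_left.trans hle') hWn ν hν

lemma TA_of_C (H : Herm σ ω) (q : ℕ) (hC : Cprop H q) : TAprop H q := by
  intro Δ hwi g hg m hm
  have key : m ∈ (AddMonoidHom.range (Rel.d : Rel (TT ω Δ) (q + 2) →+ _)).comap
      (Rel.map (res g hg) - AddMonoidHom.id _) := by
    refine nondeg_red H q hC _ Δ rfl hwi _ ?_ ?_ m hm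
    · intro w
      refine ⟨Rel.map (res g hg) w - w, ?_⟩
      rw [map_sub, Rel.d_map]; rfl
    · intro W hW hWn μ hμ
      have HW := H.restrict W hWn
      let b := Module.finBasis F Δ
      obtain ⟨l, hl, hl'⟩ := HW.witt _ (fun i => (⟨b i, hW (b i).2⟩ : W))
        (fun i => (⟨g • (b i : V), hW (hg _ (b i).2)⟩ : W)) (by
          have : LinearIndependent F (fun i => (b i : V)) :=
            b.linearIndependent.map' Δ.subtype (Submodule.ker_subtype Δ)
          exact LinearIndependent.of_comp W.subtype this) (by
          have : LinearIndependent F (fun i => g • (b i : V)) :=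
            (b.linearIndependent.map' Δ.subtype (Submodule.ker_subtype Δ)).map'
              g.1.toLinearMap g.1.ker
          exact LinearIndependent.of_comp W.subtype this)
          (fun i j => (Herm.isom g _ _).symm)
      have hch : ∀ (l : List (W × F)) (x : W),
          ((rchain (fun x y : W => ω x y) l x : W) : V) =
            rchain ω (l.map fun p => ((p.1 : V), p.2)) x := by
        intro l x
        induction l with
        | nil => rfl
        | cons p l ih =>
          show ((rfn (fun x y : W => ω x y) p.1 p.2 (rchain (fun x y : W => ω x y) l x) : W) : V) = rfn ω p.1 p.2 (rchain ω (l.map fun p => ((p.1 : V), p.2)) x)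
          rw [← ih]
          rfl
      have hgood : ∀ p ∈ l.map (fun p => ((p.1 : V), p.2)), rgood σ ω p := by
        intro p hp
        obtain ⟨q, hq, rfl⟩ := List.mem_map.1 hp
        exact hl q hq
      have hmem : ∀ p ∈ l.map (fun p => ((p.1 : V), p.2)), p.1 ∈ W := by
        intro p hp
        obtain ⟨q, hq, rfl⟩ := List.mem_map.1 hp
        exact q.1.2
      obtain ⟨γ, hγ⟩ := H.exists_rchainG _ hgood
      have hγW : ∀ x ∈ W, γ • x ∈ W := fun x hx => by
        rw [hγ]; exact rchain_mem W _ hmem x hx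
      obtain ⟨y, hy⟩ := chain_triv H W _ hmem hgood γ hγ hγW μ hμ
      have hagree : ∀ x ∈ Δ, γ • x = g • x := by
        have : γ.1.toLinearMap ∘ₗ Δ.subtype = g.1.toLinearMap ∘ₗ Δ.subtype := b.ext fun i => by
          show γ • (b i : V) = g • (b i : V)
          have := congrArg Subtype.val (hl' i)
          rw [hch] at this
          rw [hγ]; exact this
        intro x hx
        exact LinearMap.congr_fun this ⟨x, hx⟩
      refine ⟨Rel.map (res1 ω hW) y, ?_⟩
      rw [Rel.d_map, hy, map_sub]
      show _ = Rel.map (res g hg) (Rel.map (res1 ω hW) μ) - Rel.map (res1 ω hW) μ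
      rw [Rel.map_map, Rel.map_map]
      congr 3
      apply GPHom.ext'
      · intro a
        exact TS.ext' fun x => congrArg (TS.φ a) (Subtype.ext (hagree x x.2))
      · intro a
        exact TP.ext' (TS.ext' fun x => congrArg (TS.φ (TP.t a)) (Subtype.ext (hagree x x.2))) rfl
  obtain ⟨w, hw⟩ := key
  exact ⟨w, hw⟩

end ta

section sym
variable {F : Type} [Field F] {σ : F →+* F} {V : Type} [AddCommGroup V] [Module F V]
variable {ω : V → V → F} {Δ Δ' : Submodule F V}

/-- admissible vectors in `Δ'` -/
abbrev SA (Φ : Fam ω Δ) (Δ' : Submodule F V) : Type :=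
  {v : V // v ∈ Φ.Ω (TS.base ω Δ) ∧ v ∈ Δ'}

/-- the symbol group -/
abbrev SE (Φ : Fam ω Δ) (k q : ℕ) : Type := Rel (tupGP (PF Φ) k) (q + 1) ⧸ triv (PF Φ) k q

noncomputable def Sg (Φ : Fam ω Δ) (h : Δ ≤ Δ') {k q : ℕ} (m : Rel (TT ω Δ') (q + 1))
    (l : Fin k → SA Φ Δ') : SE Φ k q :=
  QuotientAddGroup.mk
    (Rel.map (theta Φ h (fun i => (l i).1) (fun i => (l i).2.1) (fun i => (l i).2.2)) m)

lemma Sg_cocycle (Φ : Fam ω Δ) (h : Δ ≤ Δ') {k q : ℕ} (m : Rel (TT ω Δ') (q + 1))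
    (hm : Rel.d m = 0) (l : Fin (k + 1) → SA Φ Δ') :
    FreeAbelianGroup.lift (Sg Φ h (k := k) m) (bdT l) = 0 := by
  rw [bdT, map_sum]
  have e := triv_e (PF Φ) (Rel.map (theta Φ h (fun i => (l i).1) (fun i => (l i).2.1)
    (fun i => (l i).2.2)) m) (by rw [Rel.d_map, hm, map_zero])
  rw [← QuotientAddGroup.eq_zero_iff, Rel.e_apply] at e
  refine Eq.trans ?_ e
  refine Eq.trans ?_ (map_sum (QuotientAddGroup.mk' (triv (PF Φ) k q)) _ _).symm
  refine Finset.sum_congr rfl fun i _ => ?_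
  rw [map_zsmul, map_zsmul, FreeAbelianGroup.lift_apply_of, Rel.map_map]
  rfl

lemma Sg_vanish (Φ : Fam ω Δ) (h : Δ ≤ Δ') {k q : ℕ} (m : Rel (TT ω Δ') (q + 1))
    (hm : Rel.d m = 0) (l : Fin k → SA Φ Δ') (Δ'' : Submodule F V) (h1 : Δ ≤ Δ'') (h2 : Δ'' ≤ Δ')
    (hl : ∀ i, (l i).1 ∈ Δ'') (hI : Iprop ω Δ'' q) : Sg Φ h m l = 0 := by
  obtain ⟨w, hw⟩ := hI (Rel.map (res1 ω h2) m) (by rw [Rel.d_map, hm, map_zero])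
  rw [Sg, QuotientAddGroup.eq_zero_iff]
  have : Rel.map (theta Φ h (fun i => (l i).1) (fun i => (l i).2.1) (fun i => (l i).2.2)) m =
      Rel.d (Rel.map (theta Φ h1 (fun i => (l i).1) (fun i => (l i).2.1) hl) w) := by
    rw [Rel.d_map, hw, Rel.map_map]
    rfl
  rw [this]
  exact triv_d _ _

lemma Sg_inv (H : Herm σ ω) (Φ : Fam ω Δ) (h : Δ ≤ Δ') {k q : ℕ} (hTA : TAprop H q)
    (hwi : H.wi Δ' q)
    (m : Rel (TT ω Δ') (q + 1)) (hm : Rel.d m = 0) (l l' : Fin k → SA Φ Δ') (g : bilinIsoms F ω)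
    (hg : ∀ x ∈ Δ, g • x = x) (hg' : ∀ x ∈ Δ', g • x ∈ Δ') (hl : ∀ i, g • (l i).1 = (l' i).1) :
    Sg Φ h m l' = Sg Φ h m l := by
  obtain ⟨w, hw⟩ := hTA Δ' hwi g hg' m hm
  have : Rel.map (theta Φ h (fun i => (l' i).1) (fun i => (l' i).2.1) (fun i => (l' i).2.2)) m =
      Rel.map (theta Φ h (fun i => (l i).1) (fun i => (l i).2.1) (fun i => (l i).2.2)) m +
      Rel.d (Rel.map (theta Φ h (fun i => (l i).1) (fun i => (l i).2.1) (fun i => (l i).2.2)) w) := by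
    rw [Rel.d_map, hw, map_sub, Rel.map_map, add_sub_cancel]
    congr 1
    congr 1
    apply GPHom.ext'
    · intro a
      refine Tup.ext' (TS.ext' fun x => ?_) fun i => ?_
      · exact congrArg (TS.φ a) (Subtype.ext (hg x x.2).symm)
      · exact congrArg (TS.φ a) (Subtype.ext (hl i).symm)
    · intro a
      refine Tup.ext' (TP.ext' (TS.ext' fun x => ?_) rfl) fun i => ?_
      · exact congrArg (TS.φ (TP.t a)) (Subtype.ext (hg x x.2).symm)
      · exact congrArg (TS.φ (TP.t a)) (Subtype.ext (hl i).symm)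
  rw [Sg, Sg, this, QuotientAddGroup.mk_add, (QuotientAddGroup.eq_zero_iff _).2 (triv_d _ _),
    add_zero]

end sym

end HS

set_option linter.unusedVariables false
set_option linter.unusedSimpArgs false

namespace HS
open FreeAbelianGroup

section coc
variable {A E : Type} [AddCommGroup E]

def Coc {k : ℕ} (S : (Fin k → A) → E) : Prop := ∀ l : Fin (k + 1) → A, FreeAbelianGroup.lift S (bdT l) = 0

lemma Coc.bd {k : ℕ} {S : (Fin k → A) → E} (h : Coc S) (x : TC (k + 1) A) :
    FreeAbelianGroup.lift S (HS.bd x) = 0 := by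
  induction x using FreeAbelianGroup.induction_on with
  | zero => simp
  | of l => rw [bd_of]; exact h l
  | neg l hl => rw [map_neg, map_neg, hl, neg_zero]
  | add x y hx hy => rw [map_add, map_add, hx, hy, add_zero]

lemma lift_tmap_inv {k : ℕ} (S : (Fin k → A) → E) (f : A → A) (h : ∀ l, S (f ∘ l) = S l)
    (x : TC k A) : FreeAbelianGroup.lift S (tmap f x) = FreeAbelianGroup.lift S x := by
  induction x using FreeAbelianGroup.induction_on with
  | zero => simp
  | of l => rw [tmap_of, lift_apply_of, lift_apply_of]; exact h l
  | neg l hl => rw [map_neg, map_neg, map_neg, hl]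
  | add x y hx hy => rw [map_add, map_add, map_add, hx, hy]

lemma Pr_zero {n : ℕ} (S : (Fin (n + 1) → A) → E) (p : Fin n → A × A)
    (h : ∀ l, (∀ r, ∃ j, l r = (p j).1 ∨ l r = (p j).2) → S l = 0) :
    FreeAbelianGroup.lift S (Pr n p) = 0 := by
  apply Pr_support
  rintro l ⟨i, r, rfl, h1, h2, h3⟩
  rw [lift_apply_of]
  apply h
  intro r
  rcases Nat.lt_trichotomy r i with hr | hr | hr
  · refine ⟨⟨r, by omega⟩, Or.inl ((h3 ⟨r, by omega⟩).1 ?_)⟩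
    exact hr
  · refine ⟨i, Or.inl ?_⟩
    rw [← h1]; congr 1; exact Fin.ext hr
  · rcases Nat.lt_or_ge (i + 1) r with hr' | hr'
    · refine ⟨⟨r - 1, by omega⟩, Or.inr ?_⟩
      rw [← (h3 ⟨r - 1, by omega⟩).2 (by rw [Fin.lt_def]; show (i : ℕ) < r - 1; omega)]
      congr 1; apply Fin.ext; show (r : ℕ) = r - 1 + 1; omega
    · refine ⟨i, Or.inr ?_⟩
      rw [← h2]; congr 1; apply Fin.ext; show (r : ℕ) = i + 1; omega

lemma prism_eq {n : ℕ} (M : (Fin (n + 1) → A) → E) (hM : Coc M) (p : Fin (n + 1) → A × A)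
    (h : ∀ (i : Fin (n + 1)) (l : Fin (n + 1) → A), (∀ r, ∃ j : Fin n,
      l r = (p (i.succAbove j)).1 ∨ l r = (p (i.succAbove j)).2) → M l = 0) :
    M (fun i => (p i).2) = M (fun i => (p i).1) := by
  have e := hM.bd (Pr (n + 1) p)
  rw [bd_Pr, map_sub, map_sub, lift_apply_of, lift_apply_of] at e
  have e2 : FreeAbelianGroup.lift M (PrH (bdT p)) = 0 := by
    rw [bdT, map_sum, map_sum]
    refine Finset.sum_eq_zero fun i _ => ?_
    rw [map_zsmul, map_zsmul, PrH_of, Pr_zero, smul_zero]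
    exact h i
  rw [e2, sub_zero, sub_eq_zero] at e
  exact e

lemma coc_cons {k : ℕ} {S : (Fin (k + 1) → A) → E} (hS : Coc S) (a : A) (l : Fin (k + 1) → A)
    (i : Fin (k + 1)) (h : ∀ j, j ≠ i → S (Fin.cons a (fun r => l (j.succAbove r))) = 0) :
    S l = (-1 : ℤ) ^ (i : ℕ) • S (Fin.cons a (fun r => l (i.succAbove r))) := by
  have e := hS (Fin.cons a l)
  rw [bdT, map_sum, Fin.sum_univ_succ] at e
  rw [Finset.sum_eq_single i] at e
  · rw [map_zsmul, map_zsmul, lift_apply_of, lift_apply_of] at e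
    have e1 : (fun j => (Fin.cons a l : Fin (k + 2) → A) ((0 : Fin (k + 2)).succAbove j)) = l := by
      funext j; simp
    have e2 : (fun j => (Fin.cons a l : Fin (k + 2) → A) (i.succ.succAbove j)) =
        Fin.cons a (fun r => l (i.succAbove r)) := by
      funext j
      refine Fin.cases ?_ (fun j => ?_) j <;> simp
    rw [e1, e2] at e
    simp only [Fin.val_zero, pow_zero, one_smul, Fin.val_succ, pow_succ, mul_neg, mul_one, neg_smul] at e
    rwa [add_neg_eq_zero] at e
  · intro j _ hj
    rw [map_zsmul, lift_apply_of]
    have e2 : (fun r => (Fin.cons a l : Fin (k + 2) → A) (j.succ.succAbove r)) =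
        Fin.cons a (fun r => l (j.succAbove r)) := by
      funext j
      refine Fin.cases ?_ (fun j => ?_) j <;> simp
    rw [e2, h j hj, smul_zero]
  · simp

end coc

section aniso
variable {F : Type} [Field F] {σ : F →+* F}

lemma span_diff_lt {L : Type} [AddCommGroup L] [Module F L] {n : ℕ} (w : Fin (n + 1) → L) :
    Module.finrank F (Submodule.span F (Set.range fun j : Fin n => w j.succ - w 0)) ≤ n := by
  have := finrank_range_le_card (R := F) (fun j : Fin n => w j.succ - w 0)
  rwa [Fintype.card_fin] at this

lemma mem_span_diff {L : Type} [AddCommGroup L] [Module F L] {n : ℕ} (w : Fin (n + 1) → L) (j) :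
    w j - w 0 ∈ Submodule.span F (Set.range fun j : Fin n => w j.succ - w 0) := by
  refine Fin.cases ?_ (fun j => ?_) j
  · simp
  · exact Submodule.subset_span ⟨j, rfl⟩

lemma aniso (u : F) (hu : u ≠ 1) (E : Type) [AddCommGroup E] (k : ℕ) :
    ∀ (L : Type) [AddCommGroup L] [Module F L] [FiniteDimensional F L] (ω : L → L → F)
    (H : Herm σ ω) (han : ∀ x, ω x x = 0 → x = 0) (hk : Module.finrank F L = k + 1)
    (d' : L) (hd : d' ≠ 0) (S : (Fin (k + 2) → L) → E) (hS : Coc S)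
    (hdep : ∀ l (x0 : L) (U : Submodule F L), Module.finrank F U < k + 1 →
      (∀ i, l i - x0 ∈ U) → S l = 0)
    (htr : ∀ l (c : L), S (fun i => l i + c) = S l)
    (hinv : ∀ (P : Submodule F L) (s : L →ₗ[F] L), d' ∈ P → (∀ x ∈ P, s x = u • x) →
      (∀ x ∈ H.perp P, s x = x) → ∀ l, S (s ∘ l) = S l) (l : Fin (k + 2) → L), S l = 0 := by
  induction k using Nat.strong_induction_on with
  | _ k ih =>
  intro L _ _ _ ω H han hk d' hd S hS hdep htr hinv
  have hdd : ω d' d' ≠ 0 := fun h => hd (han _ h)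
  let a : L →ₗ[F] F := (ω d' d')⁻¹ • H.L d'
  have had : a d' = 1 := inv_mul_cancel₀ hdd
  have ha_apply : ∀ x, a x = (ω d' d')⁻¹ * ω d' x := fun x => rfl
  let π : L →ₗ[F] L := LinearMap.id - a.smulRight d'
  have hπ : ∀ x, π x = x - a x • d' := fun x => rfl
  have hπd : ∀ c : F, π (c • d') = 0 := fun c => by
    rw [hπ, map_smul, had, smul_eq_mul, mul_one, sub_self]
  have haπ : ∀ x, a (π x) = 0 := fun x => by
    rw [hπ, map_sub, map_smul, had, smul_eq_mul, mul_one, sub_self]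
  have hππ : ∀ x, a x = 0 → π x = x := fun x hx => by rw [hπ, hx, zero_smul, sub_zero]
  let Nc : F → (Fin (k + 1) → L) → E := fun c l' =>
    FreeAbelianGroup.lift S (Pr (k + 1) fun i => (l' i, π (l' i) + c • d'))
  -- dependence
  have hNdep : ∀ c l' (x0 : L) (U : Submodule F L), Module.finrank F U < k + 1 → d' ∈ U →
      (∀ i, l' i - x0 ∈ U) → Nc c l' = 0 := by
    intro c l' x0 U hU hdU hl
    refine Pr_zero S _ fun l hl2 => hdep l x0 U hU fun r => ?_
    obtain ⟨j, hj | hj⟩ := hl2 r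
    · rw [hj]; exact hl j
    · rw [hj]
      show π (l' j) + c • d' - x0 ∈ U
      have : π (l' j) + c • d' - x0 = (l' j - x0) + (c - a (l' j)) • d' := by
        rw [hπ, sub_smul]; abel
      rw [this]
      exact add_mem (hl j) (U.smul_mem _ hdU)
  have hNS : ∀ c l, FreeAbelianGroup.lift (Nc c) (bdT l) = - S l := by
    intro c l
    have e := hS.bd (Pr (k + 2) fun i => (l i, π (l i) + c • d'))
    rw [bd_Pr, map_sub, map_sub, lift_apply_of, lift_apply_of] at e
    have e1 : S (fun i => π (l i) + c • d') = 0 := by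
      refine hdep _ (c • d') (LinearMap.ker a) ?_ fun i => ?_
      · have hlt : LinearMap.ker a < ⊤ := by
          rw [lt_top_iff_ne_top]
          intro h
          have : d' ∈ LinearMap.ker a := by rw [h]; trivial
          rw [LinearMap.mem_ker, had] at this
          exact one_ne_zero this
        have := Submodule.finrank_lt_finrank_of_lt hlt
        rwa [finrank_top, hk] at this
      · rw [add_sub_cancel_right]; exact haπ _
    have e2 : FreeAbelianGroup.lift S (PrH (bdT fun i => (l i, π (l i) + c • d'))) =
        FreeAbelianGroup.lift (Nc c) (bdT l) := by
      rw [bdT, bdT, map_sum, map_sum, map_sum]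
      refine Finset.sum_congr rfl fun i _ => ?_
      rw [map_zsmul, map_zsmul, map_zsmul, PrH_of, lift_apply_of]
    have e1' : S (Prod.snd ∘ fun i => (l i, π (l i) + c • d')) = 0 := e1
    rw [e2] at e
    have e3 : S (Prod.fst ∘ fun i => (l i, π (l i) + c • d')) = S l := rfl
    change S (Prod.snd ∘ fun i => (l i, π (l i) + c • d')) -
      S (Prod.fst ∘ fun i => (l i, π (l i) + c • d')) - _ = 0 at e
    rw [e1', e3, zero_sub, sub_eq_zero] at e
    exact e.symm
  have hNtr : ∀ (c : F) (l' : Fin (k + 1) → L) (y : L),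
      Nc c (fun i => l' i + y) = Nc (c - a y) l' := by
    intro c l' y
    have := lift_tmap_inv S (fun x => x + y) (fun l => htr l y)
      (Pr (k + 1) fun i => (l' i, π (l' i) + (c - a y) • d'))
    rw [tmap_Pr] at this
    refine Eq.trans ?_ this
    show FreeAbelianGroup.lift S _ = _
    congr 2
    funext i
    refine Prod.ext rfl ?_
    show π (l' i + y) + c • d' = π (l' i) + (c - a y) • d' + y
    rw [map_add, hπ y, sub_smul]
    abel
  have hNs : ∀ (P : Submodule F L) (s : L →ₗ[F] L), d' ∈ P → (∀ x ∈ P, s x = u • x) →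
      (∀ x ∈ H.perp P, s x = x) → (∀ x, π (s x) = s (π x)) → ∀ l', Nc 0 (s ∘ l') = Nc 0 l' := by
    intro P s h1 h2 h3 hc l'
    have := lift_tmap_inv S s (hinv P s h1 h2 h3)
      (Pr (k + 1) fun i => (l' i, π (l' i) + (0 : F) • d'))
    rw [tmap_Pr] at this
    refine Eq.trans ?_ this
    show FreeAbelianGroup.lift S _ = _
    congr 2
    funext i
    refine Prod.ext rfl ?_
    show π (s (l' i)) + (0 : F) • d' = s (π (l' i) + (0 : F) • d')
    rw [zero_smul, add_zero, add_zero, hc]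
  have hNfix : ∀ c l', (∀ i, π (l' i) + c • d' = l' i) → Nc c l' = 0 := by
    intro c l' hl
    refine Pr_zero S _ fun l hl2 => hdep l (l' 0) _ (Nat.lt_succ_of_le (span_diff_lt l')) fun r => ?_
    obtain ⟨j, hj | hj⟩ := hl2 r
    · rw [hj]; exact mem_span_diff l' j
    · rw [hj]
      show π (l' j) + c • d' - l' 0 ∈ _
      rw [hl]; exact mem_span_diff l' j
  -- dependence only on the projection
  have hM : ∀ c l', Nc 0 l' - Nc c l' = Nc 0 (fun i => π (l' i) + c • d') := by
    intro c l'
    let M : (Fin (k + 1) → L) → E := fun l => Nc 0 l - Nc c l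
    have hMl : ∀ x, FreeAbelianGroup.lift M x =
        FreeAbelianGroup.lift (Nc 0) x - FreeAbelianGroup.lift (Nc c) x := by
      intro x
      have : FreeAbelianGroup.lift M =
          FreeAbelianGroup.lift (Nc 0) - FreeAbelianGroup.lift (Nc c) := by
        apply FreeAbelianGroup.lift_ext
        intro l; rw [AddMonoidHom.sub_apply, lift_apply_of, lift_apply_of, lift_apply_of]
      rw [this]; rfl
    have hMc : Coc M := fun l => by rw [hMl, hNS, hNS, sub_self]
    have e := prism_eq M hMc (fun i => (l' i, π (l' i) + c • d')) ?_
    · change Nc 0 (fun i => π (l' i) + c • d') - Nc c (fun i => π (l' i) + c • d') =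
        Nc 0 l' - Nc c l' at e
      rw [← e, hNfix c, sub_zero]
      intro i
      rw [map_add, hπd, add_zero, hππ _ (haπ _)]
    · intro i l hl
      rcases k with _ | k
      · obtain ⟨j, -⟩ := hl 0
        exact j.elim0
      let w : Fin (k + 1) → L := fun j => l' (i.succAbove j)
      have hU : Module.finrank F (F ∙ d' ⊔ Submodule.span F (Set.range fun j : Fin k =>
          w j.succ - w 0) : Submodule F L) < k + 1 + 1 := by
        have h1 := Submodule.finrank_add_le_finrank_add_finrank (F ∙ d') (Submodule.span F (Set.range fun j : Fin k =>
          w j.succ - w 0))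
        have h2 := span_diff_lt (F := F) w
        have h3 : Module.finrank F (F ∙ d') ≤ 1 := (finrank_span_singleton hd).le
        omega
      have hdU : d' ∈ (F ∙ d' ⊔ Submodule.span F (Set.range fun j : Fin k =>
          w j.succ - w 0) : Submodule F L) :=
        Submodule.mem_sup_left (Submodule.mem_span_singleton_self d')
      have hlU : ∀ r, l r - w 0 ∈ (F ∙ d' ⊔ Submodule.span F (Set.range fun j : Fin k =>
          w j.succ - w 0) : Submodule F L) := by
        intro r
        obtain ⟨j, hj | hj⟩ := hl r
        · rw [hj]; exact Submodule.mem_sup_right (mem_span_diff w j)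
        · rw [hj]
          show π (w j) + c • d' - w 0 ∈ _
          have : π (w j) + c • d' - w 0 = (c - a (w j)) • d' + (w j - w 0) := by
            rw [hπ, sub_smul]; abel
          rw [this]
          exact add_mem (Submodule.smul_mem _ _ hdU)
            (Submodule.mem_sup_right (mem_span_diff w j))
      show Nc 0 l - Nc c l = 0
      rw [hNdep 0 l _ _ hU hdU hlU, hNdep c l _ _ hU hdU hlU, sub_zero]
  -- constants
  have hb : ∀ (c : F) (y : Fin (k + 1) → L), (∀ i, a (y i) = 0) → Nc 0 (fun i => y i + c • d') = 0 := by
    intro c y hy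
    have hadd : ∀ c c' : F, Nc 0 (fun i => y i + (c + c') • d') =
        Nc 0 (fun i => y i + c • d') + Nc 0 (fun i => y i + c' • d') := by
      intro c c'
      have e := hM c' (fun i => y i + (c + c') • d')
      have e1 : (fun i => y i + (c + c') • d') = fun i => (y i + c • d') + c' • d' := by
        funext i; rw [add_smul]; abel
      have e2 : Nc c' (fun i => y i + (c + c') • d') = Nc 0 (fun i => y i + c • d') := by
        rw [e1, hNtr, map_smul, had, smul_eq_mul, mul_one, sub_self]
      have e3 : (fun i => π (y i + (c + c') • d') + c' • d') = fun i => y i + c' • d' := by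
        funext i
        rw [map_add, hπd, add_zero, hππ _ (hy i)]
      rw [e2, e3, sub_eq_iff_eq_add] at e
      exact e.trans (add_comm _ _)
    let s : L →ₗ[F] L := LinearMap.id + ((u - 1) • a).smulRight d'
    have hs : ∀ x, s x = x + ((u - 1) * a x) • d' := fun x => rfl
    have hui : ∀ c : F, Nc 0 (fun i => y i + (u * c) • d') = Nc 0 (fun i => y i + c • d') := by
      intro c
      rw [← hNs (F ∙ d') s (Submodule.mem_span_singleton_self d') ?_ ?_ ?_
        (fun i => y i + c • d')]
      · congr 1
        funext i
        show _ = s _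
        rw [hs, map_add, hy, map_smul, had, smul_eq_mul, mul_one, zero_add, add_assoc, ← add_smul]
        congr 2; ring
      · intro x hx
        obtain ⟨t, rfl⟩ := Submodule.mem_span_singleton.1 hx
        rw [hs, map_smul, had, smul_eq_mul, mul_one, ← add_smul, smul_smul]
        congr 1; ring
      · intro x hx
        rw [H.mem_perp_span_singleton] at hx
        rw [hs, ha_apply, hx, mul_zero, mul_zero, zero_smul, add_zero]
      · intro x
        rw [hs, hs, map_add, hπd, haπ, mul_zero, zero_smul]
    have := hadd ((u - 1) * (c / (u - 1))) (c / (u - 1))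
    have h1 : u - 1 ≠ 0 := sub_ne_zero.2 hu
    rw [← add_one_mul, sub_add_cancel, hui, mul_div_cancel₀ _ h1] at this
    exact (left_eq_add.1 ((add_comm _ _).trans this.symm).symm)
  have hN1 : ∀ l' (c : F), Nc c l' = Nc 0 l' := by
    intro l' c
    have := hM c l'
    rw [hb c (fun i => π (l' i)) (fun i => haπ _), sub_eq_zero] at this
    exact this.symm
  have hN2 : ∀ l' (y : L), Nc 0 (fun i => l' i + y) = Nc 0 l' := by
    intro l' y; rw [hNtr, hN1]
  -- sections over the complement
  let K : Submodule F L := LinearMap.ker a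
  have hKfin : Module.finrank F K = k := by
    have h1 := LinearMap.finrank_range_add_finrank_ker a
    have h2 : Module.finrank F (LinearMap.range a) = 1 := by
      rw [LinearMap.range_eq_top.2, finrank_top, Module.finrank_self]
      intro c
      exact ⟨c • d', by rw [map_smul, had, smul_eq_mul, mul_one]⟩
    show Module.finrank F (LinearMap.ker a) = k
    omega
  have hKd : ∀ x : K, ω d' x = 0 := by
    intro x
    have : a x = 0 := x.2
    rw [ha_apply] at this
    exact (mul_eq_zero.1 this).resolve_left (inv_ne_zero hdd)
  have hK : ∀ (lam : K →ₗ[F] F) (y : Fin (k + 1) → K),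
      Nc 0 (fun i => (y i : L) + lam (y i) • d') = 0 := by
    intro lam
    by_cases hlam : lam = 0
    · intro y
      subst hlam
      refine hNfix 0 _ fun i => ?_
      rw [LinearMap.zero_apply, zero_smul, add_zero, add_zero]
      exact hππ _ (y i).2
    have HK : Herm σ (fun x y : K => ω x y) := H.restrict K (fun x hx hxp => han x (hxp x hx))
    rcases k with _ | k
    · exfalso
      apply hlam
      have := Module.finrank_zero_iff.1 hKfin
      ext x
      rw [Subsingleton.elim x 0, map_zero, map_zero]
    obtain ⟨d'', hd''⟩ := HK.exists_rep lam
    have hd0 : d'' ≠ 0 := by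
      rintro rfl
      apply hlam
      ext x
      rw [← hd'' x]
      exact H.zero_l _
    refine ih k (Nat.lt_succ_self k) K _ HK (fun x hx => Subtype.ext (han x hx)) hKfin d'' hd0
      (fun y => Nc 0 (fun i => (y i : L) + lam (y i) • d')) ?_ ?_ ?_ ?_
    · intro y
      have e := hNS 0 (fun i => (y i : L) + lam (y i) • d')
      have e1 : S (fun i => (y i : L) + lam (y i) • d') = 0 := by
        let G : K →ₗ[F] L := K.subtype + lam.smulRight d'
        refine hdep _ 0 (LinearMap.range G) ?_ ?_
        · have := LinearMap.finrank_range_le G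
          omega
        · intro i
          rw [sub_zero]
          exact ⟨y i, rfl⟩
      rw [e1, neg_zero] at e
      refine Eq.trans ?_ e
      rw [bdT, bdT, map_sum, map_sum]
      refine Finset.sum_congr rfl fun i _ => ?_
      rw [map_zsmul, map_zsmul, lift_apply_of, lift_apply_of]
    · intro y x0 U hU hy
      refine hNdep 0 _ (x0 : L) (F ∙ d' ⊔ U.map K.subtype) ?_
        (Submodule.mem_sup_left (Submodule.mem_span_singleton_self d')) fun i => ?_
      · have h1 := Submodule.finrank_add_le_finrank_add_finrank (F ∙ d') (U.map K.subtype)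
        have h2 := Submodule.finrank_map_le K.subtype U
        have h3 : Module.finrank F (F ∙ d') ≤ 1 := (finrank_span_singleton hd).le
        omega
      · have : (y i : L) + lam (y i) • d' - x0 = lam (y i) • d' + ((y i - x0 : K) : L) := by
          rw [Submodule.coe_sub]; abel
        rw [this]
        exact Submodule.add_mem_sup (Submodule.smul_mem _ _ (Submodule.mem_span_singleton_self d'))
          ⟨_, hy i, rfl⟩
    · intro y c
      rw [← hN2 (fun i => (y i : L) + lam (y i) • d') ((c : L) + lam c • d')]
      congr 1
      funext i
      show ((y i : L) + (c : L)) + lam (y i + c) • d' =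
        (y i : L) + lam (y i) • d' + ((c : L) + lam c • d')
      rw [map_add, add_smul]
      abel
    · intro P s hP hs1 hs2 y
      have hdec : ∀ x : K, ∃ p ∈ P, x - p ∈ HK.perp P := by
        intro x
        have HP := HK.restrict P (fun x hx hxp => Subtype.ext (han x (hxp x hx)))
        obtain ⟨p, hp⟩ := HP.exists_rep ((HK.L x) ∘ₗ P.subtype)
        refine ⟨p, p.2, (HK.mem_perp').2 fun z hz => ?_⟩
        have := hp ⟨z, hz⟩
        show ω ((x : L) - (p : K)) z = 0
        rw [H.sub_l, sub_eq_zero]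
        exact this.symm
      have hlams : ∀ x : K, lam (s x) = u * lam x := by
        intro x
        obtain ⟨p, hp, hq⟩ := hdec x
        have hq0 : lam (x - p) = 0 := by
          rw [← hd'']; exact hq d'' hP
        have hx : x = p + (x - p) := by abel
        rw [hx, map_add, map_add, hs1 p hp, hs2 _ hq, map_smul, map_add, hq0, smul_eq_mul]
        ring
      let πK : L →ₗ[F] K := π.codRestrict K haπ
      let s' : L →ₗ[F] L := K.subtype ∘ₗ s ∘ₗ πK + (u • a).smulRight d'
      have hs' : ∀ x, s' x = (s (πK x) : L) + (u * a x) • d' := fun x => rfl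
      have hπK : ∀ x : K, πK x = x := fun x => Subtype.ext (hππ _ x.2)
      have hπKd : ∀ c : F, πK (c • d') = 0 := fun c => Subtype.ext (hπd c)
      have ha0 : ∀ x : K, a x = 0 := fun x => x.2
      rw [← hNs (F ∙ d' ⊔ P.map K.subtype) s'
        (Submodule.mem_sup_left (Submodule.mem_span_singleton_self d')) ?_ ?_ ?_
        (fun i => (y i : L) + lam (y i) • d')]
      · congr 1
        funext i
        show (s (y i) : L) + lam (s (y i)) • d' = s' _
        rw [hs', map_add, hπK, hπKd, add_zero, hlams, map_add, ha0, map_smul, had, smul_eq_mul,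
          mul_one, zero_add]
      · intro x hx
        obtain ⟨x1, hx1, x2, hx2, rfl⟩ := Submodule.mem_sup.1 hx
        obtain ⟨t, rfl⟩ := Submodule.mem_span_singleton.1 hx1
        obtain ⟨p, hp, rfl⟩ := hx2
        show s' (t • d' + (p : L)) = u • (t • d' + (p : L))
        rw [hs', map_add, hπK, hπKd, zero_add, map_add, ha0, map_smul, had, smul_eq_mul,
          mul_one, add_zero, hs1 p hp, smul_add, smul_smul, Submodule.coe_smul, add_comm]
      · intro x hx
        rw [H.mem_perp_sup, H.mem_perp_span_singleton] at hx
        have hx0 : a x = 0 := by rw [ha_apply, hx.1, mul_zero]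
        have e : πK x = ⟨x, hx0⟩ := Subtype.ext (hππ x hx0)
        rw [hs', hx0, e, hs2, mul_zero, zero_smul, add_zero]
        intro z hz
        exact hx.2 z ⟨z, hz, rfl⟩
      · intro x
        have e : πK (π x) = πK x := Subtype.ext (hππ _ (haπ x))
        rw [hs', hs', map_add, hπd, add_zero, haπ, mul_zero, zero_smul, add_zero, e]
        exact hππ _ (s (πK x)).2
  have hN : ∀ l', Nc 0 l' = 0 := by
    intro l'
    let πK : L →ₗ[F] K := π.codRestrict K haπ
    let v : Fin k → K := fun i => πK (l' i.succ - l' 0)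
    have hl0 := hN2 l' (-l' 0)
    rw [← hl0]
    by_cases hv : LinearIndependent F v
    · let b : Module.Basis (Fin k) F K :=
        basisOfLinearIndependentOfCardEqFinrank' v hv (by simp [hKfin])
      have hbv : ∀ i, b i = v i := fun i => by
        simp [b, coe_basisOfLinearIndependentOfCardEqFinrank']
      let lam : K →ₗ[F] F := b.constr F (fun i => a (l' i.succ - l' 0))
      have hlam : ∀ i, lam (v i) = a (l' i.succ - l' 0) := fun i => by
        rw [← hbv]; exact b.constr_basis F _ i
      rw [← hK lam (Fin.cons 0 v)]
      congr 1
      funext i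
      refine Fin.cases ?_ (fun i => ?_) i
      · simp
      · rw [Fin.cons_succ, hlam]
        show l' i.succ + -l' 0 = π (l' i.succ - l' 0) + a (l' i.succ - l' 0) • d'
        rw [hπ]; abel
    · refine hNdep 0 _ 0 (F ∙ d' ⊔ (Submodule.span F (Set.range v)).map K.subtype) ?_
        (Submodule.mem_sup_left (Submodule.mem_span_singleton_self d')) fun i => ?_
      · have h1 := Submodule.finrank_add_le_finrank_add_finrank (F ∙ d')
          ((Submodule.span F (Set.range v)).map K.subtype)
        have h2 := Submodule.finrank_map_le K.subtype (Submodule.span F (Set.range v))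
        have h3 : Module.finrank F (F ∙ d') ≤ 1 := (finrank_span_singleton hd).le
        have h4 : Module.finrank F (Submodule.span F (Set.range v)) < k := by
          rw [linearIndependent_iff_card_le_finrank_span] at hv
          simpa [Set.finrank] using hv
        omega
      · rw [sub_zero]
        refine Fin.cases ?_ (fun i => ?_) i
        · simp
        · have : l' i.succ + -l' 0 = a (l' i.succ - l' 0) • d' + π (l' i.succ - l' 0) := by
            rw [hπ]; abel
          rw [this]
          exact Submodule.add_mem_sup (Submodule.smul_mem _ _ (Submodule.mem_span_singleton_self d'))
            ⟨v i, Submodule.subset_span ⟨i, rfl⟩, rfl⟩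
  intro l
  have := hNS 0 l
  rw [show Nc 0 = fun _ => 0 from funext hN] at this
  have e : FreeAbelianGroup.lift (fun _ : Fin (k + 1) → L => (0 : E)) (bdT l) = 0 := by
    rw [bdT, map_sum]
    refine Finset.sum_eq_zero fun i _ => ?_
    rw [map_zsmul, lift_apply_of, smul_zero]
  rw [e] at this
  exact (neg_eq_zero.1 this.symm)

end aniso

end HS

set_option linter.unusedVariables false
set_option linter.unusedSimpArgs false

namespace HS
open FreeAbelianGroup

section std
variable {F : Type} [Field F] {σ : F →+* F}

abbrev SF (σ : F →+* F) (n : ℕ) : (Fin n → F × F) → (Fin n → F × F) → F :=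
  pairForm F (hermPair F σ) n

lemma SF_herm (hinv : ∀ x, σ (σ x) = x) (hne : ∃ a, σ a ≠ a) (n : ℕ) : Herm σ (SF σ n) where
  add_r x y z := by
    simp only [pairForm, hermPair, Pi.add_apply, Prod.fst_add, Prod.snd_add, ← Finset.sum_add_distrib]
    exact Finset.sum_congr rfl fun i _ => by ring
  smul_r x c y := by
    simp only [pairForm, hermPair, Pi.smul_apply, Prod.smul_fst, Prod.smul_snd, smul_eq_mul,
      Finset.mul_sum]
    exact Finset.sum_congr rfl fun i _ => by ring
  symm x y := by
    simp only [pairForm, hermPair, map_sum, map_add, map_mul, hinv]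
    exact Finset.sum_congr rfl fun i _ => by ring
  nondeg x h := by
    funext i
    have h1 := h (Pi.single i (1, 0))
    have h2 := h (Pi.single i (0, 1))
    simp only [pairForm, hermPair] at h1 h2
    rw [Finset.sum_eq_single i (fun j _ hj => by simp [Pi.single_eq_of_ne hj]) (by simp)] at h1 h2
    simp at h1 h2
    exact Prod.ext h2 h1
  inv := hinv
  ne := hne

lemma SF_single_single {n : ℕ} (i : Fin n) (a b : F × F) :
    SF σ n (Pi.single i a) (Pi.single i b) = σ a.1 * b.2 + σ a.2 * b.1 := by
  simp only [SF, pairForm, hermPair]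
  rw [Finset.sum_eq_single i (fun j _ hj => by simp [Pi.single_eq_of_ne hj]) (by simp)]
  simp

lemma SF_single_ne {n : ℕ} {i j : Fin n} (h : i ≠ j) (a b : F × F) :
    SF σ n (Pi.single i a) (Pi.single j b) = 0 := by
  simp only [SF, pairForm, hermPair]
  refine Finset.sum_eq_zero fun r _ => ?_
  by_cases hr : r = i
  · subst hr
    simp [Pi.single_eq_of_ne h]
  · simp [Pi.single_eq_of_ne hr]

end std

section swap
variable {F : Type} [Field F] {σ : F →+* F} {V : Type} [AddCommGroup V] [Module F V]
variable {ω : V → V → F}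

/-- the standard pair number `i` -/
def stdP (σ : F →+* F) {n : ℕ} (i : Fin n) : HPr (SF σ n) where
  e := Pi.single i (1, 0)
  f := Pi.single i (0, 1)
  ee := by rw [SF_single_single]; simp
  ff := by rw [SF_single_single]; simp
  ef := by rw [SF_single_single]; simp

/-- a pair orthogonal to a given vector of the four dimensional space -/
lemma exists_orth_pair (H4 : Herm σ (SF σ 2)) (w : Fin 2 → F × F) :
    ∃ Q : HPr (SF σ 2), SF σ 2 w Q.e = 0 ∧ SF σ 2 w Q.f = 0 := by
  by_cases hw : w = 0
  · subst hw
    exact ⟨stdP σ 0, H4.zero_l _, H4.zero_l _⟩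
  obtain ⟨κ, hκ0, hκ⟩ := H4.exists_kappa (SF σ 2 w w) (H4.symm w w).symm
  obtain ⟨l, hl, hl'⟩ := H4.witt 1 (fun _ => Pi.single 0 (1, κ)) (fun _ => w) (by
      rw [linearIndependent_unique_iff]
      intro h
      have := congrArg Prod.fst (congrFun h 0)
      simp at this) (by
      rw [linearIndependent_unique_iff]; exact hw) (by
      intro i j
      rw [SF_single_single, ← hκ]; simp)
  obtain ⟨g, hg⟩ := H4.exists_rchainG l hl
  have hgw : g • (Pi.single 0 (1, κ) : Fin 2 → F × F) = w := by rw [hg]; exact hl' 0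
  refine ⟨g • stdP σ 1, ?_, ?_⟩
  · rw [← hgw]
    exact (Herm.isom g _ _).trans (SF_single_ne (by decide) _ _)
  · rw [← hgw]
    exact (Herm.isom g _ _).trans (SF_single_ne (by decide) _ _)

variable {Δ W : Submodule F V}

def iota (v v' : V) (hv : v ∈ W) (hv' : v' ∈ W) (T : TP ω W) (x : Fin 2 → F × F) : V :=
  (x 0).1 • T.t.φ ⟨v, hv⟩ + (x 0).2 • T.t.φ ⟨v', hv'⟩ + (x 1).1 • T.E.e + (x 1).2 • T.E.f

structure SwapD (H : Herm σ ω) (Δ W : Submodule F V) (v v' : V) : Prop where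
  hW : Δ ≤ W
  hv : v ∈ W
  hv' : v' ∈ W
  vp : v ∈ H.perp Δ
  vp' : v' ∈ H.perp Δ
  vv : ω v v = 0
  vv' : ω v' v' = 0
  e : ω v v' = 1

variable {H : Herm σ ω} {v v' : V}

lemma TS_isom (a : TS ω W) (x y : W) : ω (a.φ x) (a.φ y) = ω x y := by
  obtain ⟨g, hg⟩ := a.ex
  rw [hg, hg, Herm.isom g]

lemma iota_isom (D : SwapD H Δ W v v') (T : TP ω W) (x y : Fin 2 → F × F) :
    ω (iota v v' D.hv D.hv' T x) (iota v v' D.hv D.hv' T y) = SF σ 2 x y := by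
  have e1 : ω (T.t.φ ⟨v, D.hv⟩) (T.t.φ ⟨v, D.hv⟩) = 0 := by rw [TS_isom (ω := ω)]; exact D.vv
  have e2 : ω (T.t.φ ⟨v', D.hv'⟩) (T.t.φ ⟨v', D.hv'⟩) = 0 := by rw [TS_isom (ω := ω)]; exact D.vv'
  have e3 : ω (T.t.φ ⟨v, D.hv⟩) (T.t.φ ⟨v', D.hv'⟩) = 1 := by rw [TS_isom (ω := ω)]; exact D.e
  have e4 : ω (T.t.φ ⟨v', D.hv'⟩) (T.t.φ ⟨v, D.hv⟩) = 1 := by rw [H.symm, e3, map_one]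
  have e5 : ω T.E.f T.E.e = 1 := by rw [H.symm, T.E.ef, map_one]
  have e6 : ∀ x, ω T.E.e (T.t.φ x) = 0 := fun x => H.eq_zero_symm (T.he x)
  have e7 : ∀ x, ω T.E.f (T.t.φ x) = 0 := fun x => H.eq_zero_symm (T.hf x)
  simp only [iota, H.add_l, H.add_r, H.smul_l, H.smul_r, e1, e2, e3, e4, e5, e6, e7, T.he, T.hf,
    T.E.ee, T.E.ff, T.E.ef, SF, pairForm, hermPair, Fin.sum_univ_two]
  ring

lemma iota_perp (D : SwapD H Δ W v v') (T : TP ω W) (x : W) (hx : (x : V) ∈ Δ)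
    (y : Fin 2 → F × F) : ω (T.t.φ x) (iota v v' D.hv D.hv' T y) = 0 := by
  have e1 : ω (T.t.φ x) (T.t.φ ⟨v, D.hv⟩) = 0 := by rw [TS_isom (ω := ω)]; exact D.vp x hx
  have e2 : ω (T.t.φ x) (T.t.φ ⟨v', D.hv'⟩) = 0 := by rw [TS_isom (ω := ω)]; exact D.vp' x hx
  simp only [iota, H.add_r, H.smul_r, e1, e2, T.he, T.hf]
  ring

lemma iota_smul (hv : v ∈ W) (hv' : v' ∈ W) (g : bilinIsoms F ω) (T : TP ω W)
    (x : Fin 2 → F × F) : iota v v' hv hv' (g • T) x = g • iota v v' hv hv' T x := by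
  simp only [iota, Herm.smul_add' g, Herm.smul_smul' g]
  rfl

lemma iota_rfn (D : SwapD H Δ W v v') (T : TP ω W) (w : Fin 2 → F × F) (c : F)
    (x : Fin 2 → F × F) : iota v v' D.hv D.hv' T (rfn (SF σ 2) w c x) =
      rfn ω (iota v v' D.hv D.hv' T w) c (iota v v' D.hv D.hv' T x) := by
  rw [rfn, rfn, iota_isom D T]
  simp only [iota, Pi.add_apply, Pi.smul_apply, Prod.fst_add, Prod.snd_add, Prod.smul_fst,
    Prod.smul_snd, smul_eq_mul, add_smul, smul_add, smul_smul]
  abel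

/-- replace the pair of `T` by the pair with coordinates `P` -/
def pP (D : SwapD H Δ W v v') (P : HPr (SF σ 2)) (T : TP ω W) : TP ω Δ where
  t := (res1 ω D.hW).s T.t
  E := ⟨iota v v' D.hv D.hv' T P.e, iota v v' D.hv D.hv' T P.f,
    (iota_isom D T _ _).trans P.ee, (iota_isom D T _ _).trans P.ff, (iota_isom D T _ _).trans P.ef⟩
  he x := iota_perp D T ⟨x, D.hW x.2⟩ x.2 _
  hf x := iota_perp D T ⟨x, D.hW x.2⟩ x.2 _

lemma pP_smul (D : SwapD H Δ W v v') (P : HPr (SF σ 2)) (g : bilinIsoms F ω) (T : TP ω W) :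
    pP D P (g • T) = g • pP D P T :=
  TP.ext' rfl (HPr.ext (iota_smul _ _ g T _) (iota_smul _ _ g T _))

/-- reflect a pair -/
def rP (H4 : Herm σ (SF σ 2)) (w : (Fin 2 → F × F) × F) (h : rgood σ (SF σ 2) w)
    (P : HPr (SF σ 2)) : HPr (SF σ 2) := H4.rG w.1 w.2 h • P

lemma swap_step (D : SwapD H Δ W v v') (H4 : Herm σ (SF σ 2)) (w : (Fin 2 → F × F) × F)
    (h : rgood σ (SF σ 2) w) (P : HPr (SF σ 2)) {n : ℕ} (y : Ch (bilinIsoms F ω) (TP ω W) n)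
    (hy : Ch.dd n y = 0) :
    ∃ z : Rel (TT ω Δ) (n + 2), Rel.d z =
      ((0 : Ch _ _ (n + 1)), Ch.map (pP D (rP H4 w h P)) (pP_smul D _) y - Ch.map (pP D P) (pP_smul D _) y) := by
  obtain ⟨Q, hQe, hQf⟩ := exists_orth_pair H4 w.1
  have hgood : ∀ T : TP ω W, rgood σ ω (iota v v' D.hv D.hv' T w.1, w.2) := by
    intro T
    show w.2 + σ w.2 + w.2 * σ w.2 * ω _ _ = 0
    rw [iota_isom D T]
    exact h
  let γ : TP ω W → bilinIsoms F ω := fun T => H.rG (iota v v' D.hv D.hv' T w.1) w.2 (hgood T)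
  have hγ : ∀ (g : bilinIsoms F ω) (T : TP ω W), γ (g • T) = g * γ T * g⁻¹ := by
    intro g T
    have e := iota_smul D.hv D.hv' g T w.1
    have := H.rG_conj g (iota v v' D.hv D.hv' T w.1) w.2 (hgood T) (by rw [← e]; exact hgood _)
    rw [← this]
    show H.rG (iota v v' D.hv D.hv' (g • T) w.1) w.2 _ = _
    congr 1
  have hκ : ∀ (g : bilinIsoms F ω) (T : TP ω W), γ (g • T) • (g • T) = g • (γ T • T) := by
    intro g T
    rw [hγ, mul_smul, mul_smul, inv_smul_smul]
  have hfixΔ : ∀ T : TP ω W, γ T • (res1 ω D.hW).s T.t = (res1 ω D.hW).s T.t := by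
    intro T
    apply TS.ext'
    intro x
    show γ T • T.t.φ ⟨x, D.hW x.2⟩ = T.t.φ ⟨x, D.hW x.2⟩
    rw [Herm.rG_smul, H.eq_zero_symm (iota_perp D T ⟨x, D.hW x.2⟩ x.2 _)]
    simp
  have hP : ∀ T, pP D P (γ T • T) = pP D (rP H4 w h P) T := by
    intro T
    rw [pP_smul]
    refine TP.ext' (hfixΔ T) (HPr.ext ?_ ?_)
    · show γ T • iota v v' D.hv D.hv' T P.e = iota v v' D.hv D.hv' T (H4.rG w.1 w.2 h • P.e)
      exact (iota_rfn D T w.1 w.2 P.e).symm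
    · show γ T • iota v v' D.hv D.hv' T P.f = iota v v' D.hv D.hv' T (H4.rG w.1 w.2 h • P.f)
      exact (iota_rfn D T w.1 w.2 P.f).symm
  have hQ : ∀ T, pP D Q (γ T • T) = pP D Q T := by
    intro T
    rw [pP_smul]
    refine TP.ext' (hfixΔ T) (HPr.ext ?_ ?_)
    · show γ T • iota v v' D.hv D.hv' T Q.e = iota v v' D.hv D.hv' T Q.e
      rw [Herm.rG_smul, iota_isom D T, hQe]; simp
    · show γ T • iota v v' D.hv D.hv' T Q.f = iota v v' D.hv D.hv' T Q.f
      rw [Herm.rG_smul, iota_isom D T, hQf]; simp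
  let b : Ch (bilinIsoms F ω) (TP ω W) (n + 1) :=
    Ch.pri (fun x t => (γ t)⁻¹ * x) (fun g x t => by rw [hγ]; group) y
  have hb : Ch.d b = Ch.map (fun T => γ T • T) hκ y - y := by
    rw [Ch.d_pri_of_cycle _ _ y hy, Ch.vert_conj γ hγ (fun T => γ T • T) hκ (fun _ => rfl)]
  refine ⟨((0 : Ch _ _ (n + 2)), -(Ch.map (pP D P) (pP_smul D _) b - Ch.map (pP D Q) (pP_smul D _) b)), ?_⟩
  apply Rel.ext
  · show Ch.d (0 : Ch (bilinIsoms F ω) (TS ω Δ) (n + 2)) + Ch.map (fun T : TP ω Δ => T.t) (fun _ _ => rfl)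
      (-(Ch.map (pP D P) (pP_smul D _) b - Ch.map (pP D Q) (pP_smul D _) b)) = 0
    rw [map_zero, zero_add, map_neg, map_sub, Ch.map_map, Ch.map_map, neg_eq_zero, sub_eq_zero]
    rfl
  · show - Ch.d (-(Ch.map (pP D P) (pP_smul D _) b - Ch.map (pP D Q) (pP_smul D _) b)) = _
    rw [map_neg, neg_neg, map_sub, Ch.d_map, Ch.d_map, hb, map_sub, map_sub, Ch.map_map, Ch.map_map]
    simp only [hP, hQ, sub_self, sub_zero]

lemma swap_chain (D : SwapD H Δ W v v') (H4 : Herm σ (SF σ 2)) (l : List ((Fin 2 → F × F) × F))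
    (hl : ∀ p ∈ l, rgood σ (SF σ 2) p) (P P' : HPr (SF σ 2)) (he : rchain (SF σ 2) l P.e = P'.e)
    (hf : rchain (SF σ 2) l P.f = P'.f) {n : ℕ} (y : Ch (bilinIsoms F ω) (TP ω W) n)
    (hy : Ch.dd n y = 0) :
    ∃ z : Rel (TT ω Δ) (n + 2), Rel.d z =
      ((0 : Ch _ _ (n + 1)), Ch.map (pP D P') (pP_smul D _) y - Ch.map (pP D P) (pP_smul D _) y) := by
  induction l generalizing P' with
  | nil =>
    have : P' = P := HPr.ext he.symm hf.symm
    subst this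
    refine ⟨0, ?_⟩
    rw [map_zero, sub_self]; rfl
  | cons p l ih =>
    have hl2 : ∀ q ∈ l, rgood σ (SF σ 2) q := fun q hq => hl q (List.mem_cons_of_mem _ hq)
    obtain ⟨g, hg⟩ := H4.exists_rchainG l hl2
    have hp := hl p List.mem_cons_self
    obtain ⟨z1, hz1⟩ := ih hl2 (g • P) (hg _).symm (hg _).symm
    obtain ⟨z2, hz2⟩ := swap_step D H4 p hp (g • P) y hy
    have : rP H4 p hp (g • P) = P' := by
      apply HPr.ext
      · rw [← he]
        show rfn (SF σ 2) p.1 p.2 (g • P.e) = rfn (SF σ 2) p.1 p.2 (rchain (SF σ 2) l P.e)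
        rw [hg]
      · rw [← hf]
        show rfn (SF σ 2) p.1 p.2 (g • P.f) = rfn (SF σ 2) p.1 p.2 (rchain (SF σ 2) l P.f)
        rw [hg]
    subst this
    refine ⟨z1 + z2, ?_⟩
    rw [map_add, hz1, hz2]
    apply Rel.ext
    · show (0 : Ch (bilinIsoms F ω) (TT ω Δ).S (n + 1)) + 0 = 0
      rw [add_zero]
    · show (_ : Ch (bilinIsoms F ω) (TP ω Δ) n) - _ + (_ - _) = _ - _
      abel

noncomputable abbrev tF (ω : V → V → F) (Δ : Submodule F V) {n : ℕ} :
    Ch (bilinIsoms F ω) (TP ω Δ) n →+ Ch (bilinIsoms F ω) (TS ω Δ) n :=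
  Ch.map (fun T : TP ω Δ => T.t) (fun _ _ => rfl)

def rS (h : Δ ≤ W) (a : TS ω W) : TS ω Δ := (res1 ω h).s a

def rT (h : Δ ≤ W) (a : TP ω W) : TP ω Δ := (res1 ω h).p a

lemma swap_core (D : SwapD H Δ W v v') {n : ℕ} (x : Ch (bilinIsoms F ω) (TS ω W) (n + 1))
    (y : Ch (bilinIsoms F ω) (TP ω W) n) (hx : Ch.d x + tF ω W y = 0) (hy : Ch.dd n y = 0) :
    ∃ (a : Ch (bilinIsoms F ω) (TS ω Δ) (n + 2)) (b : Ch (bilinIsoms F ω) (TP ω Δ) (n + 1)),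
      Ch.d a + tF ω Δ b = Ch.map (rS (ω := ω) D.hW) (fun g s => (res1 ω D.hW).hs g s) x ∧
      - Ch.d b = Ch.map (rT (ω := ω) D.hW) (fun g s => (res1 ω D.hW).hp g s) y := by
  have H4 : Herm σ (SF σ 2) := SF_herm H.inv H.ne 2
  obtain ⟨l, hl, hl'⟩ := H4.witt 2 ![(stdP σ 0).e, (stdP σ 0).f] ![(stdP σ 1).e, (stdP σ 1).f]
    (by
      rw [LinearIndependent.pair_iff]
      intro s t h
      have := congrFun h 0
      simpa [stdP] using this)
    (by
      rw [LinearIndependent.pair_iff]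
      intro s t h
      have := congrFun h 1
      simpa [stdP] using this)
    (by
      intro i j
      fin_cases i <;> fin_cases j <;> simp [stdP, SF_single_single])
  obtain ⟨⟨a1, b1⟩, hz1⟩ := swap_chain D H4 l hl (stdP σ 0) (stdP σ 1) (hl' 0) (hl' 1) y hy
  let j : TS ω W → TP ω Δ := fun a => ⟨rS D.hW a,
    ⟨a.φ ⟨v, D.hv⟩, a.φ ⟨v', D.hv'⟩, by rw [TS_isom (ω := ω)]; exact D.vv, by rw [TS_isom (ω := ω)]; exact D.vv',
      by rw [TS_isom (ω := ω)]; exact D.e⟩, fun x => (TS_isom a ⟨x, D.hW x.2⟩ _).trans (D.vp x x.2),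
      fun x => (TS_isom a ⟨x, D.hW x.2⟩ _).trans (D.vp' x x.2)⟩
  have hj : ∀ (g : bilinIsoms F ω) a, j (g • a) = g • j a := fun g a => rfl
  obtain ⟨a, ha⟩ : ∃ a : Ch (bilinIsoms F ω) (TS ω Δ) (n + 2), a = a1 := ⟨a1, rfl⟩
  obtain ⟨b, hb⟩ : ∃ b : Ch (bilinIsoms F ω) (TP ω Δ) (n + 1), b = b1 := ⟨b1, rfl⟩
  have h1 : Ch.d a + tF ω Δ b = 0 := by subst ha hb; exact congrArg Prod.fst hz1
  have h2 : - Ch.d b = Ch.map (pP D (stdP σ 1)) (pP_smul D _) y - Ch.map (pP D (stdP σ 0)) (pP_smul D _) y := by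
    subst ha hb; exact congrArg Prod.snd hz1
  have hjf : Ch.map (pP D (stdP σ 0)) (pP_smul D _) y = - Ch.map j hj (Ch.d x) := by
    rw [eq_neg_of_add_eq_zero_left hx, map_neg, neg_neg, Ch.map_map]
    congr 2
    funext T
    refine TP.ext' rfl (HPr.ext ?_ ?_)
    · show iota v v' D.hv D.hv' T (stdP σ 0).e = T.t.φ ⟨v, D.hv⟩
      simp [iota, stdP]
    · show iota v v' D.hv D.hv' T (stdP σ 0).f = T.t.φ ⟨v', D.hv'⟩
      simp [iota, stdP]
  have hp1 : Ch.map (pP D (stdP σ 1)) (pP_smul D _) y = Ch.map (rT (ω := ω) D.hW) (fun g s => (res1 ω D.hW).hp g s) y := by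
    congr 2
    funext T
    refine TP.ext' rfl (HPr.ext ?_ ?_)
    · show iota v v' D.hv D.hv' T (stdP σ 1).e = T.E.e
      simp [iota, stdP]
    · show iota v v' D.hv D.hv' T (stdP σ 1).f = T.E.f
      simp [iota, stdP]
  refine ⟨a, b + Ch.map j hj x, ?_, ?_⟩
  · rw [map_add, ← add_assoc, h1, zero_add, tF, Ch.map_map]
  · rw [map_add, neg_add, h2, hjf, hp1, Ch.d_map]
    abel

lemma swap (D : SwapD H Δ W v v') {n : ℕ} (z : Rel (TT ω W) (n + 1)) (hz : Rel.d z = 0) :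
    ∃ w, Rel.d w = Rel.map (res1 ω D.hW) z := by
  obtain ⟨x, y⟩ := z
  obtain ⟨a, b, h1, h2⟩ := swap_core D x y (congrArg Prod.fst hz) (neg_eq_zero.1 (congrArg Prod.snd hz))
  exact ⟨(a, b), Rel.ext h1 h2⟩

end swap

end HS

set_option linter.unusedVariables false
set_option linter.unusedSimpArgs false

namespace HS
open FreeAbelianGroup

section gen
variable {A E : Type} [AddCommGroup E]

lemma coc3 {k : ℕ} {S : (Fin (k + 2) → A) → E} (hS : Coc S) (a b c : A) (rest : Fin k → A)
    (h : ∀ l, (∃ i, l i = a) → (∃ i, l i = b) → (∃ i, l i = c) → S l = 0) :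
    S (Fin.cons b (Fin.cons c rest)) - S (Fin.cons a (Fin.cons c rest)) +
      S (Fin.cons a (Fin.cons b rest)) = 0 := by
  have e := hS (Fin.cons a (Fin.cons b (Fin.cons c rest)))
  rw [bdT, map_sum, Fin.sum_univ_succ, Fin.sum_univ_succ, Fin.sum_univ_succ,
    Finset.sum_eq_zero] at e
  · simp only [map_zsmul, lift_apply_of] at e
    have e1 : (fun j => (Fin.cons a (Fin.cons b (Fin.cons c rest)) : Fin (k + 3) → A)
        ((0 : Fin (k + 3)).succAbove j)) = Fin.cons b (Fin.cons c rest) := by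
      funext j; simp
    have e2 : (fun j => (Fin.cons a (Fin.cons b (Fin.cons c rest)) : Fin (k + 3) → A)
        ((Fin.succ 0 : Fin (k + 3)).succAbove j)) = Fin.cons a (Fin.cons c rest) := by
      funext j
      refine Fin.cases ?_ (fun j => ?_) j <;> simp
    have e3 : (fun j => (Fin.cons a (Fin.cons b (Fin.cons c rest)) : Fin (k + 3) → A)
        ((Fin.succ (Fin.succ 0) : Fin (k + 3)).succAbove j)) = Fin.cons a (Fin.cons b rest) := by
      funext j
      refine Fin.cases ?_ (fun j => ?_) j
      · rfl
      · rw [Fin.succ_succAbove_succ]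
        refine Fin.cases ?_ (fun j => ?_) j <;> simp
    rw [e1, e2, e3] at e
    simp only [Fin.val_zero, Fin.val_succ, pow_succ, pow_zero, one_smul, neg_smul, mul_neg, mul_one, neg_neg, add_zero] at e
    rw [← e]; abel
  · intro j _
    rw [map_zsmul, lift_apply_of, h, smul_zero]
    · obtain ⟨z, hz⟩ := Fin.exists_succAbove_eq (x := (0 : Fin (k + 3))) (y := j.succ.succ.succ)
        (Fin.succ_ne_zero _).symm
      exact ⟨z, by rw [hz]; rfl⟩
    · obtain ⟨z, hz⟩ := Fin.exists_succAbove_eq (x := (Fin.succ 0 : Fin (k + 3))) (y := j.succ.succ.succ)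
        (by simp [Fin.ext_iff])
      exact ⟨z, by rw [hz]; rfl⟩
    · obtain ⟨z, hz⟩ := Fin.exists_succAbove_eq (x := (Fin.succ (Fin.succ 0) : Fin (k + 3)))
        (y := j.succ.succ.succ) (by
          rw [Ne, Fin.succ_inj, Fin.succ_inj]; exact (Fin.succ_ne_zero _).symm)
      exact ⟨z, by rw [hz]; rfl⟩

variable {F : Type} [Field F] {M : Type} [AddCommGroup M] [Module F M]

lemma not_li_three {ι : Type} (v : ι → M) (i1 i2 i3 : ι) (β γ : F) (h : v i1 = β • v i2 + γ • v i3)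
    (h2 : v i1 ≠ v i2) (h3 : v i1 ≠ v i3) : ¬ LinearIndependent F v := by
  intro hv
  refine hv.notMem_span_image (s := {i2, i3}) (x := i1) ?_ ?_
  · rintro (rfl | rfl)
    · exact h2 rfl
    · exact h3 rfl
  · rw [h]
    exact add_mem (Submodule.smul_mem _ _ (Submodule.subset_span ⟨i2, by simp, rfl⟩))
      (Submodule.smul_mem _ _ (Submodule.subset_span ⟨i3, by simp, rfl⟩))

lemma li_functional {ι : Type} (R : Submodule F M) (v : ι → M)
    (h : LinearIndependent F (fun i => R.mkQ (v i))) (c : ι → F) :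
    ∃ f : M →ₗ[F] F, (∀ x ∈ R, f x = 0) ∧ ∀ i, f (v i) = c i := by
  obtain ⟨g, hg⟩ := LinearMap.exists_extend ((Module.Basis.span h).constr F c)
  refine ⟨g ∘ₗ R.mkQ, ?_, ?_⟩
  · intro x hx
    rw [LinearMap.comp_apply, (Submodule.Quotient.mk_eq_zero R).2 hx |> fun h => (show R.mkQ x = 0 from h), map_zero]
  · intro i
    have h1 := LinearMap.congr_fun hg (Module.Basis.span h i)
    rw [Module.Basis.constr_basis] at h1
    rw [← h1, LinearMap.comp_apply, LinearMap.comp_apply, Submodule.subtype_apply,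
      Module.Basis.span_apply]

/-- a linear relation modulo `R` -/
lemma not_li_rel {k : ℕ} (R : Submodule F M) (v : Fin k → M)
    (h : ¬ LinearIndependent F (fun i => R.mkQ (v i))) :
    ∃ c : Fin k → F, (∑ i, c i • v i) ∈ R ∧ ∃ j, c j ≠ 0 := by
  rw [Fintype.not_linearIndependent_iff] at h
  obtain ⟨c, hc, j, hj⟩ := h
  refine ⟨c, ?_, j, hj⟩
  rw [← Submodule.Quotient.mk_eq_zero R, ← hc]
  show R.mkQ _ = _
  simp

lemma exists_compl (P D : Submodule F M) (h : P ≤ D) [FiniteDimensional F M] :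
    ∃ D' : Submodule F M, P ⊔ D' = D ∧ Module.finrank F D' + Module.finrank F P = Module.finrank F D := by
  obtain ⟨Q, hQ⟩ := Submodule.exists_isCompl P
  have e : P ⊔ Q ⊓ D = D := by
    rw [← sup_inf_assoc_of_le Q h, hQ.sup_eq_top, top_inf_eq]
  refine ⟨Q ⊓ D, e, ?_⟩
  have := Submodule.finrank_sup_add_finrank_inf_eq P (Q ⊓ D)
  rw [e, ← inf_assoc, hQ.inf_eq_bot, bot_inf_eq, finrank_bot] at this
  omega

end gen

section herm
variable {F : Type} [Field F] {σ : F →+* F} {V : Type} [AddCommGroup V] [Module F V]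
variable {ω : V → V → F} [FiniteDimensional F V]

/-- isometries which move by vectors of the radical -/
lemma rad_isom (H : Herm σ ω) (Δ' : Submodule F V) (N : V →ₗ[F] V)
    (hN : ∀ x ∈ Δ', N x ∈ H.perp Δ') (hN' : ∀ x ∈ Δ', N x ∈ Δ')
    (h0 : ∀ x ∈ Δ', x + N x = 0 → x = 0) :
    ∃ g : bilinIsoms F ω, ∀ x ∈ Δ', g • x = x + N x := by
  obtain ⟨g, hg⟩ := H.witt_ext Δ' ((LinearMap.id + N) ∘ₗ Δ'.subtype) (by
    rw [← LinearMap.ker_eq_bot, LinearMap.ker_eq_bot']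
    intro x hx
    exact Subtype.ext (h0 x x.2 hx)) (by
    intro x y
    show ω ((x : V) + N x) ((y : V) + N y) = ω x y
    rw [H.add_r, H.add_l, H.add_l, hN y y.2 x x.2, hN y y.2 _ (hN' x x.2),
      H.eq_zero_symm (hN x x.2 y y.2)]
    ring)
  exact ⟨g, fun x hx => hg ⟨x, hx⟩⟩

lemma decomp (H : Herm σ ω) (P : Submodule F V) (hP : ∀ x ∈ P, x ∈ H.perp P → x = 0) (x : V) :
    ∃ p ∈ P, x - p ∈ H.perp P := by
  have HP := H.restrict P hP
  obtain ⟨u, hu⟩ := HP.exists_rep (H.L x ∘ₗ P.subtype)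
  refine ⟨u, u.2, ?_⟩
  rw [H.mem_perp']
  intro y hy
  have := hu ⟨y, hy⟩
  rw [H.sub_l]
  exact sub_eq_zero.2 this.symm

/-- every linear isometry belongs to the group -/
lemma isom_lift (H : Herm σ ω) (T : V →ₗ[F] V) (hT : ∀ x y, ω (T x) (T y) = ω x y) :
    ∃ g : bilinIsoms F ω, ∀ x, g • x = T x := by
  obtain ⟨g, hg⟩ := H.witt_ext ⊤ (T ∘ₗ (⊤ : Submodule F V).subtype) (by
    rw [← LinearMap.ker_eq_bot, LinearMap.ker_eq_bot']
    intro x hx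
    refine Subtype.ext (H.nondeg x fun y => ?_)
    rw [← hT]
    have : T x = 0 := hx
    rw [this, H.zero_r]) (fun x y => hT x y)
  exact ⟨g, fun x => hg ⟨x, trivial⟩⟩

/-- a complementary isotropic vector -/
lemma exists_f (H : Herm σ ω) {Δ : Submodule F V} {e : V} (he : e ∈ H.perp Δ) (hee : ω e e = 0)
    (h : e ∉ Δ) : ∃ f ∈ H.perp Δ, ω f f = 0 ∧ ω e f = 1 := by
  obtain ⟨u, hu, hne⟩ := H.sep h
  have hne' := H.ne_zero_symm hne
  obtain ⟨θ, hθ⟩ := H.exists_theta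
  let f := (ω e u)⁻¹ • u
  have hf : f ∈ H.perp Δ := Submodule.smul_mem _ _ hu
  have hef : ω e f = 1 := by rw [H.smul_r, inv_mul_cancel₀ hne']
  have hfe : ω f e = 1 := by rw [H.symm e, hef, map_one]
  clear_value f
  refine ⟨f - (θ * ω f f) • e, sub_mem hf (Submodule.smul_mem _ _ he), ?_, ?_⟩
  · rw [H.sub_l, H.sub_r, H.sub_r, H.smul_l, H.smul_r, H.smul_l, H.smul_r, hee, hef, hfe, map_mul,
      ← H.symm f f]
    linear_combination (-ω f f) * hθ
  · rw [H.sub_r, H.smul_r, hee, hef]; simp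

lemma exists_pair (H : Herm σ ω) {Δ : Submodule F V} (h : H.wi Δ 1) :
    ∃ E : HPr ω, E.e ∈ H.perp Δ ∧ E.f ∈ H.perp Δ := by
  obtain ⟨A, h1, h2, h3, h4⟩ := h
  obtain ⟨a, ha⟩ := Module.finrank_pos_iff_exists_ne_zero.1 (Nat.lt_of_lt_of_le Nat.zero_lt_one h4)
  have hne : (a : V) ∉ Δ := fun h => ha (Subtype.ext (h3 a a.2 h))
  obtain ⟨f, hf, hff, hef⟩ := exists_f H (h1 a.2) (h2 _ a.2 _ a.2) hne
  exact ⟨⟨a, f, h2 _ a.2 _ a.2, hff, hef⟩, h1 a.2, hf⟩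

end herm

end HS

set_option linter.unusedVariables false
set_option linter.unusedSimpArgs false
set_option linter.unusedSectionVars false

namespace HS
open FreeAbelianGroup

section ipart
variable {F : Type} [Field F] {σ : F →+* F} {V : Type} [AddCommGroup V] [Module F V]
variable {ω : V → V → F} [FiniteDimensional F V]

def IQ (H : Herm σ ω) (b : ℕ) : Prop := ∀ Δ, H.wi Δ (b + 1) → Iprop ω Δ b

lemma IQ_zero (H : Herm σ ω) : IQ H 0 := by
  intro Δ hwi z _
  have key : ∀ a : Ch (bilinIsoms F ω) (TS ω Δ) 1, ∃ b : Ch (bilinIsoms F ω) (TP ω Δ) 1, tF ω Δ b = a := by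
    intro a
    induction a using Ch.ind with
    | h0 => exact ⟨0, map_zero _⟩
    | hc x t =>
      obtain ⟨g, hg⟩ := t.ex
      obtain ⟨E, h1, h2⟩ := exists_pair H hwi
      refine ⟨cel x ⟨t, g • E, ?_, ?_⟩, ?_⟩
      · intro y; rw [hg]; exact (Herm.isom g _ _).trans (h1 y y.2)
      · intro y; rw [hg]; exact (Herm.isom g _ _).trans (h2 y y.2)
      · rw [tF, Ch.map_cel]
    | ha x y hx hy =>
      obtain ⟨a, rfl⟩ := hx
      obtain ⟨b, rfl⟩ := hy
      exact ⟨a + b, map_add _ _ _⟩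
    | hn x hx =>
      obtain ⟨a, rfl⟩ := hx
      exact ⟨-a, map_neg _ _⟩
  obtain ⟨z1, z2⟩ := z
  obtain ⟨b, hb⟩ := key z1
  refine ⟨((0 : Ch (bilinIsoms F ω) (TS ω Δ) 2), b), Rel.ext ?_ (Subsingleton.elim (α := Ch (bilinIsoms F ω) (TP ω Δ) 0) _ _)⟩
  show Ch.d (0 : Ch (bilinIsoms F ω) (TS ω Δ) 2) + tF ω Δ b = z1
  rw [map_zero, zero_add, hb]

def IFam (H : Herm σ ω) (Δ : Submodule F V) : Fam ω Δ where
  Ω s := {v | ω v v = 0 ∧ (∀ x, ω (s.φ x) v = 0) ∧ ∀ x, s.φ x ≠ v}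
  eqv := by
    rintro g s v ⟨h1, h2, h3⟩
    refine ⟨(Herm.isom g _ _).trans h1, fun x => (Herm.isom g _ _).trans (h2 x), fun x h => h3 x ?_⟩
    exact (MulAction.injective g) h

lemma IFam_base (H : Herm σ ω) (Δ : Submodule F V) (v : V) :
    v ∈ (IFam H Δ).Ω (TS.base ω Δ) ↔ ω v v = 0 ∧ v ∈ H.perp Δ ∧ v ∉ Δ := by
  constructor
  · rintro ⟨h1, h2, h3⟩
    exact ⟨h1, fun x hx => h2 ⟨x, hx⟩, fun h => h3 ⟨v, h⟩ rfl⟩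
  · rintro ⟨h1, h2, h3⟩
    exact ⟨h1, fun x => h2 x x.2, fun x h => h3 (h ▸ x.2)⟩

/-- the symbols in the first induction vanish -/
lemma I_sym (H : Herm σ ω) (Δ : Submodule F V) (Ω : Set V)
    (hΩ : ∀ v, v ∈ Ω ↔ ω v v = 0 ∧ v ∈ H.perp Δ ∧ v ∉ Δ) {k q : ℕ} (hwi : H.wi Δ (k + 1 + q + 1))
    (η : Fin (k + 2) → V) (Δ' : Submodule F V) (hΔ' : Δ' = Δ ⊔ Submodule.span F (Set.range η))
    {E : Type} [AddCommGroup E] (S : (Fin (k + 2) → {v // v ∈ Ω ∧ v ∈ Δ'}) → E) (hS : Coc S)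
    (van : ∀ l (Δ'' : Submodule F V), Δ ≤ Δ'' → Δ'' ≤ Δ' → (∀ i, (l i).1 ∈ Δ'') → H.wi Δ'' (q + 1) →
      S l = 0)
    (inv : ∀ l l' (g : bilinIsoms F ω), (∀ x ∈ Δ, g • x = x) → (∀ x ∈ Δ', g • x ∈ Δ') →
      (∀ i, g • (l i).1 = (l' i).1) → S l' = S l)
    (l : Fin (k + 2) → {v // v ∈ Ω ∧ v ∈ Δ'}) (hl : ∀ i, (l i).1 = η i) : S l = 0 := by
  have hΔ : Δ ≤ Δ' := hΔ' ▸ le_sup_left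
  -- dependent tuples
  have dep : ∀ l, ¬ LinearIndependent F (fun i => Δ.mkQ (l i).1) → S l = 0 := by
    intro l hl
    obtain ⟨c, hc, j, hj⟩ := not_li_rel Δ _ hl
    let U : Submodule F V := Submodule.span F ((fun i => (l i).1) '' (Finset.univ.erase j : Finset (Fin (k + 2))))
    have hU : Module.finrank F U ≤ k + 1 := by
      classical
      have := finrank_span_finset_le_card (R := F) ((Finset.univ.erase j).image (fun i => (l i).1))
      rw [Finset.coe_image] at this
      refine this.trans (Finset.card_image_le.trans ?_)
      rw [Finset.card_erase_of_mem (Finset.mem_univ _)]; simp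
    have hmem : ∀ i, i ≠ j → (l i).1 ∈ U := fun i hi => Submodule.subset_span ⟨i, by simp [hi], rfl⟩
    refine van l (Δ ⊔ U) le_sup_left (sup_le hΔ ?_) ?_ (H.wi_le (H.wi_sup U hwi) (by omega))
    · rw [Submodule.span_le]; rintro _ ⟨i, -, rfl⟩; exact (l i).2.2
    · intro i
      by_cases hi : i = j
      · subst hi
        have e : (l i).1 = (c i)⁻¹ • (∑ r, c r • (l r).1) - (c i)⁻¹ • (∑ r ∈ Finset.univ.erase i, c r • (l r).1) := by
          rw [← Finset.add_sum_erase _ _ (Finset.mem_univ i), smul_add, smul_smul, inv_mul_cancel₀ hj, one_smul]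
          abel
        rw [e]
        refine sub_mem (Submodule.smul_mem _ _ (Submodule.mem_sup_left hc)) (Submodule.smul_mem _ _ (Submodule.mem_sup_right ?_))
        exact Submodule.sum_mem _ fun r hr => Submodule.smul_mem _ _ (hmem r (Finset.ne_of_mem_erase hr))
      · exact Submodule.mem_sup_right (hmem i hi)
  by_contra hne
  have hli : LinearIndependent F (fun i => Δ.mkQ (l i).1) := by
    by_contra h; exact hne (dep l h)
  -- the vectors are orthogonal to each other
  have horth : ∀ a b, ω (l a).1 (l b).1 = 0 := by
    intro a b
    by_contra hab
    have pa := (hΩ _).1 (l a).2.1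
    have pb := (hΩ _).1 (l b).2.1
    have hneq : a ≠ b := by rintro rfl; exact hab pa.1
    let U : Submodule F V := Submodule.span F ((fun i => (l i).1) '' ((Finset.univ.erase a).erase b : Finset (Fin (k + 2))))
    have hU : Module.finrank F U ≤ k := by
      classical
      have := finrank_span_finset_le_card (R := F) (((Finset.univ.erase a).erase b).image (fun i => (l i).1))
      rw [Finset.coe_image] at this
      refine this.trans (Finset.card_image_le.trans ?_)
      rw [Finset.card_erase_of_mem (by simp [hneq.symm]), Finset.card_erase_of_mem (Finset.mem_univ _)]; simp
    refine hne (van l (Δ ⊔ (F ∙ (l a).1 ⊔ F ∙ (l b).1) ⊔ U) (le_sup_left.trans le_sup_left) (sup_le (sup_le hΔ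
      (sup_le ?_ ?_)) ?_) ?_
      (H.wi_le (H.wi_sup U (H.wi_two hwi _ _ pa.2.1 pb.2.1 pa.1 hab)) (by omega)))
    · rw [Submodule.span_singleton_le_iff_mem]; exact (l a).2.2
    · rw [Submodule.span_singleton_le_iff_mem]; exact (l b).2.2
    · rw [Submodule.span_le]; rintro _ ⟨i, -, rfl⟩; exact (l i).2.2
    · intro i
      by_cases hi : i = a
      · subst hi
        exact Submodule.mem_sup_left (Submodule.mem_sup_right (Submodule.mem_sup_left (Submodule.mem_span_singleton_self _)))
      by_cases hi' : i = b
      · subst hi'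
        exact Submodule.mem_sup_left (Submodule.mem_sup_right (Submodule.mem_sup_right (Submodule.mem_span_singleton_self _)))
      · exact Submodule.mem_sup_right (Submodule.subset_span ⟨i, by simp [hi, hi'], rfl⟩)
  have hrange : Submodule.span F (Set.range η) = Submodule.span F (Set.range fun i => (l i).1) := by
    congr 2; funext i; exact (hl i).symm
  have hperp : ∀ i, (l i).1 ∈ H.perp Δ' := by
    intro i
    have h2 : (l i).1 ∈ H.perp (Δ ⊔ Submodule.span F (Set.range fun i => (l i).1)) := by
      rw [H.mem_perp_sup, H.mem_perp_span]
      refine ⟨((hΩ _).1 (l i).2.1).2.1, ?_⟩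
      rintro _ ⟨j, rfl⟩
      exact horth j i
    have h3 : Δ' ≤ Δ ⊔ Submodule.span F (Set.range fun i => (l i).1) := by
      rw [← hrange]; exact hΔ'.le
    exact H.perp_anti h3 h2
  obtain ⟨f0, hf0, hf0'⟩ := li_functional Δ _ hli (Pi.single 0 1)
  obtain ⟨f1, hf1, hf1'⟩ := li_functional Δ _ hli (Pi.single 1 1)
  have h00 : f0 (l 0).1 = 1 := by rw [hf0']; simp
  have h01 : f0 (l 1).1 = 0 := by rw [hf0']; simp
  have h10 : f1 (l 0).1 = 0 := by rw [hf1']; simp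
  have h11 : f1 (l 1).1 = 1 := by rw [hf1']; simp
  have h0r : ∀ r : Fin k, f0 (l r.succ.succ).1 = 0 := fun r => by
    rw [hf0', Pi.single_eq_of_ne]; exact Fin.succ_ne_zero _
  have h1r : ∀ r : Fin k, f1 (l r.succ.succ).1 = 0 := fun r => by
    rw [hf1', Pi.single_eq_of_ne]
    intro h
    have h := congrArg Fin.val h
    simp at h
  obtain ⟨g1, hg1⟩ := rad_isom H Δ' (f0.smulRight (l 1).1)
    (fun x hx => Submodule.smul_mem _ _ (hperp 1)) (fun x hx => Submodule.smul_mem _ _ (l 1).2.2) (by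
      intro x hx h
      have e0 := congrArg f0 h
      simp [h01] at e0
      simpa [e0] using h)
  obtain ⟨g2, hg2⟩ := rad_isom H Δ' (f0.smulRight (l 1).1 + f1.smulRight ((l 0).1 - (l 1).1))
    (fun x hx => add_mem (Submodule.smul_mem _ _ (hperp 1)) (Submodule.smul_mem _ _ (sub_mem (hperp 0) (hperp 1))))
    (fun x hx => add_mem (Submodule.smul_mem _ _ (l 1).2.2) (Submodule.smul_mem _ _ (sub_mem (l 0).2.2 (l 1).2.2))) (by
      intro x hx h
      have e0 := congrArg f0 h
      have e1 := congrArg f1 h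
      simp [h00, h01, h10, h11] at e0 e1
      have e2 : f1 x = 0 := by linear_combination e0 - e1
      have e3 : f0 x = 0 := by linear_combination e1
      simpa [e2, e3] using h)
  have hw : (l 0).1 + (l 1).1 ∈ Ω ∧ (l 0).1 + (l 1).1 ∈ Δ' := by
    refine ⟨(hΩ _).2 ⟨?_, add_mem ((hΩ _).1 (l 0).2.1).2.1 ((hΩ _).1 (l 1).2.1).2.1, ?_⟩, add_mem (l 0).2.2 (l 1).2.2⟩
    · simp only [H.add_l, H.add_r, horth, add_zero]
    · intro h
      have := hf0 _ h
      rw [map_add, h00, h01] at this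
      simp at this
  let w : {v // v ∈ Ω ∧ v ∈ Δ'} := ⟨_, hw⟩
  have c3 := coc3 hS w (l 0) (l 1) (fun r => l r.succ.succ) (by
    rintro l' ⟨i1, h1⟩ ⟨i2, h2⟩ ⟨i3, h3⟩
    refine dep l' (not_li_three _ i1 i2 i3 1 1 ?_ ?_ ?_)
    · simp only [h1, h2, h3, one_smul]; exact map_add Δ.mkQ _ _
    · simp only [h1, h2]
      intro h
      have : (l 1).1 ∈ Δ := by
        have := (Submodule.Quotient.eq Δ).1 h
        simpa [w] using this
      exact ((hΩ _).1 (l 1).2.1).2.2 this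
    · simp only [h1, h3]
      intro h
      have : (l 0).1 ∈ Δ := by
        have := (Submodule.Quotient.eq Δ).1 h
        simpa [w] using this
      exact ((hΩ _).1 (l 0).2.1).2.2 this)
  have el : (Fin.cons (l 0) (Fin.cons (l 1) (fun r => l r.succ.succ)) : Fin (k + 2) → {v // v ∈ Ω ∧ v ∈ Δ'}) = l := by
    funext i
    refine Fin.cases rfl (fun i => ?_) i
    refine Fin.cases rfl (fun i => rfl) i
  have i1 : S (Fin.cons w (Fin.cons (l 1) (fun r => l r.succ.succ))) = S l := by
    refine inv l _ g1 ?_ ?_ ?_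
    · intro x hx
      rw [hg1 x (hΔ hx)]; simp [hf0 x hx]
    · intro x hx
      rw [hg1 x hx]; exact add_mem hx (Submodule.smul_mem _ _ (l 1).2.2)
    · intro i
      rw [hg1 _ (l i).2.2]
      refine Fin.cases ?_ (fun i => ?_) i
      · simp [h00, w]
      · refine Fin.cases ?_ (fun i => ?_) i
        · simpa using Or.inl h01
        · simpa using Or.inl (h0r i)
  have i2 : S (Fin.cons w (Fin.cons (l 0) (fun r => l r.succ.succ))) = S l := by
    refine inv l _ g2 ?_ ?_ ?_
    · intro x hx
      rw [hg2 x (hΔ hx)]; simp [hf0 x hx, hf1 x hx]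
    · intro x hx
      rw [hg2 x hx]
      exact add_mem hx (add_mem (Submodule.smul_mem _ _ (l 1).2.2) (Submodule.smul_mem _ _ (sub_mem (l 0).2.2 (l 1).2.2)))
    · intro i
      rw [hg2 _ (l i).2.2]
      refine Fin.cases ?_ (fun i => ?_) i
      · simp [h00, h10, w]
      · refine Fin.cases ?_ (fun i => ?_) i
        · have : Fin.succ (0 : Fin (k + 1)) = 1 := rfl
          rw [this]
          simp [h01, h11]
        · simp [h0r, h1r]
  rw [el, i1, i2, sub_self, zero_add] at c3
  exact hne c3

lemma IFam_ne (H : Herm σ ω) (Δ : Submodule F V) (hwi : H.wi Δ 1) (s : TS ω Δ) :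
    ((IFam H Δ).Ω s).Nonempty := by
  obtain ⟨g, hg⟩ := s.ex
  obtain ⟨E, h1, h2⟩ := exists_pair H hwi
  refine ⟨g • E.e, (Herm.isom g _ _).trans E.ee, fun x => ?_, fun x h => ?_⟩
  · rw [hg]; exact (Herm.isom g _ _).trans (h1 x x.2)
  · rw [hg] at h
    have h := (MulAction.injective g) h
    have h3 := h2 x x.2
    rw [h, E.ef] at h3
    exact one_ne_zero h3

lemma IFam_ne2 (H : Herm σ ω) (Δ : Submodule F V) (hwi : H.wi Δ 2) (p : TP ω Δ) :
    ∃ v ∈ (IFam H Δ).Ω p.t, ω v p.E.e = 0 ∧ ω v p.E.f = 0 := by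
  obtain ⟨g, hg⟩ := p.t.ex
  have pe : g⁻¹ • p.E.e ∈ H.perp Δ := by
    intro x hx
    have := p.he ⟨x, hx⟩
    rw [hg] at this
    rw [← this, Herm.isom' g⁻¹, inv_inv]
  have pf : g⁻¹ • p.E.f ∈ H.perp Δ := by
    intro x hx
    have := p.hf ⟨x, hx⟩
    rw [hg] at this
    rw [← this, Herm.isom' g⁻¹, inv_inv]
  have h2 := H.wi_two hwi (g⁻¹ • p.E.e) (g⁻¹ • p.E.f) pe pf ((Herm.isom g⁻¹ _ _).trans p.E.ee)
    (by rw [Herm.isom g⁻¹, p.E.ef]; exact one_ne_zero)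
  obtain ⟨E, h3, h4⟩ := exists_pair H h2
  refine ⟨g • E.e, ⟨(Herm.isom g _ _).trans E.ee, fun x => ?_, fun x h => ?_⟩, ?_, ?_⟩
  · rw [hg]; exact (Herm.isom g _ _).trans (h3 x (Submodule.mem_sup_left x.2))
  · rw [hg] at h
    have h := (MulAction.injective g) h
    have h5 := h4 x (Submodule.mem_sup_left x.2)
    rw [h, E.ef] at h5
    exact one_ne_zero h5
  · have := h3 (g⁻¹ • p.E.e) (Submodule.mem_sup_right (Submodule.mem_sup_left (Submodule.mem_span_singleton_self _)))
    rw [← Herm.isom' g] at this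
    exact H.eq_zero_symm this
  · have := h3 (g⁻¹ • p.E.f) (Submodule.mem_sup_right (Submodule.mem_sup_right (Submodule.mem_span_singleton_self _)))
    rw [← Herm.isom' g] at this
    exact H.eq_zero_symm this

lemma finrank_span_fin_le {k : ℕ} (η : Fin k → V) : Module.finrank F (Submodule.span F (Set.range η)) ≤ k := by
  have := finrank_range_le_card (R := F) η
  simpa [Set.finrank] using this

lemma IQ_succ (H : Herm σ ω) (n : ℕ) (hn : 1 ≤ n) (hI : ∀ b < n, IQ H b) (hTA : ∀ q < n, TAprop H q)
    (hC : Cprop H n) : IQ H n := by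
  intro Δ hwi z hz
  refine resolve H (IFam H Δ) (IFam_ne H Δ (H.wi_le hwi (by omega))) (IFam_ne2 H Δ (H.wi_le hwi (by omega)))
    n ?_ (AddMonoidHom.range Rel.d) ?_ z hz
  · intro k i hk hki η hη μ hμ
    obtain ⟨k, rfl⟩ : ∃ k', k = k' + 1 := ⟨k - 1, by omega⟩
    have hwi' : H.wi (Δ ⊔ Submodule.span F (Set.range η)) i :=
      H.wi_le (H.wi_sup _ hwi) (by have := finrank_span_fin_le (F := F) η; omega)
    have key := I_sym H Δ _ (IFam_base H Δ) (k := k) (q := i) (H.wi_le hwi (by omega)) η _ rfl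
      (Sg (IFam H Δ) le_sup_left μ) (Sg_cocycle (IFam H Δ) le_sup_left μ hμ)
      (fun l Δ'' h1 h2 h3 h4 => Sg_vanish _ _ μ hμ l Δ'' h1 h2 h3 (hI i (by omega) _ h4))
      (fun l l' g h1 h2 h3 => Sg_inv H _ _ (hTA i (by omega)) hwi' μ hμ l l' g h1 h2 h3)
      (fun i => ⟨η i, hη i, sup_span_mem η i⟩) (fun i => rfl)
    exact (QuotientAddGroup.eq_zero_iff _).1 key
  · intro v hv μ hμ
    obtain ⟨h1, h2, h3⟩ := (IFam_base H Δ v).1 hv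
    refine hC Δ v h2 h1 h3 (H.wi_one hwi v) ((AddMonoidHom.range Rel.d).comap (Rel.map (res1 ω le_sup_left))) ?_ ?_ μ hμ
    · intro w
      exact ⟨Rel.map (res1 ω le_sup_left) w, Rel.d_map _ _⟩
    · intro f f1 f2 f3 μ' hμ'
      obtain ⟨w, hw⟩ := swap (H := H) (Δ := Δ) (W := Δ ⊔ F ∙ v ⊔ F ∙ f) (v := v) (v' := f)
        ⟨le_sup_left.trans le_sup_left, Submodule.mem_sup_left (Submodule.mem_sup_right (Submodule.mem_span_singleton_self _)),
        Submodule.mem_sup_right (Submodule.mem_span_singleton_self _), h2, f1, h1, f2, f3⟩ μ' hμ'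
      refine ⟨w, hw.trans ?_⟩
      rw [Rel.map_map]
      rfl

end ipart

end HS

set_option linter.unusedVariables false
set_option linter.unusedSimpArgs false
set_option linter.unusedSectionVars false

namespace HS
open FreeAbelianGroup

section cpart
variable {F : Type} [Field F] {σ : F →+* F} {V : Type} [AddCommGroup V] [Module F V]
variable {ω : V → V → F} [FiniteDimensional F V]

/-- the formal properties of the symbols in the second induction -/
structure CSym (H : Herm σ ω) (Δ₁ R : Submodule F V) (e : V) (Ω : Set V) (Δ' : Submodule F V) (k q : ℕ)
    {E : Type} [AddCommGroup E] (S : (Fin (k + 2) → {v // v ∈ Ω ∧ v ∈ Δ'}) → E) : Prop where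
  hR : R = Δ₁ ⊔ F ∙ e
  ep : e ∈ H.perp R
  hΩ : ∀ v, v ∈ Ω ↔ ω v v = 0 ∧ v ∈ H.perp Δ₁ ∧ ω e v = 1
  hΔ : R ≤ Δ'
  hwi : H.wi R (k + 1 + q)
  coc : Coc S
  van : ∀ l (Δ'' : Submodule F V), R ≤ Δ'' → Δ'' ≤ Δ' → (∀ i, (l i).1 ∈ Δ'') → H.wi Δ'' (q + 1) →
      S l = 0
  inv : ∀ l l' (g : bilinIsoms F ω), (∀ x ∈ R, g • x = x) → (∀ x ∈ Δ', g • x ∈ Δ') →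
      (∀ i, g • (l i).1 = (l' i).1) → S l' = S l

namespace CSym
variable {H : Herm σ ω} {Δ₁ R : Submodule F V} {e : V} {Ω : Set V} {Δ' : Submodule F V} {k q : ℕ}
    {E : Type} [AddCommGroup E] {S : (Fin (k + 2) → {v // v ∈ Ω ∧ v ∈ Δ'}) → E}

lemma eR (C : CSym H Δ₁ R e Ω Δ' k q S) : e ∈ R := by
  rw [C.hR]; exact Submodule.mem_sup_right (Submodule.mem_span_singleton_self _)

lemma le1 (C : CSym H Δ₁ R e Ω Δ' k q S) : Δ₁ ≤ R := by
  rw [C.hR]; exact le_sup_left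

lemma ee (C : CSym H Δ₁ R e Ω Δ' k q S) : ω e e = 0 := C.ep e C.eR

lemma ef (C : CSym H Δ₁ R e Ω Δ' k q S) (v : {v // v ∈ Ω ∧ v ∈ Δ'}) : ω e v.1 = 1 := ((C.hΩ _).1 v.2.1).2.2

lemma eRx (C : CSym H Δ₁ R e Ω Δ' k q S) {x : V} (hx : x ∈ R) : ω e x = 0 := H.eq_zero_symm (C.ep x hx)

lemma dep (C : CSym H Δ₁ R e Ω Δ' k q S) (l) (f0 : V) (hf : f0 ∈ Δ') (hf1 : ω e f0 = 1)
    (U : Submodule F V) (hU : Module.finrank F U < k + 1) (h : ∀ i, (l i).1 - f0 ∈ R ⊔ U) : S l = 0 := by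
  have hle : Module.finrank F (U ⊓ Δ' : Submodule F V) ≤ Module.finrank F U := Submodule.finrank_mono inf_le_left
  refine C.van l (R ⊔ F ∙ f0 ⊔ U ⊓ Δ') (le_sup_left.trans le_sup_left) (sup_le (sup_le C.hΔ ?_) inf_le_right)
    ?_ (H.wi_le (H.wi_sup _ (H.wi_four C.hwi e f0 C.eR C.ep hf1)) (by omega))
  · rw [Submodule.span_singleton_le_iff_mem]; exact hf
  · intro i
    obtain ⟨r, hr, u, hu, hru⟩ := Submodule.mem_sup.1 (h i)
    have e1 : (l i).1 = r + f0 + u := by rw [eq_add_of_sub_eq hru.symm]; abel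
    have hu' : u ∈ Δ' := by
      have : u = (l i).1 - f0 - r := by rw [e1]; abel
      rw [this]; exact sub_mem (sub_mem (l i).2.2 hf) (C.hΔ hr)
    rw [e1]
    exact add_mem (Submodule.mem_sup_left (add_mem (Submodule.mem_sup_left hr)
      (Submodule.mem_sup_right (Submodule.mem_span_singleton_self _)))) (Submodule.mem_sup_right ⟨hu, hu'⟩)

lemma sum_zero (C : CSym H Δ₁ R e Ω Δ' k q S) (l : Fin (k + 2) → {v // v ∈ Ω ∧ v ∈ Δ'}) (c : Fin (k + 2) → F)
    (x : V) (hx : ω e x = 0) (h : x - ∑ i, c i • (l i).1 ∈ R) : ∑ i, c i = 0 := by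
  have h1 := C.eRx h
  rw [H.sub_r, hx, zero_sub, neg_eq_zero] at h1
  rw [← h1]
  change _ = H.L e _
  rw [map_sum]
  refine Finset.sum_congr rfl fun i _ => ?_
  rw [map_smul, H.L_apply, C.ef, smul_eq_mul, mul_one]

/-- one of the points is in the affine span of the others modulo R -/
lemma dep_aff (C : CSym H Δ₁ R e Ω Δ' k q S) (l) (j : Fin (k + 2)) (c : Fin (k + 2) → F)
    (hj : c j ≠ 0) (hc : ∑ i, c i • (l i).1 ∈ R) : S l = 0 := by
  have hs := C.sum_zero l c 0 (H.zero_r _) (by simpa using hc)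
  obtain ⟨i0, hi0⟩ := exists_ne j
  let U : Submodule F V := Submodule.span F ((fun i => (l i).1 - (l i0).1) '' ((Finset.univ.erase j).erase i0 : Finset (Fin (k + 2))))
  have hU : Module.finrank F U < k + 1 := by
    classical
    have := finrank_span_finset_le_card (R := F) (((Finset.univ.erase j).erase i0).image (fun i => (l i).1 - (l i0).1))
    rw [Finset.coe_image] at this
    have h2 := this.trans Finset.card_image_le
    rw [Finset.card_erase_of_mem (by simp [hi0]), Finset.card_erase_of_mem (Finset.mem_univ _)] at h2
    rw [Finset.card_univ, Fintype.card_fin] at h2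
    exact Nat.lt_succ_of_le h2
  have hmem : ∀ i, i ≠ j → (l i).1 - (l i0).1 ∈ U := by
    intro i hi
    by_cases h : i = i0
    · subst h; simp
    · exact Submodule.subset_span ⟨i, by simp [hi, h], rfl⟩
  refine C.dep l (l i0).1 (l i0).2.2 (C.ef _) U hU fun i => ?_
  by_cases hi : i = j
  · subst hi
    have e2 : ∑ r, c r • ((l r).1 - (l i0).1) = ∑ r, c r • (l r).1 := by
      simp only [smul_sub, Finset.sum_sub_distrib, ← Finset.sum_smul, hs, zero_smul, sub_zero]
    have e1 : (l i).1 - (l i0).1 = (c i)⁻¹ • (∑ r, c r • (l r).1) - (c i)⁻¹ • (∑ r ∈ Finset.univ.erase i, c r • ((l r).1 - (l i0).1)) := by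
      rw [← e2, ← Finset.add_sum_erase _ _ (Finset.mem_univ i), smul_add, smul_smul, inv_mul_cancel₀ hj, one_smul]
      abel
    rw [e1]
    refine sub_mem (Submodule.smul_mem _ _ (Submodule.mem_sup_left hc)) (Submodule.smul_mem _ _ (Submodule.mem_sup_right ?_))
    exact Submodule.sum_mem _ fun r hr => Submodule.smul_mem _ _ (hmem r (Finset.ne_of_mem_erase hr))
  · exact Submodule.mem_sup_right (hmem i hi)

lemma depLI (C : CSym H Δ₁ R e Ω Δ' k q S) (l) (h : ¬ LinearIndependent F (fun i => R.mkQ (l i).1)) : S l = 0 := by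
  obtain ⟨c, hc, j, hj⟩ := not_li_rel R _ h
  exact C.dep_aff l j c hj hc

lemma dep_eq (C : CSym H Δ₁ R e Ω Δ' k q S) (l) (i j : Fin (k + 2)) (hij : i ≠ j) (h : (l i).1 - (l j).1 ∈ R) : S l = 0 := by
  refine C.depLI l fun hl => hij (hl.injective ?_)
  exact (Submodule.Quotient.eq R).2 h

lemma modR (C : CSym H Δ₁ R e Ω Δ' k q S) (l l' : Fin (k + 2) → {v // v ∈ Ω ∧ v ∈ Δ'})
    (h : ∀ i, (l i).1 - (l' i).1 ∈ R) : S l = S l' := by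
  have h' : ∀ i, (l' i).1 - (l i).1 ∈ R := fun i => by rw [← neg_sub]; exact neg_mem (h i)
  refine prism_eq S C.coc (fun i => (l' i, l i)) ?_
  intro i m hm
  choose f hf using hm
  obtain ⟨a, b, hab, hfab⟩ := Fintype.exists_ne_map_eq_of_card_lt f (by simp)
  refine C.dep_eq m a b hab ?_
  have ha := hf a
  have hb := hf b
  rw [hfab] at ha
  rcases ha with ha | ha <;> rcases hb with hb | hb <;> rw [ha, hb]
  · simp
  · exact h' _
  · exact h _
  · simp

/-- translating by the radical -/
lemma mem_rad (C : CSym H Δ₁ R e Ω Δ' k q S) (a : {v // v ∈ Ω ∧ v ∈ Δ'}) {d : V} (hd : d ∈ Δ')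
    (hd' : d ∈ H.perp Δ') : a.1 + d ∈ Ω ∧ a.1 + d ∈ Δ' := by
  have ha := (C.hΩ _).1 a.2.1
  refine ⟨(C.hΩ _).2 ⟨?_, add_mem ha.2.1 (H.perp_anti (C.le1.trans C.hΔ) hd'), ?_⟩, add_mem a.2.2 hd⟩
  · rw [H.add_l, H.add_r, H.add_r, ha.1, hd' _ a.2.2, H.eq_zero_symm (hd' _ a.2.2), hd' _ hd]; simp
  · rw [H.add_r, ha.2.2, hd' _ (C.hΔ C.eR), add_zero]

lemma A01 (C : CSym H Δ₁ R e Ω Δ' k q S) (a a' : {v // v ∈ Ω ∧ v ∈ Δ'}) (d : V) (t : F) (ht1 : t ≠ 1) (hd : d ∈ Δ')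
    (hd' : d ∈ H.perp Δ') (ha : a'.1 = a.1 + t • d) (rest : Fin k → {v // v ∈ Ω ∧ v ∈ Δ'}) :
    S (Fin.cons a' (Fin.cons a rest)) = 0 := by
  by_contra hne
  have hli : LinearIndependent F (fun i => R.mkQ ((Fin.cons a' (Fin.cons a rest) : Fin (k + 2) → {v // v ∈ Ω ∧ v ∈ Δ'}) i).1) := by
    by_contra h; exact hne (C.depLI _ h)
  have ht0 : t ≠ 0 := by
    rintro rfl
    refine hne (C.dep_eq _ 0 1 (by simp) ?_)
    show a'.1 - a.1 ∈ R
    rw [ha]; simp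
  have hdR : d ∉ R := by
    intro h
    refine hne (C.dep_eq _ 0 1 (by simp) ?_)
    show a'.1 - a.1 ∈ R
    rw [ha]; simpa using Submodule.smul_mem _ _ h
  let b : {v // v ∈ Ω ∧ v ∈ Δ'} := ⟨a.1 + d, C.mem_rad a hd hd'⟩
  obtain ⟨f, hfR, hf⟩ := li_functional R _ hli (Fin.cons (t - t * t) (Fin.cons t 0))
  have fa' : f a'.1 = t - t * t := hf 0
  have fa : f a.1 = t := hf 1
  have fr : ∀ r, f (rest r).1 = 0 := fun r => hf r.succ.succ
  have fd : f d = -t := by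
    rw [ha, map_add, fa, map_smul, smul_eq_mul] at fa'
    have : t * (f d + t) = 0 := by linear_combination fa'
    rcases mul_eq_zero.1 this with h | h
    · exact absurd h ht0
    · linear_combination h
  have fb : f b.1 = 0 := by
    show f (a.1 + d) = 0
    rw [map_add, fa, fd]; ring
  obtain ⟨g, hg⟩ := rad_isom H Δ' (f.smulRight d)
    (fun x hx => Submodule.smul_mem _ _ hd') (fun x hx => Submodule.smul_mem _ _ hd) (by
      intro x hx h
      have e0 := congrArg f h
      simp [fd] at e0
      have e1 : f x * (1 - t) = 0 := by linear_combination e0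
      have e2 : f x = 0 := by
        rcases mul_eq_zero.1 e1 with h | h
        · exact h
        · exact absurd (by linear_combination -h) ht1
      simpa [e2] using h)
  have c3 := coc3 C.coc a' a b rest (by
    rintro l' ⟨i1, h1⟩ ⟨i2, h2⟩ ⟨i3, h3⟩
    refine C.depLI l' (not_li_three _ i1 i2 i3 (1 - t) t ?_ ?_ ?_)
    · simp only [h1, h2, h3]
      rw [← map_smul, ← map_smul, ← map_add]
      congr 1
      rw [ha]; show a.1 + t • d = (1 - t) • a.1 + t • (a.1 + d)
      module
    · simp only [h1, h2]
      intro h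
      have := (Submodule.Quotient.eq R).1 h
      rw [ha, add_sub_cancel_left, Submodule.smul_mem_iff _ ht0] at this
      exact hdR this
    · simp only [h1, h3]
      intro h
      have := (Submodule.Quotient.eq R).1 h
      have e1 : a'.1 - b.1 = (t - 1) • d := by
        rw [ha]; show a.1 + t • d - (a.1 + d) = _
        module
      rw [e1, Submodule.smul_mem_iff _ (sub_ne_zero.2 ht1)] at this
      exact hdR this)
  have i1 : S (Fin.cons a' (Fin.cons b rest)) = S (Fin.cons a (Fin.cons b rest)) := by
    refine C.inv _ _ g ?_ ?_ ?_
    · intro x hx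
      rw [hg x (C.hΔ hx)]; simp [hfR x hx]
    · intro x hx
      rw [hg x hx]; exact add_mem hx (Submodule.smul_mem _ _ hd)
    · intro i
      rw [hg _ ((Fin.cons a (Fin.cons b rest) : Fin (k + 2) → {v // v ∈ Ω ∧ v ∈ Δ'}) i).2.2]
      refine Fin.cases ?_ (fun i => ?_) i
      · simp [fa, ha]
      · refine Fin.cases ?_ (fun i => ?_) i
        · simp [fb]
        · simp [fr]
  rw [i1, sub_self, zero_add] at c3
  exact hne c3

lemma exists_u (H : Herm σ ω) : ∃ u : F, u ≠ 0 ∧ u ≠ 1 := by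
  obtain ⟨a, ha⟩ := H.ne
  exact ⟨a, by rintro rfl; simp at ha, by rintro rfl; simp at ha⟩

lemma A01' (C : CSym H Δ₁ R e Ω Δ' k q S) (a a' : {v // v ∈ Ω ∧ v ∈ Δ'}) (hd : a'.1 - a.1 ∈ H.perp Δ')
    (rest : Fin k → {v // v ∈ Ω ∧ v ∈ Δ'}) :
    S (Fin.cons a' (Fin.cons a rest)) = 0 := by
  obtain ⟨u, h0, h1⟩ := exists_u H
  refine C.A01 a a' (u⁻¹ • (a'.1 - a.1)) u h1 (Submodule.smul_mem _ _ (sub_mem a'.2.2 a.2.2)) (Submodule.smul_mem _ _ hd) ?_ rest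
  rw [smul_smul, mul_inv_cancel₀ h0, one_smul]; abel

lemma move (C : CSym H Δ₁ R e Ω Δ' k q S) (l : Fin (k + 2) → {v // v ∈ Ω ∧ v ∈ Δ'}) (i : Fin (k + 2)) :
    S l = (-1 : ℤ) ^ (i : ℕ) • S (Fin.cons (l i) (fun r => l (i.succAbove r))) := by
  refine coc_cons C.coc (l i) l i fun j hj => ?_
  obtain ⟨r, hr⟩ := Fin.exists_succAbove_eq hj.symm
  refine C.dep_eq _ 0 r.succ (Fin.succ_ne_zero _).symm ?_
  simp [hr]

lemma A_gen (C : CSym H Δ₁ R e Ω Δ' k q S) (l : Fin (k + 2) → {v // v ∈ Ω ∧ v ∈ Δ'}) (i j : Fin (k + 2)) (hij : i ≠ j)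
    (h : (l i).1 - (l j).1 ∈ H.perp Δ') : S l = 0 := by
  rw [C.move l j]
  obtain ⟨r, hr⟩ := Fin.exists_succAbove_eq hij
  rw [C.move _ r.succ]
  have e1 : (fun s => (Fin.cons (l j) (fun r => l (j.succAbove r)) : Fin (k + 2) → {v // v ∈ Ω ∧ v ∈ Δ'}) (r.succ.succAbove s)) =
      Fin.cons (l j) (fun s => l (j.succAbove (r.succAbove s))) := by
    funext s
    refine Fin.cases ?_ (fun s => ?_) s
    · simp
    · simp
  rw [e1, Fin.cons_succ, hr, C.A01' _ _ h, smul_zero, smul_zero]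

/-- the case of an isotropic direction in the radical -/
lemma iso_case (C : CSym H Δ₁ R e Ω Δ' k q S) (l : Fin (k + 2) → {v // v ∈ Ω ∧ v ∈ Δ'})
    (hl : Δ' = R ⊔ Submodule.span F (Set.range fun i => (l i).1)) (d : V) (hd : d ∈ Δ') (hd' : d ∈ H.perp Δ')
    (hdR : d ∉ R) : S l = 0 := by
  have hd2 : d ∈ R ⊔ Submodule.span F (Set.range fun i => (l i).1) := hl.le hd
  obtain ⟨r, hr, z, hz, hrz⟩ := Submodule.mem_sup.1 hd2
  obtain ⟨c, rfl⟩ := (Submodule.mem_span_range_iff_exists_fun F).1 hz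
  obtain ⟨i0, hi0⟩ : ∃ i, c i ≠ 0 := by
    by_contra h
    push Not at h
    refine hdR ?_
    rw [← hrz]; simpa [h] using hr
  let a : {v // v ∈ Ω ∧ v ∈ Δ'} := ⟨(l i0).1 + (-(c i0)⁻¹ • d), C.mem_rad _ (Submodule.smul_mem _ _ hd) (Submodule.smul_mem _ _ hd')⟩
  have hav : a.1 = (l i0).1 + (-(c i0)⁻¹ • d) := rfl
  rw [coc_cons C.coc a l i0]
  · rw [C.dep_aff (Fin.cons a (fun r => l (i0.succAbove r))) 0
      (Fin.cons (c i0) (fun r => c (i0.succAbove r))) hi0, smul_zero]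
    rw [Fin.sum_univ_succ]
    simp only [Fin.cons_zero, Fin.cons_succ]
    have e2 := Fin.sum_univ_succAbove (fun i => c i • (l i).1) i0
    rw [hav, smul_add, smul_smul, mul_neg, mul_inv_cancel₀ hi0]
    rw [e2] at hrz
    have : c i0 • (l i0).1 + (-1 : F) • d + ∑ x, c (i0.succAbove x) • (l (i0.succAbove x)).1 = -r := by
      rw [← hrz]; module
    rw [this]
    exact neg_mem hr
  · intro j hj
    obtain ⟨r, hr⟩ := Fin.exists_succAbove_eq hj.symm
    refine C.A_gen _ 0 r.succ (Fin.succ_ne_zero _).symm ?_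
    simp only [Fin.cons_zero, Fin.cons_succ, hr, hav, add_sub_cancel_left]
    exact Submodule.smul_mem _ _ hd'

end CSym
end cpart

end HS

set_option linter.unusedVariables false
set_option linter.unusedSimpArgs false
set_option linter.unusedSectionVars false

namespace HS
open FreeAbelianGroup

section cpart2
variable {F : Type} [Field F] {σ : F →+* F} {V : Type} [AddCommGroup V] [Module F V]
variable {ω : V → V → F} [FiniteDimensional F V]

/-- Eichler transformations -/
lemma eichler (H : Herm σ ω) (e c : V) (θ : F) (hθ : θ + σ θ = 1) (hee : ω e e = 0) (hec : ω e c = 0) :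
    ∃ g : bilinIsoms F ω, ∀ x, g • x = x + ω e x • (c - (θ * ω c c) • e) - ω c x • e := by
  let T : V →ₗ[F] V := LinearMap.id + (H.L e).smulRight (c - (θ * ω c c) • e) - (H.L c).smulRight e
  have hT : ∀ x, T x = x + ω e x • (c - (θ * ω c c) • e) - ω c x • e := fun x => rfl
  have hce : ω c e = 0 := H.eq_zero_symm hec
  have hs : σ (ω c c) = ω c c := (H.symm c c).symm
  obtain ⟨g, hg⟩ := isom_lift H T (by
    intro x y
    rw [hT, hT]
    simp only [H.add_l, H.add_r, H.sub_l, H.sub_r, H.smul_l, H.smul_r, hee, hec, hce, map_mul, hs]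
    rw [H.symm e x, H.symm c x]
    linear_combination (-(σ (ω e x)) * ω e y * ω c c) * hθ)
  exact ⟨g, fun x => (hg x).trans (hT x)⟩

/-- unitary homotheties of an anisotropic subspace -/
lemma homoth (H : Herm σ ω) (P : Submodule F V) (hP : ∀ x ∈ P, ω x x = 0 → x = 0) (u : F) (hu : σ u * u = 1) :
    ∃ g : bilinIsoms F ω, (∀ x ∈ P, g • x = u • x) ∧ (∀ x ∈ H.perp P, g • x = x) := by
  have hd := decomp H P (fun x hx hx' => hP x hx (hx' x hx))
  have hc : IsCompl P (H.perp P) := by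
    constructor
    · rw [Submodule.disjoint_def]
      intro x hx hx'
      exact hP x hx (hx' x hx)
    · rw [codisjoint_iff, eq_top_iff]
      intro x _
      obtain ⟨p, hp, hxp⟩ := hd x
      have : x = p + (x - p) := by abel
      rw [this]
      exact add_mem (Submodule.mem_sup_left hp) (Submodule.mem_sup_right hxp)
  let T : V →ₗ[F] V := LinearMap.id + (u - 1) • (P.subtype ∘ₗ Submodule.projectionOnto P (H.perp P) hc)
  have T1 : ∀ x ∈ P, T x = u • x := by
    intro x hx
    have : Submodule.projectionOnto P (H.perp P) hc x = ⟨x, hx⟩ :=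
      Submodule.projectionOnto_apply_left hc ⟨x, hx⟩
    show x + (u - 1) • ((Submodule.projectionOnto P (H.perp P) hc x : P) : V) = _
    rw [this]
    module
  have T2 : ∀ x ∈ H.perp P, T x = x := by
    intro x hx
    have : Submodule.projectionOnto P (H.perp P) hc x = 0 :=
      Submodule.projectionOnto_apply_right hc ⟨x, hx⟩
    show x + (u - 1) • ((Submodule.projectionOnto P (H.perp P) hc x : P) : V) = _
    rw [this]
    simp
  obtain ⟨g, hg⟩ := isom_lift H T (by
    intro x y
    obtain ⟨p, hp, hxp⟩ := hd x
    obtain ⟨r, hr, hyr⟩ := hd y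
    obtain ⟨x', rfl⟩ : ∃ x', x = p + x' := ⟨x - p, by abel⟩
    obtain ⟨y', rfl⟩ : ∃ y', y = r + y' := ⟨y - r, by abel⟩
    rw [add_sub_cancel_left] at hxp hyr
    rw [map_add, map_add, T1 p hp, T1 r hr, T2 _ hxp, T2 _ hyr]
    simp only [H.add_l, H.add_r, H.smul_l, H.smul_r, hyr p hp, H.eq_zero_symm (hxp r hr)]
    linear_combination (ω p r) * hu)
  exact ⟨g, fun x hx => (hg x).trans (T1 x hx), fun x hx => (hg x).trans (T2 x hx)⟩

namespace CSym
variable {H : Herm σ ω} {Δ₁ R : Submodule F V} {e : V} {Ω : Set V} {Δ' : Submodule F V} {k q : ℕ}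
    {E : Type} [AddCommGroup E] {S : (Fin (k + 2) → {v // v ∈ Ω ∧ v ∈ Δ'}) → E}

lemma perpR (C : CSym H Δ₁ R e Ω Δ' k q S) {v : V} (h1 : v ∈ H.perp Δ₁) (h2 : ω e v = 0) : v ∈ H.perp R := by
  rw [C.hR, H.mem_perp_sup, H.mem_perp_span_singleton]; exact ⟨h1, h2⟩

lemma aniso_case (C : CSym H Δ₁ R e Ω Δ' k q S) (f0 : {v // v ∈ Ω ∧ v ∈ Δ'}) (D : Submodule F V)
    (hDΔ : D ≤ Δ') (hDR : D ≤ H.perp R) (hDf : ∀ x ∈ D, ω f0.1 x = 0) (hD : Module.finrank F D = k + 1)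
    (han : ∀ x ∈ D, ω x x = 0 → x = 0) :
    ∃ θ : F, ∃ pt : D → {v // v ∈ Ω ∧ v ∈ Δ'}, (∀ x : D, (pt x).1 = f0.1 + x - (θ * ω x x) • e) ∧
      ∀ l : Fin (k + 2) → D, S (pt ∘ l) = 0 := by
  obtain ⟨θ, hθ⟩ := H.exists_theta
  obtain ⟨u, hu1, hu⟩ := H.exists_norm_one
  have hf0 := (C.hΩ _).1 f0.2.1
  have hfe : ω f0.1 e = 1 := by rw [H.symm e, hf0.2.2, map_one]
  have hss : ∀ x, σ (ω x x) = ω x x := fun x => (H.symm x x).symm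
  have heD : ∀ x ∈ D, ω e x = 0 := fun x hx => hDR hx e C.eR
  have hDe : ∀ x ∈ D, ω x e = 0 := fun x hx => H.eq_zero_symm (heD x hx)
  have hee := C.ee
  have eΔ : e ∈ Δ' := C.hΔ C.eR
  let pt : D → {v // v ∈ Ω ∧ v ∈ Δ'} := fun x => ⟨f0.1 + x - (θ * ω x x) • e, by
    refine ⟨(C.hΩ _).2 ⟨?_, ?_, ?_⟩, sub_mem (add_mem f0.2.2 (hDΔ x.2)) (Submodule.smul_mem _ _ eΔ)⟩
    · simp only [H.add_l, H.add_r, H.sub_l, H.sub_r, H.smul_l, H.smul_r, hee, hfe, hf0.1, hf0.2.2, hDe x x.2, heD x x.2,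
        hDf x x.2, H.eq_zero_symm (hDf x x.2), map_mul, hss]
      linear_combination (-(ω (x : V) (x : V))) * hθ
    · exact sub_mem (add_mem hf0.2.1 (H.perp_anti C.le1 (hDR x.2))) (Submodule.smul_mem _ _ (H.perp_anti C.le1 C.ep))
    · rw [H.sub_r, H.add_r, H.smul_r, hf0.2.2, heD x x.2, hee]; ring⟩
  have hpt : ∀ x : D, (pt x).1 = f0.1 + x - (θ * ω x x) • e := fun x => rfl
  refine ⟨θ, pt, hpt, ?_⟩
  have hnd : ∀ x ∈ D, x ∈ H.perp D → x = 0 := fun x hx hx' => han x hx (hx' x hx)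
  obtain ⟨d', hd'⟩ := Module.finrank_pos_iff_exists_ne_zero.1 (show 0 < Module.finrank F D by omega)
  refine aniso u hu1 E k D (fun x y : D => ω x y) (H.restrict D hnd) (fun x hx => Subtype.ext (han x x.2 hx)) hD d' hd'
    (fun l => S (pt ∘ l)) ?_ ?_ ?_ ?_
  · intro l
    have := C.coc (pt ∘ l)
    rw [bdT, map_sum] at this ⊢
    simp only [map_zsmul, lift_apply_of] at this ⊢
    exact this
  · intro l x0 U hU h
    refine C.dep _ (pt x0).1 (pt x0).2.2 (C.ef _) (U.map D.subtype) ?_ ?_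
    · exact (Submodule.finrank_map_le _ _).trans_lt hU
    · intro i
      have : ((pt ∘ l) i).1 - (pt x0).1 = (θ * ω x0 x0 - θ * ω (l i) (l i)) • e + ((l i - x0 : D) : V) := by
        rw [Function.comp_apply, hpt, hpt, Submodule.coe_sub]; module
      rw [this]
      exact add_mem (Submodule.mem_sup_left (Submodule.smul_mem _ _ C.eR)) (Submodule.mem_sup_right ⟨_, h i, rfl⟩)
  · intro l c
    obtain ⟨g, hg⟩ := eichler H e c θ hθ hee (heD c c.2)
    have hgΔ : ∀ x ∈ Δ', g • x ∈ Δ' := by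
      intro x hx
      rw [hg]
      exact sub_mem (add_mem hx (Submodule.smul_mem _ _ (sub_mem (hDΔ c.2) (Submodule.smul_mem _ _ eΔ)))) (Submodule.smul_mem _ _ eΔ)
    have hgR : ∀ x ∈ R, g • x = x := by
      intro x hx
      rw [hg, C.eRx hx, H.eq_zero_symm (hDR c.2 x hx)]; simp
    have hgp : ∀ x : D, g • (pt x).1 = f0.1 + x + c - (θ * ω x x + θ * ω c c + ω c x) • e := by
      intro x
      rw [hg, C.ef]
      rw [hpt, H.sub_r, H.add_r, H.smul_r, H.eq_zero_symm (hDf c c.2), hDe c c.2]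
      module
    have hmem : ∀ x : D, g • (pt x).1 ∈ Ω := by
      intro x
      have := (C.hΩ _).1 (pt x).2.1
      refine (C.hΩ _).2 ⟨(Herm.isom g _ _).trans this.1, fun y hy => ?_, ?_⟩
      · rw [← hgR y (C.le1 hy)]; exact (Herm.isom g _ _).trans (this.2.1 y hy)
      · have h2 := Herm.isom g e (pt x).1
        rw [hgR e C.eR] at h2
        rw [h2]; exact this.2.2
    have h1 := C.inv (pt ∘ l) (fun i => ⟨g • (pt (l i)).1, hmem _, hgΔ _ (pt (l i)).2.2⟩) g hgR hgΔ (fun i => rfl)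
    rw [← h1]
    refine C.modR _ _ fun i => ?_
    show (pt (l i + c)).1 - g • (pt (l i)).1 ∈ R
    rw [hgp, hpt, Submodule.coe_add]
    have : ∀ a b : F, f0.1 + ((l i : V) + c) - a • e - (f0.1 + l i + c - b • e) = (b - a) • e := by intro a b; module
    rw [this]
    exact Submodule.smul_mem _ _ C.eR
  · intro P s hdP hs1 hs2 l
    obtain ⟨g, hg1, hg2⟩ := homoth H (P.map D.subtype) (by
      rintro _ ⟨x, hx, rfl⟩ h
      exact han x x.2 h) u hu
    have hP : P.map D.subtype ≤ D := by rintro _ ⟨x, hx, rfl⟩; exact x.2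
    have hgR : ∀ x ∈ R, g • x = x := by
      intro x hx
      exact hg2 x fun y hy => H.eq_zero_symm (hDR (hP hy) x hx)
    have hgf : g • f0.1 = f0.1 := hg2 _ fun y hy => H.eq_zero_symm (hDf y (hP hy))
    have hgD : ∀ x : D, g • (x : V) = s x := by
      intro x
      obtain ⟨p, hp, hxp⟩ := decomp (H.restrict D hnd) P (fun x hx hx' => Subtype.ext (han x x.2 (hx' x hx))) x
      obtain ⟨x', rfl⟩ : ∃ x', x = p + x' := ⟨x - p, by abel⟩
      rw [add_sub_cancel_left] at hxp
      rw [map_add, hs1 p hp, hs2 x' hxp, Submodule.coe_add, Submodule.coe_add, Herm.smul_add' g, show g • (p : V) = u • (p : V) from hg1 _ ⟨p, hp, rfl⟩, hg2 x']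
      · rfl
      · rintro _ ⟨y, hy, rfl⟩
        exact hxp y hy
    have hgΔ : ∀ x ∈ Δ', g • x ∈ Δ' := by
      intro x hx
      obtain ⟨p, hp, hxp⟩ := decomp H (P.map D.subtype) (fun x hx hx' => han x (hP hx) (hx' x hx)) x
      obtain ⟨x', rfl⟩ : ∃ x', x = p + x' := ⟨x - p, by abel⟩
      rw [add_sub_cancel_left] at hxp
      rw [Herm.smul_add' g, hg1 _ hp, hg2 x' hxp]
      have hp' := hDΔ (hP hp)
      have hx' : x' ∈ Δ' := by have := sub_mem hx hp'; rwa [add_sub_cancel_left] at this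
      exact add_mem (Submodule.smul_mem _ _ hp') hx'
    refine C.inv (pt ∘ l) _ g hgR hgΔ fun i => ?_
    show g • (pt (l i)).1 = (pt (s (l i))).1
    rw [hpt, hpt, sub_eq_add_neg, ← neg_smul, Herm.smul_add' g, Herm.smul_add' g, Herm.smul_smul' g, hgf, hgD, hgR e C.eR,
      ← hgD (l i), Herm.isom g, sub_eq_add_neg, ← neg_smul]

lemma main (C : CSym H Δ₁ R e Ω Δ' k q S) (l : Fin (k + 2) → {v // v ∈ Ω ∧ v ∈ Δ'})
    (hl : Δ' = R ⊔ Submodule.span F (Set.range fun i => (l i).1)) : S l = 0 := by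
  have hf0 := (C.hΩ _).1 (l 0).2.1
  have hfe : ω (l 0).1 e = 1 := by rw [H.symm e, hf0.2.2, map_one]
  have eΔ : e ∈ Δ' := C.hΔ C.eR
  obtain ⟨x, hx⟩ : ∃ x : Fin (k + 1) → V, ∀ i, x i = (l i.succ).1 - (l 0).1 - ω (l 0).1 (l i.succ).1 • e :=
    ⟨_, fun i => rfl⟩
  obtain ⟨D, hDx⟩ : ∃ D, D = Submodule.span F (Set.range x) := ⟨_, rfl⟩
  have hxD : ∀ i, x i ∈ D := fun i => by rw [hDx]; exact Submodule.subset_span ⟨i, rfl⟩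
  have hDΔ : D ≤ Δ' := by
    rw [hDx, Submodule.span_le]
    rintro _ ⟨i, rfl⟩
    rw [hx]
    exact sub_mem (sub_mem (l i.succ).2.2 (l 0).2.2) (Submodule.smul_mem _ _ eΔ)
  have hDR : D ≤ H.perp R := by
    rw [hDx, Submodule.span_le]
    rintro _ ⟨i, rfl⟩
    rw [hx]
    have hi := (C.hΩ _).1 (l i.succ).2.1
    refine C.perpR (sub_mem (sub_mem hi.2.1 hf0.2.1) (Submodule.smul_mem _ _ (H.perp_anti C.le1 C.ep))) ?_
    rw [H.sub_r, H.sub_r, H.smul_r, hi.2.2, hf0.2.2, C.ee]; ring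
  have hDf : D ≤ H.perp (F ∙ (l 0).1) := by
    rw [hDx, Submodule.span_le]
    rintro _ ⟨i, rfl⟩
    rw [hx, SetLike.mem_coe, H.mem_perp_span_singleton, H.sub_r, H.sub_r, H.smul_r, hf0.1, hfe]; ring
  have hDf' : ∀ y ∈ D, ω (l 0).1 y = 0 := fun y hy => H.mem_perp_span_singleton.1 (hDf hy)
  have hlD : ∀ i, (l i).1 - (l 0).1 ∈ R ⊔ D := by
    intro i
    refine Fin.cases ?_ (fun i => ?_) i
    · simp
    · have : (l i.succ).1 - (l 0).1 = ω (l 0).1 (l i.succ).1 • e + x i := by rw [hx]; abel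
      rw [this]
      exact add_mem (Submodule.mem_sup_left (Submodule.smul_mem _ _ C.eR)) (Submodule.mem_sup_right (hxD i))
  have hΔle : Δ' ≤ R ⊔ F ∙ (l 0).1 ⊔ D := by
    have h2 : R ⊔ Submodule.span F (Set.range fun i => (l i).1) ≤ R ⊔ F ∙ (l 0).1 ⊔ D := by
      refine sup_le (le_sup_left.trans le_sup_left) (Submodule.span_le.2 ?_)
      rintro _ ⟨i, rfl⟩
      have h3 : R ⊔ D ≤ R ⊔ F ∙ (l 0).1 ⊔ D := sup_le_sup_right le_sup_left _
      have h4 : (l 0).1 ∈ R ⊔ F ∙ (l 0).1 ⊔ D :=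
        Submodule.mem_sup_left (Submodule.mem_sup_right (Submodule.mem_span_singleton_self _))
      have := add_mem (h3 (hlD i)) h4
      rwa [sub_add_cancel] at this
    exact hl.le.trans h2
  have hle : Module.finrank F D ≤ k + 1 := by rw [hDx]; exact finrank_span_fin_le x
  by_cases hlt : Module.finrank F D < k + 1
  · exact C.dep l (l 0).1 (l 0).2.2 (C.ef _) D hlt hlD
  have hD : Module.finrank F D = k + 1 := by omega
  by_cases han : ∀ y ∈ D, ω y y = 0 → y = 0
  · obtain ⟨θ, pt, hpt, h0⟩ := C.aniso_case (l 0) D hDΔ hDR hDf' hD han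
    rw [← h0 (Fin.cons 0 fun i => ⟨x i, hxD i⟩)]
    refine C.modR _ _ fun i => ?_
    rw [Function.comp_apply, hpt]
    refine Fin.cases ?_ (fun i => ?_) i
    · simp only [Fin.cons_zero, Submodule.coe_zero, H.zero_r]; simp
    · simp only [Fin.cons_succ]
      generalize θ * ω (x i) (x i) = t
      rw [hx]
      have : (l i.succ).1 - ((l 0).1 + ((l i.succ).1 - (l 0).1 - ω (l 0).1 (l i.succ).1 • e) - t • e) =
        (ω (l 0).1 (l i.succ).1 + t) • e := by module
      rw [this]
      exact Submodule.smul_mem _ _ C.eR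
  push Not at han
  obtain ⟨v, hvD, hvv, hv0⟩ := han
  have hFv : F ∙ v ≤ D := by rw [Submodule.span_singleton_le_iff_mem]; exact hvD
  by_cases hvR : v ∈ R
  · obtain ⟨D', h1, h2⟩ := exists_compl (F ∙ v) D hFv
    rw [finrank_span_singleton hv0] at h2
    refine C.dep l (l 0).1 (l 0).2.2 (C.ef _) D' (by omega) fun i => ?_
    have h3 : R ⊔ D ≤ R ⊔ D' := by
      rw [← h1]
      refine sup_le le_sup_left (sup_le ?_ le_sup_right)
      rw [Submodule.span_singleton_le_iff_mem]; exact Submodule.mem_sup_left hvR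
    exact h3 (hlD i)
  have hperp : ∀ y ∈ D, y ∈ H.perp (R ⊔ F ∙ (l 0).1) := fun y hy => H.mem_perp_sup.2 ⟨hDR hy, hDf hy⟩
  have hfΔ : F ∙ (l 0).1 ≤ Δ' := by rw [Submodule.span_singleton_le_iff_mem]; exact (l 0).2.2
  by_cases hw : ∃ w ∈ D, ω v w ≠ 0
  · obtain ⟨w, hwD, hvw⟩ := hw
    have hFw : F ∙ w ≤ D := by rw [Submodule.span_singleton_le_iff_mem]; exact hwD
    obtain ⟨D', h1, h2⟩ := exists_compl (F ∙ v ⊔ F ∙ w) D (sup_le hFv hFw)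
    have hlt : F ∙ v < F ∙ v ⊔ F ∙ w := by
      refine lt_of_le_of_ne le_sup_left fun h => ?_
      have : w ∈ F ∙ v := by rw [h]; exact Submodule.mem_sup_right (Submodule.mem_span_singleton_self _)
      obtain ⟨c, rfl⟩ := Submodule.mem_span_singleton.1 this
      rw [H.smul_r, hvv, mul_zero] at hvw
      exact hvw rfl
    have h3 := Submodule.finrank_lt_finrank_of_lt hlt
    rw [finrank_span_singleton hv0] at h3
    have hwi := H.wi_sup D' (H.wi_two (H.wi_four C.hwi e (l 0).1 C.eR C.ep hf0.2.2) v w (hperp v hvD) (hperp w hwD) hvv hvw)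
    refine C.van l _ ?_ ?_ ?_ (H.wi_le hwi (by omega))
    · exact le_sup_left.trans (le_sup_left.trans le_sup_left)
    · rw [sup_assoc, h1]
      exact sup_le (sup_le C.hΔ hfΔ) hDΔ
    · intro i
      rw [sup_assoc, h1]
      exact hΔle (l i).2.2
  · push Not at hw
    refine C.iso_case l hl v (hDΔ hvD) (H.perp_anti hΔle ?_) hvR
    rw [H.mem_perp_sup]
    exact ⟨hperp v hvD, H.mem_perp'.2 hw⟩

end CSym

def CFam (H : Herm σ ω) (Δ₁ : Submodule F V) (e : V) : Fam ω (Δ₁ ⊔ F ∙ e) where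
  Ω s := {f | ω f f = 0 ∧ (∀ x : (Δ₁ ⊔ F ∙ e : Submodule F V), (x : V) ∈ Δ₁ → ω (s.φ x) f = 0) ∧
    ω (s.φ ⟨e, Submodule.mem_sup_right (Submodule.mem_span_singleton_self _)⟩) f = 1}
  eqv := by
    rintro g s v ⟨h1, h2, h3⟩
    exact ⟨(Herm.isom g _ _).trans h1, fun x hx => (Herm.isom g _ _).trans (h2 x hx), (Herm.isom g _ _).trans h3⟩

lemma CFam_base (H : Herm σ ω) (Δ₁ : Submodule F V) (e : V) (v : V) :
    v ∈ (CFam H Δ₁ e).Ω (TS.base ω (Δ₁ ⊔ F ∙ e)) ↔ ω v v = 0 ∧ v ∈ H.perp Δ₁ ∧ ω e v = 1 := by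
  constructor
  · rintro ⟨h1, h2, h3⟩
    exact ⟨h1, fun x hx => h2 ⟨x, Submodule.mem_sup_left hx⟩ hx, h3⟩
  · rintro ⟨h1, h2, h3⟩
    exact ⟨h1, fun x hx => h2 x hx, h3⟩

lemma CFam_ne (H : Herm σ ω) (Δ₁ : Submodule F V) (e : V) (he : e ∈ H.perp Δ₁) (hee : ω e e = 0) (hn : e ∉ Δ₁)
    (s : TS ω (Δ₁ ⊔ F ∙ e)) : ((CFam H Δ₁ e).Ω s).Nonempty := by
  obtain ⟨g, hg⟩ := s.ex
  obtain ⟨f, h1, h2, h3⟩ := exists_f H he hee hn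
  refine ⟨g • f, (Herm.isom g _ _).trans h2, fun x hx => ?_, ?_⟩
  · rw [hg]; exact (Herm.isom g _ _).trans (h1 x hx)
  · rw [hg]; exact (Herm.isom g _ _).trans h3

lemma CFam_ne2 (H : Herm σ ω) (Δ₁ : Submodule F V) (e : V) (he : e ∈ H.perp Δ₁) (hee : ω e e = 0) (hn : e ∉ Δ₁)
    (p : TP ω (Δ₁ ⊔ F ∙ e)) : ∃ v ∈ (CFam H Δ₁ e).Ω p.t, ω v p.E.e = 0 ∧ ω v p.E.f = 0 := by
  obtain ⟨g, hg⟩ := p.t.ex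
  obtain ⟨a, ha⟩ : ∃ a, a = g⁻¹ • p.E.e := ⟨_, rfl⟩
  obtain ⟨b, hb⟩ : ∃ b, b = g⁻¹ • p.E.f := ⟨_, rfl⟩
  have pe : a ∈ H.perp (Δ₁ ⊔ F ∙ e) := by
    intro x hx
    have := p.he ⟨x, hx⟩
    rw [hg] at this
    rw [← this, ha, Herm.isom' g⁻¹, inv_inv]
  have pf : b ∈ H.perp (Δ₁ ⊔ F ∙ e) := by
    intro x hx
    have := p.hf ⟨x, hx⟩
    rw [hg] at this
    rw [← this, hb, Herm.isom' g⁻¹, inv_inv]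
  have haa : ω a a = 0 := by rw [ha]; exact (Herm.isom g⁻¹ _ _).trans p.E.ee
  have hbb : ω b b = 0 := by rw [hb]; exact (Herm.isom g⁻¹ _ _).trans p.E.ff
  have hab : ω a b = 1 := by rw [ha, hb]; exact (Herm.isom g⁻¹ _ _).trans p.E.ef
  have hba : ω b a = 1 := by rw [H.symm a, hab, map_one]
  have hE : e ∈ Δ₁ ⊔ F ∙ e := Submodule.mem_sup_right (Submodule.mem_span_singleton_self _)
  obtain ⟨f, h1, h2, h3⟩ := exists_f H (Δ := Δ₁ ⊔ (F ∙ a ⊔ F ∙ b)) (e := e) (by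
    rw [H.mem_perp_sup, H.mem_perp_sup, H.mem_perp_span_singleton, H.mem_perp_span_singleton]
    exact ⟨he, H.eq_zero_symm (pe e hE), H.eq_zero_symm (pf e hE)⟩) hee (by
    intro h
    obtain ⟨x, hx, y, hy, hxy⟩ := Submodule.mem_sup.1 h
    obtain ⟨y1, hy1, y2, hy2, rfl⟩ := Submodule.mem_sup.1 hy
    obtain ⟨s, rfl⟩ := Submodule.mem_span_singleton.1 hy1
    obtain ⟨t, rfl⟩ := Submodule.mem_span_singleton.1 hy2
    have e1 : ω a e = 0 := H.eq_zero_symm (pe e hE)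
    have e2 : ω b e = 0 := H.eq_zero_symm (pf e hE)
    have e3 : ω a x = 0 := H.eq_zero_symm (pe x (Submodule.mem_sup_left hx))
    have e4 : ω b x = 0 := H.eq_zero_symm (pf x (Submodule.mem_sup_left hx))
    rw [← hxy] at e1 e2
    simp only [H.add_r, H.smul_r, e3, e4, haa, hbb, hab, hba, mul_zero, mul_one, zero_add, add_zero] at e1 e2
    subst e1 e2
    apply hn
    rw [← hxy]; simpa using hx)
  refine ⟨g • f, ⟨(Herm.isom g _ _).trans h2, fun x hx => ?_, ?_⟩, ?_, ?_⟩
  · rw [hg]; exact (Herm.isom g _ _).trans (h1 x (Submodule.mem_sup_left hx))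
  · rw [hg]; exact (Herm.isom g _ _).trans h3
  · have := h1 a (Submodule.mem_sup_right (Submodule.mem_sup_left (Submodule.mem_span_singleton_self _)))
    rw [ha, ← Herm.isom' g] at this
    exact H.eq_zero_symm this
  · have := h1 b (Submodule.mem_sup_right (Submodule.mem_sup_right (Submodule.mem_span_singleton_self _)))
    rw [hb, ← Herm.isom' g] at this
    exact H.eq_zero_symm this

lemma Cprop_step (H : Herm σ ω) (n : ℕ) (hI : ∀ b < n, IQ H b) (hTA : ∀ q < n, TAprop H q) : Cprop H n := by
  intro Δ₁ e he hee hne hwi A hA1 hA2 z hz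
  refine resolve H (CFam H Δ₁ e) (CFam_ne H Δ₁ e he hee hne) (CFam_ne2 H Δ₁ e he hee hne) n ?_ A ?_ z hz
  · intro k i hk hki η hη μ hμ
    obtain ⟨k, rfl⟩ : ∃ k', k = k' + 1 := ⟨k - 1, by omega⟩
    have ep : e ∈ H.perp (Δ₁ ⊔ F ∙ e) := by
      rw [H.mem_perp_sup, H.mem_perp_span_singleton]; exact ⟨he, hee⟩
    have hE : e ∈ Δ₁ ⊔ F ∙ e := Submodule.mem_sup_right (Submodule.mem_span_singleton_self _)
    have hwi' : H.wi (Δ₁ ⊔ F ∙ e ⊔ Submodule.span F (Set.range η)) i := by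
      have h0 := H.wi_four hwi e (η 0) hE ep ((CFam_base H Δ₁ e _).1 (hη 0)).2.2
      refine H.wi_mono (H.wi_le (H.wi_sup (Submodule.span F (Set.range fun r : Fin (k + 1) => η r.succ)) h0) ?_) ?_
      · have := finrank_span_fin_le (F := F) fun r : Fin (k + 1) => η r.succ
        omega
      · refine sup_le (le_sup_left.trans le_sup_left) (Submodule.span_le.2 ?_)
        rintro _ ⟨r, rfl⟩
        refine Fin.cases ?_ (fun r => ?_) r
        · exact Submodule.mem_sup_left (Submodule.mem_sup_right (Submodule.mem_span_singleton_self _))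
        · exact Submodule.mem_sup_right (Submodule.subset_span ⟨r, rfl⟩)
    have C : CSym H Δ₁ (Δ₁ ⊔ F ∙ e) e ((CFam H Δ₁ e).Ω (TS.base ω (Δ₁ ⊔ F ∙ e)))
        (Δ₁ ⊔ F ∙ e ⊔ Submodule.span F (Set.range η)) k i
        (Sg (CFam H Δ₁ e) le_sup_left μ) :=
      { hR := rfl
        ep := ep
        hΩ := CFam_base H Δ₁ e
        hΔ := le_sup_left
        hwi := H.wi_le hwi (by omega)
        coc := Sg_cocycle (CFam H Δ₁ e) le_sup_left μ hμ
        van := fun l Δ'' h1 h2 h3 h4 => Sg_vanish _ _ μ hμ l Δ'' h1 h2 h3 (hI i (by omega) _ h4)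
        inv := fun l l' g h1 h2 h3 => Sg_inv H _ _ (hTA i (by omega)) hwi' μ hμ l l' g h1 h2 h3 }
    have key := C.main (fun i => ⟨η i, hη i, sup_span_mem η i⟩) rfl
    exact (QuotientAddGroup.eq_zero_iff _).1 key
  · intro f hf μ hμ
    obtain ⟨h1, h2, h3⟩ := (CFam_base H Δ₁ e f).1 hf
    exact hA2 f h2 h1 h3 μ hμ

theorem IQ_all (H : Herm σ ω) (n : ℕ) : IQ H n := by
  suffices h : ∀ n, Cprop H n ∧ IQ H n from (h n).2
  intro n
  induction n using Nat.strong_induction_on with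
  | _ n ih =>
    have hC : Cprop H n := Cprop_step H n (fun b hb => (ih b hb).2) (fun q hq => TA_of_C H q (ih q hq).1)
    refine ⟨hC, ?_⟩
    rcases Nat.eq_zero_or_pos n with rfl | hn
    · exact IQ_zero H
    · exact IQ_succ H n hn (fun b hb => (ih b hb).2) (fun q hq => TA_of_C H q (ih q hq).1) hC

end cpart2

end HS

set_option linter.unusedVariables false
set_option linter.unusedSimpArgs false
set_option linter.unusedSectionVars false

namespace HS
open FreeAbelianGroup

section shapiro
variable {G K : Type} [Group G] [Group K] {P : Type} [MulAction G P]

/-- a transitive action together with an identification of a stabilizer -/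
structure Orb (φ : K →* G) (p₀ : P) where
  fix : ∀ k, φ k • p₀ = p₀
  inj : Function.Injective φ
  st : ∀ g : G, g • p₀ = p₀ → ∃ k, φ k = g
  c : P → G
  hc : ∀ p, c p • p₀ = p
  hc₀ : c p₀ = 1

namespace Orb
variable {φ : K →* G} {p₀ : P} (O : Orb φ p₀)

def Y (x : G) (p : P) : G := x * O.c (x⁻¹ • p)

lemma Y_smul (x : G) (p : P) : O.Y x p • p₀ = p := by
  simp [Y, mul_smul, O.hc]

lemma Y_mul (g x : G) (p : P) : O.Y (g * x) (g • p) = g * O.Y x p := by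
  simp [Y, mul_smul, mul_assoc]

lemma Y_fix (x : G) (h : x • p₀ = p₀) : O.Y x p₀ = x := by
  have : x⁻¹ • p₀ = p₀ := by rw [inv_smul_eq_iff, h]
  simp [Y, this, O.hc₀]

lemma exκ (x x' : G) (p : P) : ∃ k, φ k = (O.Y x p)⁻¹ * O.Y x' p :=
  O.st _ (by rw [mul_smul, Y_smul, inv_smul_eq_iff, Y_smul])

noncomputable def κ (x x' : G) (p : P) : K := (O.exκ x x' p).choose

lemma hκ (x x' : G) (p : P) : φ (O.κ x x' p) = (O.Y x p)⁻¹ * O.Y x' p := (O.exκ x x' p).choose_spec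

lemma κ_smul (g x x' : G) (p : P) : O.κ (g * x) (g * x') (g • p) = O.κ x x' p := by
  apply O.inj
  rw [hκ, hκ, Y_mul, Y_mul]
  group

lemma κ_mul (x x' x'' : G) (p : P) : O.κ x x' p * O.κ x' x'' p = O.κ x x'' p := by
  apply O.inj
  rw [map_mul, hκ, hκ, hκ]
  group

noncomputable def κs {q : ℕ} (x : Fin (q + 1) → G) (p : P) : Fin q → K :=
  fun i => O.κ (x i.castSucc) (x i.succ) p

lemma κs_contract {q : ℕ} (x : Fin (q + 2) → G) (p : P) (j : Fin (q + 1)) :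
    O.κs (fun i => x (j.succ.succAbove i)) p = Fin.contractNth j (· * ·) (O.κs x p) := by
  funext k
  rcases lt_trichotomy (k : ℕ) j with h | h | h
  · rw [Fin.contractNth_apply_of_lt _ _ _ _ h]
    show O.κ (x (j.succ.succAbove k.castSucc)) (x (j.succ.succAbove k.succ)) p = O.κ _ _ p
    have h1 : j.succ.succAbove k.castSucc = k.castSucc.castSucc :=
      Fin.succAbove_of_castSucc_lt _ _ (by simp [Fin.lt_def]; omega)
    have h2 : j.succ.succAbove k.succ = k.castSucc.succ := by
      rw [Fin.succAbove_of_castSucc_lt _ _ (by simp [Fin.lt_def]; omega)]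
      rfl
    rw [h1, h2]
  · rw [Fin.contractNth_apply_of_eq _ _ _ _ h]
    show O.κ (x (j.succ.succAbove k.castSucc)) (x (j.succ.succAbove k.succ)) p = O.κ _ _ p * O.κ _ _ p
    have h1 : j.succ.succAbove k.castSucc = k.castSucc.castSucc :=
      Fin.succAbove_of_castSucc_lt _ _ (by simp [Fin.lt_def]; omega)
    have h2 : j.succ.succAbove k.succ = k.succ.succ := by
      rw [Fin.succAbove_of_le_castSucc _ _ (by simp [Fin.le_def]; omega)]
    rw [h1, h2, ← Fin.succ_castSucc, κ_mul]
  · rw [Fin.contractNth_apply_of_gt _ _ _ _ h]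
    show O.κ (x (j.succ.succAbove k.castSucc)) (x (j.succ.succAbove k.succ)) p = O.κ _ _ p
    have h1 : j.succ.succAbove k.castSucc = k.succ.castSucc := by
      rw [Fin.succAbove_of_le_castSucc _ _ (by simp [Fin.le_def]; omega)]
      rfl
    have h2 : j.succ.succAbove k.succ = k.succ.succ := by
      rw [Fin.succAbove_of_le_castSucc _ _ (by simp [Fin.le_def]; omega)]
    rw [h1, h2]

noncomputable def rho (q : ℕ) : Ch G P (q + 1) →+ GroupHomologyBar.chains K ℤ q :=
  Ch.lift (fun x p => Finsupp.single (O.κs x p) (1 : ℤ)) (fun g x p => by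
    congr 1
    funext i
    exact O.κ_smul g _ _ p)

lemma rho_cel {q : ℕ} (x : Fin (q + 1) → G) (p : P) :
    O.rho q (cel x p) = Finsupp.single (O.κs x p) (1 : ℤ) :=
  Ch.lift_cel _ _ (fun h => absurd h (Nat.succ_ne_zero q)) x p

lemma d_cel {S : Type} [MulAction G S] {q : ℕ} (x : Fin (q + 1) → G) (p : S) :
    Ch.d (cel x p) = ∑ i : Fin (q + 1), (-1 : ℤ) ^ (i : ℕ) • (cel (fun j => x (i.succAbove j)) p : Ch G S q) := by
  rw [← push_of, Ch.d_push, bd_of, bdT, map_sum]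
  refine Finset.sum_congr rfl fun i _ => ?_
  rw [map_zsmul, push_of]

lemma rho_d {q : ℕ} (z : Ch G P (q + 2)) :
    O.rho q (Ch.d z) = GroupHomologyBar.d K ℤ q (O.rho (q + 1) z) := by
  induction z using Ch.ind with
  | h0 => simp
  | hc x p =>
    rw [d_cel, rho_cel, GroupHomologyBar.d_single, map_sum, Fin.sum_univ_succ]
    congr 1
    · simp only [Fin.val_zero, pow_zero, one_smul, Fin.zero_succAbove, map_zsmul, rho_cel]
      rfl
    · refine Finset.sum_congr rfl fun j _ => ?_
      rw [map_zsmul, rho_cel, κs_contract, Fin.val_succ]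
  | hn a ha => rw [map_neg, map_neg, map_neg, map_neg, ha]
  | ha a b ha hb => rw [map_add, map_add, map_add, map_add, ha, hb]

variable (φ p₀) in
noncomputable def bet (q : ℕ) : GroupHomologyBar.chains K ℤ q →+ Ch G P (q + 1) :=
  Finsupp.liftAddHom fun g => (zmultiplesHom _) (cel (Fin.partialProd (φ ∘ g)) p₀)

lemma bet_single {q : ℕ} (g : Fin q → K) :
    bet φ p₀ q (Finsupp.single g (1 : ℤ)) = cel (Fin.partialProd (φ ∘ g)) p₀ := by
  simp [bet]

lemma chains_ext {B : Type} [AddCommGroup B] {q : ℕ} (f g : GroupHomologyBar.chains K ℤ q →+ B)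
    (h : ∀ v, f (Finsupp.single v 1) = g (Finsupp.single v 1)) (z) : f z = g z := by
  have : f = g := by
    ext v
    exact h v
  rw [this]

lemma comp_contract {q : ℕ} (g : Fin (q + 1) → K) (j : Fin (q + 1)) :
    φ ∘ Fin.contractNth j (· * ·) g = Fin.contractNth j (· * ·) (φ ∘ g) := by
  funext k
  simp only [Function.comp_apply, Fin.contractNth]
  split_ifs <;> simp

lemma bet_d (O : Orb φ p₀) {q : ℕ} (z : GroupHomologyBar.chains K ℤ (q + 1)) :
    Ch.d (bet φ p₀ (q + 1) z) = bet φ p₀ q (GroupHomologyBar.d K ℤ q z) := by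
  refine chains_ext ((Ch.d).comp (bet φ p₀ (q + 1))) ((bet φ p₀ q).comp (GroupHomologyBar.d K ℤ q).toAddMonoidHom) ?_ z
  intro g
  show Ch.d (bet φ p₀ (q + 1) _) = bet φ p₀ q (GroupHomologyBar.d K ℤ q _)
  rw [bet_single, GroupHomologyBar.d_single, d_cel, Fin.sum_univ_succ, map_add, map_sum]
  congr 1
  · rw [bet_single, Fin.val_zero, pow_zero, one_smul, ← cel_smul (φ (g 0)) (Fin.partialProd (φ ∘ Fin.tail g)), O.fix]
    congr 1
    funext i
    rw [Fin.zero_succAbove, Fin.partialProd_succ']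
    rfl
  · refine Finset.sum_congr rfl fun j _ => ?_
    rw [map_zsmul, bet_single, comp_contract, Fin.partialProd_contractNth, Fin.val_succ]
    rfl

lemma rho_bet {q : ℕ} (z : GroupHomologyBar.chains K ℤ q) : O.rho q (bet φ p₀ q z) = z := by
  refine chains_ext ((O.rho q).comp (bet φ p₀ q)) (AddMonoidHom.id _) ?_ z
  intro g
  show O.rho q (bet φ p₀ q _) = _
  rw [bet_single, rho_cel]
  show _ = Finsupp.single g (1 : ℤ)
  congr 1
  funext i
  apply O.inj
  have hfix : ∀ i : Fin (q + 1), Fin.partialProd (φ ∘ g) i • p₀ = p₀ := by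
    intro i
    induction i using Fin.induction with
    | zero => simp
    | succ i ih => rw [Fin.partialProd_succ, mul_smul]; rw [Function.comp_apply, O.fix, ih]
  rw [κs, hκ, Y_fix _ _ (hfix _), Y_fix _ _ (hfix _), Fin.partialProd_right_inv]
  rfl

lemma bet_rho {q : ℕ} (z : Ch G P (q + 1)) :
    bet φ p₀ q (O.rho q z) = Ch.vert O.Y O.Y_mul z := by
  induction z using Ch.ind with
  | h0 => simp
  | hc x p =>
    rw [rho_cel, bet_single, ← push_of p x, Ch.vert_push, tmap_of, push_of]
    have hp : ∀ i : Fin (q + 1), O.Y (x 0) p * Fin.partialProd (φ ∘ O.κs x p) i = O.Y (x i) p := by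
      intro i
      induction i using Fin.induction with
      | zero => simp
      | succ i ih =>
        rw [Fin.partialProd_succ, ← mul_assoc, ih, Function.comp_apply, κs, hκ]
        group
    rw [← cel_smul (O.Y (x 0) p), Y_smul]
    congr 1
    funext i
    exact hp i
  | hn a ha => rw [map_neg, map_neg, map_neg, ha]
  | ha a b ha hb => rw [map_add, map_add, map_add, ha, hb]

end Orb

variable {S : Type} [MulAction G S]

lemma map_bet (φ : K →* G) (p₀ : P) (f : P → S) (hf : ∀ (g : G) s, f (g • s) = g • f s) {q : ℕ}
    (z : GroupHomologyBar.chains K ℤ q) :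
    Ch.map f hf (Orb.bet φ p₀ q z)
      = Orb.bet (MonoidHom.id G) (f p₀) q (GroupHomologyBar.chainsMap ℤ φ q z) := by
  refine Orb.chains_ext ((Ch.map f hf).comp (Orb.bet φ p₀ q))
    ((Orb.bet (MonoidHom.id G) (f p₀) q).comp (GroupHomologyBar.chainsMap ℤ φ q).toAddMonoidHom) ?_ z
  intro g
  show Ch.map f hf (Orb.bet φ p₀ q _) = Orb.bet _ _ q (GroupHomologyBar.chainsMap ℤ φ q _)
  rw [GroupHomologyBar.chainsMap_single, Orb.bet_single, Orb.bet_single, Ch.map_cel]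
  rfl


lemma surj_core {φ : K →* G} {p₀ : P} (O : Orb φ p₀) (f : P → S)
    (hf : ∀ (g : G) s, f (g • s) = g • f s) (OS : Orb (MonoidHom.id G) (f p₀)) (q : ℕ)
    (hI : ∀ u : Ch G S (q + 1), Ch.dd (q + 1) u = 0 →
      ∃ (a : Ch G S (q + 2)) (b : Ch G P (q + 1)), Ch.d a + Ch.map f hf b = u ∧ Ch.dd (q + 1) b = 0) :
    Function.Surjective (GroupHomologyBar.inducedMap ℤ φ q) := by
  intro h
  obtain ⟨⟨x, hx⟩, rfl⟩ := Submodule.Quotient.mk_surjective _ h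
  have hcyc : Ch.dd (q + 1) (Orb.bet (MonoidHom.id G) (f p₀) q x) = 0 := by
    cases q with
    | zero => exact Subsingleton.elim (α := Ch G S 0) _ _
    | succ q =>
      refine (OS.bet_d x).trans ?_
      have hx' : GroupHomologyBar.d G ℤ q x = 0 := hx
      rw [hx', map_zero]
  obtain ⟨a, b, hab, hb⟩ := hI _ hcyc
  have hcy : O.rho q b ∈ GroupHomologyBar.cycles K ℤ q := by
    cases q with
    | zero => trivial
    | succ q =>
      show GroupHomologyBar.d K ℤ q _ = 0
      rw [← O.rho_d]
      have hb' : Ch.d b = 0 := hb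
      rw [hb', map_zero]
  have hv := Ch.d_pri_of_cycle O.Y O.Y_mul b hb
  rw [← O.bet_rho] at hv
  refine ⟨Submodule.Quotient.mk ⟨O.rho q b, hcy⟩, ?_⟩
  refine (Submodule.Quotient.eq _).2 ?_
  show GroupHomologyBar.chainsMap ℤ φ q (O.rho q b) - x ∈ LinearMap.range (GroupHomologyBar.d G ℤ q)
  refine ⟨OS.rho (q + 1) (Ch.map f hf (Ch.pri O.Y O.Y_mul b) - a), ?_⟩
  rw [← OS.rho_d, map_sub, Ch.d_map, hv, map_sub, map_sub, map_bet]
  have : Ch.map f hf b = Orb.bet (MonoidHom.id G) (f p₀) q x - Ch.d a := by rw [← hab]; abel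
  rw [this, map_sub, map_sub, OS.rho_bet, OS.rho_bet]
  abel

lemma inj_core {φ : K →* G} {p₀ : P} (O : Orb φ p₀) (f : P → S)
    (hf : ∀ (g : G) s, f (g • s) = g • f s) (OS : Orb (MonoidHom.id G) (f p₀)) (q : ℕ)
    (hI : ∀ (u : Ch G S (q + 2)) (v : Ch G P (q + 1)), Ch.d u + Ch.map f hf v = 0 → Ch.dd (q + 1) v = 0 →
      ∃ b : Ch G P (q + 2), - Ch.d b = v) :
    Function.Injective (GroupHomologyBar.inducedMap ℤ φ q) := by
  rw [injective_iff_map_eq_zero]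
  intro h hh
  obtain ⟨⟨z, hz⟩, rfl⟩ := Submodule.Quotient.mk_surjective _ h
  have h1 : GroupHomologyBar.chainsMap ℤ φ q z ∈ LinearMap.range (GroupHomologyBar.d G ℤ q) :=
    (Submodule.Quotient.mk_eq_zero (GroupHomologyBar.boundaries G ℤ q)
      (x := GroupHomologyBar.cyclesMap ℤ φ q ⟨z, hz⟩)).1 hh
  obtain ⟨x, hx⟩ := h1
  obtain ⟨b, hb⟩ := hI (Orb.bet (MonoidHom.id G) (f p₀) (q + 1) x) (- Orb.bet φ p₀ q z) (by
      rw [OS.bet_d, map_neg, map_bet, hx, add_neg_cancel]) (by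
      rw [map_neg, neg_eq_zero]
      cases q with
      | zero => exact Subsingleton.elim (α := Ch G P 0) _ _
      | succ q =>
        refine (O.bet_d z).trans ?_
        have hz' : GroupHomologyBar.d K ℤ q z = 0 := hz
        rw [hz', map_zero])
  refine (Submodule.Quotient.mk_eq_zero _).2 ?_
  show z ∈ LinearMap.range (GroupHomologyBar.d K ℤ q)
  refine ⟨O.rho (q + 1) b, ?_⟩
  rw [← O.rho_d, neg_injective hb, O.rho_bet]

end shapiro

end HS

set_option linter.unusedVariables false
set_option linter.unusedSimpArgs false
set_option linter.unusedSectionVars false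

namespace HS
open FreeAbelianGroup

section final
variable {F : Type} [Field F] {σ : F →+* F}

lemma SF_wi {n : ℕ} (H : Herm σ (SF σ n)) : H.wi ⊥ n := by
  let i : (Fin n → F) →ₗ[F] (Fin n → F × F) :=
    { toFun := fun x j => (x j, 0)
      map_add' := fun x y => by funext j; simp
      map_smul' := fun c x => by funext j; simp }
  have hi : Function.Injective i := fun x y h => by
    funext j
    exact congrArg Prod.fst (congrFun h j)
  refine ⟨LinearMap.range i, ?_, ?_, ?_, ?_⟩
  · intro x _
    rw [H.mem_perp]
    intro y hy
    rw [Submodule.mem_bot] at hy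
    subst hy
    exact H.zero_l _
  · rintro _ ⟨x, rfl⟩ _ ⟨y, rfl⟩
    simp [SF, pairForm, hermPair, i]
  · intro a _ ha
    exact (Submodule.mem_bot F).1 ha
  · rw [LinearMap.finrank_range_of_inj hi]
    simp

lemma SF_single_l {n : ℕ} (i : Fin n) (a : F × F) (y : Fin n → F × F) :
    SF σ n (Pi.single i a) y = σ a.1 * (y i).2 + σ a.2 * (y i).1 := by
  simp only [SF, pairForm, hermPair]
  rw [Finset.sum_eq_single i (fun j _ hj => by simp [Pi.single_eq_of_ne hj]) (by simp)]
  simp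

/-- the last standard pair, as a configuration over the zero subspace -/
def pt (hinv : ∀ x, σ (σ x) = x) (hne : ∃ a, σ a ≠ a) (n : ℕ) : TP (SF σ (n + 1)) ⊥ where
  t := TS.base _ _
  E := stdP σ (Fin.last n)
  he := fun x => by
    have : (TS.base (SF σ (n + 1)) ⊥).φ x = 0 := (Submodule.mem_bot F).1 x.2
    rw [this]
    exact (SF_herm hinv hne (n + 1)).zero_l _
  hf := fun x => by
    have : (TS.base (SF σ (n + 1)) ⊥).φ x = 0 := (Submodule.mem_bot F).1 x.2
    rw [this]
    exact (SF_herm hinv hne (n + 1)).zero_l _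

lemma TS_bot_eq {V : Type} [AddCommGroup V] [Module F V] {ω : V → V → F} (a b : TS ω (⊥ : Submodule F V)) :
    a = b := by
  obtain ⟨g, hg⟩ := a.ex
  obtain ⟨h, hh⟩ := b.ex
  refine TS.ext' fun x => ?_
  have : (x : V) = 0 := (Submodule.mem_bot F).1 x.2
  rw [hg, hh, this]
  have e : ∀ k : bilinIsoms F ω, k • (0 : V) = 0 := fun k => map_zero k.1
  rw [e, e]

lemma split_eq {n : ℕ} (x : Fin (n + 1) → F × F) :
    ∃ p w, x = (lastSplit F n).symm (p, w) :=
  ⟨(lastSplit F n x).1, (lastSplit F n x).2, ((lastSplit F n).symm_apply_apply x).symm⟩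

lemma single_last {n : ℕ} (w : F × F) :
    (Pi.single (Fin.last n) w : Fin (n + 1) → F × F) = (lastSplit F n).symm (0, w) := by
  rw [lastSplit_symm_apply]
  funext i
  refine Fin.lastCases ?_ (fun j => ?_) i
  · simp
  · simp [Pi.single_eq_of_ne (Fin.castSucc_ne_last j)]

lemma symm_last {n : ℕ} (p : Fin n → F × F) (w : F × F) :
    (lastSplit F n).symm (p, w) (Fin.last n) = w := by
  rw [lastSplit_symm_apply]
  simp

lemma stab_smul {n : ℕ} (k : bilinIsoms F (SF σ n)) (p : Fin n → F × F) (w : F × F) :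
    bilinStab F (hermPair F σ) n k • (lastSplit F n).symm (p, w) = (lastSplit F n).symm (k • p, w) :=
  stabAut_symm_apply F n k.1 p w

lemma stab_inj (n : ℕ) : Function.Injective (bilinStab F (hermPair F σ) n) := by
  intro k k' h
  refine Subtype.ext (LinearEquiv.ext fun p => ?_)
  have h1 := stab_smul k p 0
  rw [h, stab_smul] at h1
  exact (congrArg Prod.fst ((lastSplit F n).symm.injective h1)).symm

lemma stab_pt (hinv : ∀ x, σ (σ x) = x) (hne : ∃ a, σ a ≠ a) (n : ℕ) (k : bilinIsoms F (SF σ n)) :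
    bilinStab F (hermPair F σ) n k • pt hinv hne n = pt hinv hne n := by
  have e : ∀ w : F × F, bilinStab F (hermPair F σ) n k • (Pi.single (Fin.last n) w : Fin (n + 1) → F × F)
      = Pi.single (Fin.last n) w := by
    intro w
    rw [single_last, stab_smul]
    congr 2
    exact map_zero k.1
  exact TP.ext' (TS_bot_eq _ _) (HPr.ext (e _) (e _))

set_option synthInstance.maxHeartbeats 400000 in
lemma fix_perp (n : ℕ) (g : bilinIsoms F (SF σ (n + 1)))
    (he : g • (stdP σ (Fin.last n)).e = (stdP σ (Fin.last n)).e)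
    (hf : g • (stdP σ (Fin.last n)).f = (stdP σ (Fin.last n)).f) (p : Fin n → F × F) :
    ∃ p', g • (lastSplit F n).symm (p, 0) = (lastSplit F n).symm (p', 0) := by
  obtain ⟨p', w, h⟩ := split_eq (g • (lastSplit F n).symm (p, (0 : F × F)))
  refine ⟨p', ?_⟩
  rw [h]
  have h1 := Herm.isom g (stdP σ (Fin.last n)).e ((lastSplit F n).symm (p, (0 : F × F)))
  have h2 := Herm.isom g (stdP σ (Fin.last n)).f ((lastSplit F n).symm (p, (0 : F × F)))
  rw [he, h] at h1
  rw [hf, h] at h2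
  simp only [stdP] at h1 h2
  rw [SF_single_l, SF_single_l, symm_last, symm_last] at h1 h2
  simp at h1 h2
  rw [show w = 0 from Prod.ext h2 h1]

set_option synthInstance.maxHeartbeats 400000 in
lemma stab_surj (n : ℕ) (g : bilinIsoms F (SF σ (n + 1)))
    (he : g • (stdP σ (Fin.last n)).e = (stdP σ (Fin.last n)).e)
    (hf : g • (stdP σ (Fin.last n)).f = (stdP σ (Fin.last n)).f) :
    ∃ k, bilinStab F (hermPair F σ) n k = g := by
  have he' : g⁻¹ • (stdP σ (Fin.last n)).e = (stdP σ (Fin.last n)).e := by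
    rw [inv_smul_eq_iff, he]
  have hf' : g⁻¹ • (stdP σ (Fin.last n)).f = (stdP σ (Fin.last n)).f := by
    rw [inv_smul_eq_iff, hf]
  choose a ha using fix_perp n g he hf
  choose b hb using fix_perp n g⁻¹ he' hf'
  have inj : ∀ {p p' : Fin n → F × F}, (lastSplit F n).symm (p, (0 : F × F)) = (lastSplit F n).symm (p', 0) → p = p' :=
    fun h => congrArg Prod.fst ((lastSplit F n).symm.injective h)
  let k : (Fin n → F × F) ≃ₗ[F] (Fin n → F × F) :=
    { toFun := a
      invFun := b
      left_inv := fun p => inj (by rw [← hb, ← ha, inv_smul_smul])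
      right_inv := fun p => inj (by rw [← ha, ← hb, smul_inv_smul])
      map_add' := fun p p' => inj (by
        rw [← ha]
        have e1 : ∀ p p' : Fin n → F × F, (lastSplit F n).symm (p + p', (0 : F × F))
            = (lastSplit F n).symm (p, 0) + (lastSplit F n).symm (p', 0) := fun p p' => by
          rw [← map_add, Prod.mk_add_mk, add_zero]
        rw [e1, e1, ← ha, ← ha]
        exact Herm.smul_add' g _ _)
      map_smul' := fun c p => inj (by
        rw [← ha]
        have e1 : ∀ p : Fin n → F × F, (lastSplit F n).symm (c • p, (0 : F × F))
            = c • (lastSplit F n).symm (p, 0) := fun p => by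
          rw [← map_smul, Prod.smul_mk, smul_zero]
        rw [RingHom.id_apply, e1, e1, ← ha]
        exact map_smul g.1 c _) }
  have hk : ∀ v w, SF σ n (k v) (k w) = SF σ n v w := by
    intro v w
    have h1 := pairForm_snoc F (hermPair F σ) n (k v) (k w) 0 0
    have h2 := pairForm_snoc F (hermPair F σ) n v w 0 0
    have h3 := Herm.isom g ((lastSplit F n).symm (v, (0 : F × F))) ((lastSplit F n).symm (w, (0 : F × F)))
    rw [ha, ha] at h3
    have h4 := h1.symm.trans (h3.trans h2)
    exact add_right_cancel h4
  refine ⟨⟨k, hk⟩, Subtype.ext (LinearEquiv.ext fun x => ?_)⟩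
  obtain ⟨p, w, rfl⟩ := split_eq x
  show bilinStab F (hermPair F σ) n ⟨k, hk⟩ • (lastSplit F n).symm (p, w) = g • (lastSplit F n).symm (p, w)
  rw [stab_smul]
  have dec : ∀ p : Fin n → F × F, (lastSplit F n).symm (p, w)
      = (lastSplit F n).symm (p, 0) + (w.1 • (stdP σ (Fin.last n)).e + w.2 • (stdP σ (Fin.last n)).f) := by
    intro p
    simp only [stdP]
    rw [single_last, single_last, ← map_smul, ← map_smul, ← map_add, ← map_add]
    congr 1
    ext <;> simp
  rw [dec, dec p]
  have e2 : ∀ x y, g • (x + y) = g • x + g • y := fun x y => map_add g.1 x y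
  have e3 : ∀ (c : F) x, g • (c • x) = c • (g • x) := fun c x => map_smul g.1 c x
  rw [e2, e2, e3, e3, he, hf, ha]
  rfl

lemma HPr_indep {V : Type} [AddCommGroup V] [Module F V] {ω : V → V → F} (H : Herm σ ω) (E : HPr ω) :
    LinearIndependent F ![E.e, E.f] := by
  rw [LinearIndependent.pair_iff]
  intro s t h
  have h1 : ω E.e (s • E.e + t • E.f) = 0 := by rw [h, H.zero_r]
  have h2 : ω E.f (s • E.e + t • E.f) = 0 := by rw [h, H.zero_r]
  have hfe : ω E.f E.e = 1 := by rw [H.symm E.e E.f, E.ef, map_one]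
  rw [H.add_r, H.smul_r, H.smul_r, E.ee, E.ef] at h1
  rw [H.add_r, H.smul_r, H.smul_r, hfe, E.ff] at h2
  constructor
  · simpa using h2
  · simpa using h1

lemma HPr_trans {V : Type} [AddCommGroup V] [Module F V] [FiniteDimensional F V] {ω : V → V → F}
    (H : Herm σ ω) (E E' : HPr ω) : ∃ g : bilinIsoms F ω, g • E = E' := by
  have hfe : ∀ E : HPr ω, ω E.f E.e = 1 := fun E => by rw [H.symm E.e E.f, E.ef, map_one]
  obtain ⟨l, hl, hl'⟩ := H.witt 2 ![E.e, E.f] ![E'.e, E'.f] (HPr_indep H E) (HPr_indep H E') (by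
    intro i j
    fin_cases i <;> fin_cases j <;> simp [E.ee, E.ff, E.ef, E'.ee, E'.ff, E'.ef, hfe])
  obtain ⟨g, hg⟩ := H.exists_rchainG l hl
  exact ⟨g, HPr.ext ((hg _).trans (hl' 0)) ((hg _).trans (hl' 1))⟩

lemma exists_orb (hinv : ∀ x, σ (σ x) = x) (hne : ∃ a, σ a ≠ a) (n : ℕ) :
    Nonempty (Orb (bilinStab F (hermPair F σ) n) (pt hinv hne n)) := by
  have htr : ∀ p : TP (SF σ (n + 1)) ⊥, ∃ g : bilinIsoms F (SF σ (n + 1)), g • pt hinv hne n = p := by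
    intro p
    obtain ⟨g, hg⟩ := HPr_trans (SF_herm hinv hne (n + 1)) (pt hinv hne n).E p.E
    exact ⟨g, TP.ext' (TS_bot_eq _ _) hg⟩
  choose c hc using htr
  refine ⟨⟨stab_pt hinv hne n, stab_inj n, ?_, fun p => c p * (c (pt hinv hne n))⁻¹, ?_, mul_inv_cancel _⟩⟩
  · intro g hg
    have hE : g • (stdP σ (Fin.last n)) = stdP σ (Fin.last n) := congrArg TP.E hg
    exact stab_surj n g (congrArg HPr.e hE) (congrArg HPr.f hE)
  · intro p
    have : (c (pt hinv hne n))⁻¹ • pt hinv hne n = pt hinv hne n := by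
      rw [inv_smul_eq_iff, hc]
    rw [mul_smul, this, hc]

def orbS {V : Type} [AddCommGroup V] [Module F V] {ω : V → V → F} (s : TS ω (⊥ : Submodule F V)) :
    Orb (MonoidHom.id (bilinIsoms F ω)) s where
  fix _ := TS_bot_eq _ _
  inj := fun _ _ h => h
  st := fun g _ => ⟨g, rfl⟩
  c := fun _ => 1
  hc := fun _ => TS_bot_eq _ _
  hc₀ := rfl

lemma rel_surj {G : Type} [Group G] (X : GP G) (q : ℕ)
    (hI : ∀ z : Rel X (q + 1), Rel.d z = 0 → ∃ w : Rel X (q + 2), Rel.d w = z) :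
    ∀ u : Ch G X.S (q + 1), Ch.dd (q + 1) u = 0 →
      ∃ (a : Ch G X.S (q + 2)) (b : Ch G X.P (q + 1)),
        Ch.d a + Ch.map X.f X.hf b = u ∧ Ch.dd (q + 1) b = 0 := by
  intro u hu
  have hu' : Ch.d u = 0 := hu
  obtain ⟨⟨a, b⟩, hw⟩ := hI (u, (0 : Ch G X.P q)) (Rel.ext (by
    show Ch.d u + Ch.map X.f X.hf (0 : Ch G X.P q) = 0
    rw [map_zero, add_zero, hu']) (by
    show - Ch.dd q (0 : Ch G X.P q) = 0
    rw [map_zero, neg_zero]))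
  refine ⟨a, b, congrArg Prod.fst hw, ?_⟩
  have h2 : - Ch.dd (q + 1) (b : Ch G X.P (q + 1)) = 0 := congrArg Prod.snd hw
  exact neg_eq_zero.1 h2

lemma rel_inj {G : Type} [Group G] (X : GP G) (q : ℕ)
    (hI : ∀ z : Rel X (q + 2), Rel.d z = 0 → ∃ w : Rel X (q + 3), Rel.d w = z) :
    ∀ (u : Ch G X.S (q + 2)) (v : Ch G X.P (q + 1)),
      Ch.d u + Ch.map X.f X.hf v = 0 → Ch.dd (q + 1) v = 0 →
      ∃ b : Ch G X.P (q + 2), - Ch.d b = v := by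
  intro u v h1 h2
  obtain ⟨⟨a, b⟩, hw⟩ := hI (u, v) (Rel.ext h1 (by
    show - Ch.dd (q + 1) v = 0
    rw [h2, neg_zero]))
  exact ⟨b, congrArg Prod.snd hw⟩

theorem main (hinv : ∀ x, σ (σ x) = x) (hne : σ ≠ RingHom.id F) (n : ℕ) (hn : 1 ≤ n) :
    (∀ d : ℕ, d ≤ n - 1 → Function.Bijective
        (GroupHomologyBar.inducedMap ℤ (bilinStab F (hermPair F σ) n) d)) ∧
      Function.Surjective (GroupHomologyBar.inducedMap ℤ (bilinStab F (hermPair F σ) n) n) := by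
  have hne' : ∃ a, σ a ≠ a := by
    by_contra h
    push Not at h
    exact hne (RingHom.ext h)
  have H := SF_herm hinv hne' (n + 1)
  obtain ⟨O⟩ := exists_orb hinv hne' n
  have hI : ∀ b, b ≤ n → Iprop (SF σ (n + 1)) ⊥ b := fun b hb =>
    IQ_all H b ⊥ (H.wi_le (SF_wi H) (by omega))
  have hs : ∀ b, b ≤ n →
      Function.Surjective (GroupHomologyBar.inducedMap ℤ (bilinStab F (hermPair F σ) n) b) :=
    fun b hb => surj_core O (fun p => p.t) (fun _ _ => rfl) (orbS _) b (rel_surj (TT (SF σ (n + 1)) ⊥) b (hI b hb))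
  refine ⟨fun d hd => ⟨?_, hs d (by omega)⟩, hs n le_rfl⟩
  exact inj_core O (fun p => p.t) (fun _ _ => rfl) (orbS _) d (rel_inj (TT (SF σ (n + 1)) ⊥) d (hI (d + 1) (by omega)))

end final

end HS

open GroupHomologyBar in
/-- Homological stability for the hyperbolic unitary groups over a field other than `𝔽₂`
with a nontrivial involution `σ`.  Here `U_{n,n}(F,σ)` is realized as the group
`bilinIsoms F (pairForm F (hermPair F σ) n)` of linear automorphisms of `F^{2n} = (F²)ⁿ`
preserving the nondegenerate hyperbolic Hermitian form
`ω(v, w) = ∑ᵢ (σ(vᵢ) w_{n+i} + σ(v_{n+i}) wᵢ)`, where the `i`-th copy of `F²` carries the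
pair of coordinates `(vᵢ, v_{n+i})`.  The stabilization map
`U_{n,n}(F,σ) → U_{n+1,n+1}(F,σ)`, extending an automorphism by the identity on an added
hyperbolic plane, induces an isomorphism on integral group homology `H_d` for `d ≤ n - 1`
and a surjection for `d = n`. -/
theorem U_homology_stability (F : Type) [Field F] (hF : ∃ x : F, x ≠ 0 ∧ x ≠ 1)
    (σ : F →+* F) (hinv : ∀ x, σ (σ x) = x) (hne : σ ≠ RingHom.id F)
    (n : ℕ) (hn : 1 ≤ n) :
    (∀ d : ℕ, d ≤ n - 1 →
      Function.Bijective (inducedMap ℤ (bilinStab F (hermPair F σ) n) d)) ∧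
    Function.Surjective (inducedMap ℤ (bilinStab F (hermPair F σ) n) n) := by
  exact HS.main hinv hne n hn
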